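/- arXiv:2411.07908 — 5 statements merged into one kernel-verified Lean document; each statement's English description precedes it below -/
import Mathlib

section
/- Let m ≥ k ≥ 2 and e ≥ 2 be fixed integers and let J be a k-graph on m vertices. For every ε > 0 there exists n_0 such that for all n ≥ n_0, there exists a J-packing P = {(V(J_i), J_i) : i ∈ [|P|]} in C([n], k) satisfying: (i) P is induced; (ii) the m-graph V = {V(J_i) : i ∈ [|P|]} is (ℓm − (ℓ−1)k − 1, ℓ)-free for all 2 ≤ ℓ ≤ e; and (iii) |P| ≥ (1−ε) · C(n, k)/|J|. -/
open Finset

variable {α : Type*} {β : Type*}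

/-- An `r`-graph `H` is `t`-cancellative if for any subfamily `𝒜 ⊆ H` of at most `t` edges and
any two further distinct edges `B, C ∈ H` not in `𝒜`, the symmetric difference of `B` and `C`
is not contained in the union of the edges of `𝒜`. -/
def IsCancellative [DecidableEq α] (t : ℕ) (H : Finset (Finset α)) : Prop :=
  ∀ 𝒜 ⊆ H, 𝒜.card ≤ t → ∀ B ∈ H, ∀ C ∈ H, B ∉ 𝒜 → C ∉ 𝒜 → B ≠ C →
    ¬((B \ C) ∪ (C \ B) ⊆ 𝒜.sup id)

/-- An `r`-graph `H` is `t`-union-free if any two distinct nonempty subfamilies of `H`, each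
consisting of at most `t` edges, have distinct unions. -/
def IsUnionFree [DecidableEq α] (t : ℕ) (H : Finset (Finset α)) : Prop :=
  ∀ 𝒜 ⊆ H, ∀ ℬ ⊆ H, 𝒜.Nonempty → ℬ.Nonempty → 𝒜.card ≤ t → ℬ.card ≤ t → 𝒜 ≠ ℬ →
    𝒜.sup id ≠ ℬ.sup id

/-- An `r`-graph `H` is `t`-cover-free if no edge of `H` is contained in the union of at most
`t` other edges of `H`. -/
def IsCoverFree [DecidableEq α] (t : ℕ) (H : Finset (Finset α)) : Prop :=
  ∀ 𝒜 ⊆ H, 𝒜.card ≤ t → ∀ B ∈ H, B ∉ 𝒜 → ¬(B ⊆ 𝒜.sup id)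

/-- `H` is `(v, e)`-free if any `e` distinct edges of `H` have union of size at least `v + 1`. -/
def IsVEFree [DecidableEq α] (v e : ℕ) (H : Finset (Finset α)) : Prop :=
  ∀ 𝒜 ⊆ H, 𝒜.card = e → v + 1 ≤ (𝒜.sup id).card

/-- The `k`-shadow of `F`: all `k`-subsets of the vertex set contained in some edge of `F`. -/
def kShadow [DecidableEq α] (k : ℕ) (F : Finset (Finset α)) : Finset (Finset α) :=
  F.sup fun A => Finset.powersetCard k A

/-- `J'` is a copy of `J`: the image of `J` under a map injective on the vertex set of `J`. -/
def IsCopyOf [DecidableEq α] [DecidableEq β] (J' : Finset (Finset β))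
    (J : Finset (Finset α)) : Prop :=
  ∃ f : α → β, Set.InjOn f ↑(J.sup id) ∧ J' = J.image fun A => A.image f

/-- The matching number of `H` is at most `b`: every subfamily of pairwise disjoint edges
has at most `b` members. -/
def MatchingNumberLE [DecidableEq α] (H : Finset (Finset α)) (b : ℕ) : Prop :=
  ∀ M ⊆ H, (∀ A ∈ M, ∀ B ∈ M, A ≠ B → Disjoint A B) → M.card ≤ b

/-- `C_t(n, r)`: the maximum number of edges in an `n`-vertex `t`-cancellative `r`-graph. -/
noncomputable def maxCancellative (t n r : ℕ) : ℕ :=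
  sSup {N | ∃ H : Finset (Finset (Fin n)),
    (∀ e ∈ H, e.card = r) ∧ IsCancellative t H ∧ H.card = N}

/-- `U_t(n, r)`: the maximum number of edges in an `n`-vertex `t`-union-free `r`-graph. -/
noncomputable def maxUnionFree (t n r : ℕ) : ℕ :=
  sSup {N | ∃ H : Finset (Finset (Fin n)),
    (∀ e ∈ H, e.card = r) ∧ IsUnionFree t H ∧ H.card = N}

/-- `F_t(n, r)`: the maximum number of edges in an `n`-vertex `t`-cover-free `r`-graph. -/
noncomputable def maxCoverFree (t n r : ℕ) : ℕ :=
  sSup {N | ∃ H : Finset (Finset (Fin n)),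
    (∀ e ∈ H, e.card = r) ∧ IsCoverFree t H ∧ H.card = N}

section BernoulliExpectation

variable {ι κ : Type*} [Fintype ι] [DecidableEq ι]

/-- Expectation of `f X` when `X` is the random subset of `ι` containing every element
independently with probability `p`. -/
noncomputable def bernExp (p : ℝ) (f : Finset ι → ℝ) : ℝ :=
  ∑ X : Finset ι, p ^ #X * (1 - p) ^ #Xᶜ * f X

lemma bernExp_add (p : ℝ) (f g : Finset ι → ℝ) :
    bernExp p (fun X => f X + g X) = bernExp p f + bernExp p g := by
  simp [bernExp, mul_add, sum_add_distrib]

lemma bernExp_const_mul (p c : ℝ) (f : Finset ι → ℝ) :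
    bernExp p (fun X => c * f X) = c * bernExp p f := by
  simp only [bernExp, mul_sum]
  exact sum_congr rfl fun X _ => by ring

lemma bernExp_sum (p : ℝ) (s : Finset κ) (f : κ → Finset ι → ℝ) :
    bernExp p (fun X => ∑ i ∈ s, f i X) = ∑ i ∈ s, bernExp p (f i) := by
  simp only [bernExp, mul_sum]
  exact sum_comm

lemma bernExp_mono {p : ℝ} (hp0 : 0 ≤ p) (hp1 : p ≤ 1) {f g : Finset ι → ℝ}
    (h : ∀ X, f X ≤ g X) : bernExp p f ≤ bernExp p g :=
  sum_le_sum fun X _ => mul_le_mul_of_nonneg_left (h X)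
    (mul_nonneg (pow_nonneg hp0 _) (pow_nonneg (by linarith) _))

lemma bernExp_indicator (p : ℝ) {A B : Finset ι} (h : Disjoint A B) :
    bernExp p (fun X => if A ⊆ X ∧ Disjoint B X then 1 else 0) = p ^ #A * (1 - p) ^ #B := by
  classical
  have key := prod_add (fun i => if i ∈ B then (0 : ℝ) else p)
    (fun i => if i ∈ A then (0 : ℝ) else 1 - p) (univ : Finset ι)
  have h1 : ∏ i : ι, ((if i ∈ B then (0 : ℝ) else p) + (if i ∈ A then (0 : ℝ) else 1 - p))
      = p ^ #A * (1 - p) ^ #B := by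
    have : ∀ i : ι, ((if i ∈ B then (0 : ℝ) else p) + (if i ∈ A then (0 : ℝ) else 1 - p))
        = (if i ∈ A then p else 1) * (if i ∈ B then 1 - p else 1) := by
      intro i
      by_cases hA : i ∈ A
      · have hB : i ∉ B := Finset.disjoint_left.mp h hA
        simp [hA, hB]
      · by_cases hB : i ∈ B <;> simp [hA, hB]
    rw [prod_congr rfl fun i _ => this i, prod_mul_distrib]
    simp [prod_ite_mem]
  rw [← h1, key, powerset_univ, bernExp]
  refine sum_congr rfl fun X _ => ?_
  by_cases hA : A ⊆ X
  · by_cases hB : Disjoint B X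
    · rw [if_pos ⟨hA, hB⟩, mul_one]
      congr 1
      · rw [prod_congr rfl fun i hi => if_neg (Finset.disjoint_right.mp hB hi), prod_const]
      · rw [← compl_eq_univ_sdiff, prod_congr rfl fun i hi =>
          if_neg fun hiA => (mem_compl.mp hi) (hA hiA), prod_const]
    · rw [if_neg fun hh => hB hh.2, mul_zero]
      obtain ⟨i, hiB, hiX⟩ := Finset.not_disjoint_iff.mp hB
      refine (mul_eq_zero_of_left (prod_eq_zero hiX ?_) _).symm
      exact if_pos hiB
  · rw [if_neg fun hh => hA hh.1, mul_zero]
    obtain ⟨i, hiA, hiX⟩ := Finset.not_subset.mp hA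
    refine (mul_eq_zero_of_right _ (prod_eq_zero (i := i) (by simpa using hiX) ?_)).symm
    exact if_pos hiA

lemma bernExp_indicator_le {p : ℝ} (hp0 : 0 ≤ p) (hp1 : p ≤ 1) (A B : Finset ι) :
    bernExp p (fun X => if A ⊆ X ∧ Disjoint B X then 1 else 0) ≤ p ^ #A * (1 - p) ^ #B := by
  by_cases h : Disjoint A B
  · exact (bernExp_indicator p h).le
  · have : (fun X : Finset ι => if A ⊆ X ∧ Disjoint B X then (1 : ℝ) else 0) = fun _ => 0 := by
      funext X
      refine if_neg fun hh => h ?_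
      exact (hh.2.mono_right hh.1).symm
    rw [this]
    simp only [bernExp, mul_zero, sum_const_zero]
    exact mul_nonneg (pow_nonneg hp0 _) (pow_nonneg (by linarith) _)

lemma bernExp_subset (p : ℝ) (A : Finset ι) :
    bernExp p (fun X => if A ⊆ X then 1 else 0) = p ^ #A := by
  simpa using bernExp_indicator p (disjoint_empty_right A)

lemma bernExp_disjoint (p : ℝ) (B : Finset ι) :
    bernExp p (fun X => if Disjoint B X then 1 else 0) = (1 - p) ^ #B := by
  simpa using bernExp_indicator p (disjoint_empty_left B)

lemma bernExp_const (p c : ℝ) : bernExp (ι := ι) p (fun _ => c) = c := by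
  have h := bernExp_subset p (∅ : Finset ι)
  have h' := bernExp_const_mul (ι := ι) p c fun _ => 1
  simp only [empty_subset, if_true, card_empty, pow_zero, mul_one] at h h'
  rw [h', h, mul_one]

lemma exists_le_bernExp {p : ℝ} (hp0 : 0 ≤ p) (hp1 : p ≤ 1) (f : Finset ι → ℝ) :
    ∃ X, f X ≤ bernExp p f := by
  obtain ⟨X, -, hX⟩ := exists_min_image (univ : Finset (Finset ι)) f univ_nonempty
  exact ⟨X, (bernExp_const p (f X)).symm.le.trans
    (bernExp_mono hp0 hp1 fun Y => hX Y (mem_univ Y))⟩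

lemma abs_le_sq_div_add {s : ℝ} (hs : 0 < s) (x : ℝ) : |x| ≤ (x ^ 2 / s + s) / 2 := by
  have h : x ^ 2 / s * s = x ^ 2 := div_mul_cancel₀ _ hs.ne'
  have h2 : 0 ≤ (|x| - s) ^ 2 / s := by positivity
  have h3 : (|x| - s) ^ 2 / s = x ^ 2 / s - 2 * |x| + s := by
    field_simp
    rw [sub_sq, sq_abs]
    ring
  linarith

lemma abs_pow_sub_pow_le_mul {q : ℝ} (hq0 : 0 ≤ q) (hq1 : q ≤ 1) (a b : ℕ) :
    |q ^ a - q ^ b| ≤ (1 - q) * |(a : ℝ) - b| := by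
  wlog hab : a ≤ b generalizing a b
  · rw [abs_sub_comm, abs_sub_comm (a : ℝ)]
    exact this b a (by omega)
  obtain ⟨c, rfl⟩ := Nat.exists_eq_add_of_le hab
  have h1 : 1 - c * (1 - q) ≤ q ^ c := by
    have := one_add_mul_le_pow (a := q - 1) (by linarith) c
    simp only [add_sub_cancel] at this
    linarith
  have h2 : q ^ c ≤ 1 := pow_le_one₀ hq0 hq1
  have h3 : q ^ a ≤ 1 := pow_le_one₀ hq0 hq1
  have h4 : 0 ≤ q ^ a := pow_nonneg hq0 a
  have e1 : q ^ a - q ^ (a + c) = q ^ a * (1 - q ^ c) := by ring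
  have e2 : |(a : ℝ) - ((a + c : ℕ) : ℝ)| = c := by
    push_cast
    rw [sub_add_cancel_left, abs_neg, Nat.abs_cast]
  rw [e1, e2, abs_of_nonneg (mul_nonneg h4 (by linarith))]
  nlinarith

/-- First and second moment of the number of sets of a family avoided by the random set. -/
lemma bernExp_card_avoid (p : ℝ) (I : Finset κ) (A : κ → Finset ι) :
    bernExp p (fun X => (#{i ∈ I | Disjoint (A i) X} : ℝ)) = ∑ i ∈ I, (1 - p) ^ #(A i) := by
  simp_rw [card_filter, Nat.cast_sum, Nat.cast_ite, Nat.cast_one, Nat.cast_zero]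
  rw [bernExp_sum]
  exact sum_congr rfl fun i _ => bernExp_disjoint p (A i)

lemma bernExp_card_avoid_sq (p : ℝ) (I : Finset κ) (A : κ → Finset ι) :
    bernExp p (fun X => (#{i ∈ I | Disjoint (A i) X} : ℝ) ^ 2)
      = ∑ i ∈ I, ∑ j ∈ I, (1 - p) ^ #(A i ∪ A j) := by
  simp_rw [card_filter, Nat.cast_sum, Nat.cast_ite, Nat.cast_one, Nat.cast_zero, sq,
    sum_mul_sum]
  rw [bernExp_sum]
  refine sum_congr rfl fun i _ => ?_
  rw [bernExp_sum]
  refine sum_congr rfl fun j _ => ?_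
  rw [← bernExp_disjoint]
  congr 1
  funext X
  by_cases h1 : Disjoint (A i) X <;> by_cases h2 : Disjoint (A j) X <;>
    simp [h1, h2, disjoint_union_left]

lemma bernExp_abs_sub_le {p : ℝ} (hp0 : 0 ≤ p) (hp1 : p ≤ 1) (Y : Finset ι → ℝ) (c : ℝ)
    {s : ℝ} (hs : 0 < s) :
    bernExp p (fun X => |Y X - c|) ≤
      ((bernExp p (fun X => Y X ^ 2) - bernExp p Y ^ 2) / s + s) / 2 + |bernExp p Y - c| := by
  set μ := bernExp p Y
  have h : ∀ X, |Y X - c| ≤ 1 / (2 * s) * (Y X ^ 2) + (-(μ / s) * Y X) +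
      (μ ^ 2 / (2 * s) + s / 2 + |μ - c|) := by
    intro X
    have h1 := abs_le_sq_div_add hs (Y X - μ)
    have h2 := abs_sub_le (Y X) μ c
    have h3 : ((Y X - μ) ^ 2 / s + s) / 2 = 1 / (2 * s) * (Y X ^ 2) + (-(μ / s) * Y X) +
      (μ ^ 2 / (2 * s) + s / 2) := by field_simp; ring
    linarith
  refine (bernExp_mono hp0 hp1 h).trans (le_of_eq ?_)
  rw [bernExp_add, bernExp_add, bernExp_const_mul, bernExp_const_mul, bernExp_const]
  change 1 / (2 * s) * _ + -(μ / s) * μ + _ = _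
  field_simp
  ring

end BernoulliExpectation

section LinearHypergraph

variable {V : Type*} [DecidableEq V]

/-- The number of edges of `E` containing the vertex `v`. -/
def edgeDeg (E : Finset (Finset V)) (v : V) : ℕ := #{e ∈ E | v ∈ e}

/-- `E` is a linear `r`-uniform hypergraph with vertex set `U`. -/
structure IsLinearOn (r : ℕ) (U : Finset V) (E : Finset (Finset V)) : Prop where
  subset : ∀ e ∈ E, e ⊆ U
  card : ∀ e ∈ E, #e = r
  inter : ∀ e ∈ E, ∀ f ∈ E, e ≠ f → #(e ∩ f) ≤ 1

/-- `M` consists of pairwise disjoint edges of `E`. -/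
def IsMatchingIn (E M : Finset (Finset V)) : Prop :=
  M ⊆ E ∧ ∀ e ∈ M, ∀ f ∈ M, e ≠ f → Disjoint e f

/-- The `ℓ¹`-distance of the degree sequence of `E` on `U` from the constant `D`. -/
noncomputable def degDeviation (U : Finset V) (E : Finset (Finset V)) (D : ℝ) : ℝ :=
  ∑ u ∈ U, |(edgeDeg E u : ℝ) - D|

lemma degDeviation_nonneg (U : Finset V) (E : Finset (Finset V)) (D : ℝ) :
    0 ≤ degDeviation U E D := sum_nonneg fun _ _ => abs_nonneg _

lemma sum_sum_edges {U : Finset V} {E : Finset (Finset V)} (hE : ∀ e ∈ E, e ⊆ U)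
    (h : V → Finset V → ℝ) :
    ∑ u ∈ U, ∑ e ∈ E with u ∈ e, h u e = ∑ e ∈ E, ∑ u ∈ e, h u e := by
  refine sum_comm' fun u e => ?_
  simp only [mem_filter]
  exact ⟨fun ⟨_, h2, h3⟩ => ⟨h3, h2⟩, fun ⟨h3, h2⟩ => ⟨hE e h2 h3, h2, h3⟩⟩

lemma sum_edgeDeg_mul {U : Finset V} {E : Finset (Finset V)} (hE : ∀ e ∈ E, e ⊆ U)
    (g : V → ℝ) : ∑ u ∈ U, (edgeDeg E u : ℝ) * g u = ∑ e ∈ E, ∑ u ∈ e, g u := by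
  rw [← sum_sum_edges hE]
  exact sum_congr rfl fun u _ => by rw [sum_const, nsmul_eq_mul, edgeDeg]

namespace IsLinearOn

variable {r : ℕ} {U : Finset V} {E : Finset (Finset V)}

lemma eq_of_mem (hE : IsLinearOn r U E) {e f : Finset V} (he : e ∈ E) (hf : f ∈ E) {x y : V}
    (hxy : x ≠ y) (hxe : x ∈ e) (hye : y ∈ e) (hxf : x ∈ f) (hyf : y ∈ f) : e = f := by
  by_contra hne
  have h1 : ({x, y} : Finset V) ⊆ e ∩ f := by
    intro z hz
    simp only [mem_insert, mem_singleton] at hz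
    rcases hz with rfl | rfl <;> simp [*]
  have h2 := (card_le_card h1).trans (hE.inter e he f hf hne)
  rw [card_pair hxy] at h2
  omega

lemma mono (hE : IsLinearOn r U E) {U' : Finset V} {E' : Finset (Finset V)} (h : E' ⊆ E)
    (hU : ∀ e ∈ E', e ⊆ U') : IsLinearOn r U' E' :=
  ⟨hU, fun e he => hE.card e (h he), fun e he f hf => hE.inter e (h he) f (h hf)⟩

lemma sum_edgeDeg (hE : IsLinearOn r U E) :
    ∑ u ∈ U, (edgeDeg E u : ℝ) = r * #E := by
  have h := sum_edgeDeg_mul hE.subset fun _ => 1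
  simp only [mul_one, sum_const, nsmul_eq_mul] at h
  rw [h, sum_congr rfl fun e he => by rw [hE.card e he], sum_const, nsmul_eq_mul, mul_comm]

/-- Edges avoiding `u` that meet `e`. -/
def blockers (E : Finset (Finset V)) (u : V) (e : Finset V) : Finset (Finset V) :=
  {f ∈ E | u ∉ f ∧ ¬ Disjoint f e}

lemma card_blockers (hE : IsLinearOn r U E) {u : V} {e : Finset V} (he : e ∈ E) (hu : u ∈ e) :
    (#(blockers E u e) : ℝ) = ∑ x ∈ e.erase u, ((edgeDeg E x : ℝ) - 1) := by
  have h1 : blockers E u e = (e.erase u).biUnion fun x => ({f ∈ E | x ∈ f} : Finset _).erase e := by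
    ext f
    simp only [blockers, mem_filter, mem_biUnion, mem_erase]
    constructor
    · rintro ⟨hf, huf, hd⟩
      obtain ⟨x, hxf, hxe⟩ := Finset.not_disjoint_iff.mp hd
      exact ⟨x, ⟨fun h => huf (h ▸ hxf), hxe⟩, fun h => huf (h ▸ hu), hf, hxf⟩
    · rintro ⟨x, ⟨hxu, hxe⟩, hfe, hf, hxf⟩
      exact ⟨hf, fun huf => hfe (hE.eq_of_mem hf he hxu hxf huf hxe hu),
        Finset.not_disjoint_iff.mpr ⟨x, hxf, hxe⟩⟩
  rw [h1, card_biUnion]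
  · push_cast
    refine sum_congr rfl fun x hx => ?_
    have hmem : e ∈ ({f ∈ E | x ∈ f} : Finset _) := by
      simp [he, mem_of_mem_erase hx]
    rw [card_erase_of_mem hmem, Nat.cast_sub (card_pos.mpr ⟨e, hmem⟩), edgeDeg, Nat.cast_one]
  · intro x hx y hy hxy
    rw [Function.onFun, Finset.disjoint_left]
    intro f hf hf'
    simp only [coe_erase, Set.mem_sdiff, mem_coe, mem_erase, mem_filter] at hf hf' hx hy
    exact hf.1 (hE.eq_of_mem hf.2.1 he hxy hf.2.2 hf'.2.2 hx.1 hy.1)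

lemma card_blockers_inter_le (hE : IsLinearOn r U E) {u : V} {e e' : Finset V} (he : e ∈ E)
    (he' : e' ∈ E) (hu : u ∈ e) (hu' : u ∈ e') (hne : e ≠ e') :
    #(blockers E u e ∩ blockers E u e') ≤ r ^ 2 := by
  have h1 : blockers E u e ∩ blockers E u e' ⊆
      (e ×ˢ e').biUnion fun x => {f ∈ E | u ∉ f ∧ x.1 ∈ f ∧ x.2 ∈ f} := by
    intro f
    simp only [blockers, mem_inter, mem_filter, mem_biUnion, mem_product, Prod.exists]
    rintro ⟨⟨hf, huf, hd⟩, -, -, hd'⟩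
    obtain ⟨x, hxf, hxe⟩ := Finset.not_disjoint_iff.mp hd
    obtain ⟨y, hyf, hye⟩ := Finset.not_disjoint_iff.mp hd'
    exact ⟨x, y, ⟨hxe, hye⟩, hf, huf, hxf, hyf⟩
  refine (card_le_card h1).trans ((card_biUnion_le_card_mul _ _ 1 ?_).trans ?_)
  · rintro ⟨x, y⟩ hxy
    rw [mem_product] at hxy
    rw [card_le_one]
    intro f hf f' hf'
    simp only [mem_filter] at hf hf'
    have hne' : x ≠ y := by
      rintro rfl
      have hxu : x ≠ u := fun h => hf.2.1 (h ▸ hf.2.2.1)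
      exact hne (hE.eq_of_mem he he' hxu hxy.1 hu hxy.2 hu')
    exact hE.eq_of_mem hf.1 hf'.1 hne' hf.2.2.1 hf.2.2.2 hf'.2.2.1 hf'.2.2.2
  · rw [card_product, hE.card e he, hE.card e' he', mul_one, sq]

variable [Fintype V]

lemma bernExp_survivors_var_le (hE : IsLinearOn r U E) {p : ℝ} (hp0 : 0 ≤ p) (hp1 : p ≤ 1)
    (u : V) :
    bernExp p (fun X => (#{e ∈ {e ∈ E | u ∈ e} | Disjoint (blockers E u e) X} : ℝ) ^ 2) -
      bernExp p (fun X => (#{e ∈ {e ∈ E | u ∈ e} | Disjoint (blockers E u e) X} : ℝ)) ^ 2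
    ≤ edgeDeg E u + edgeDeg E u ^ 2 * (p * r ^ 2) := by
  set I : Finset (Finset V) := {e ∈ E | u ∈ e}
  have hq0 : 0 ≤ 1 - p := by linarith
  have hq1 : 1 - p ≤ 1 := by linarith
  rw [bernExp_card_avoid_sq, bernExp_card_avoid, sq, sum_mul_sum, ← sum_sub_distrib]
  have hterm : ∀ e ∈ I, ∀ e' ∈ I,
      (1 - p) ^ #(blockers E u e ∪ blockers E u e')
        - (1 - p) ^ #(blockers E u e) * (1 - p) ^ #(blockers E u e')
      ≤ (if e = e' then 1 else 0) + p * r ^ 2 := by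
    intro e he e' he'
    simp only [I, mem_filter] at he he'
    by_cases hee : e = e'
    · rw [if_pos hee]
      have h1 : (1 - p) ^ #(blockers E u e ∪ blockers E u e') ≤ 1 := pow_le_one₀ hq0 hq1
      have h2 : 0 ≤ (1 - p) ^ #(blockers E u e) * (1 - p) ^ #(blockers E u e') := by positivity
      have h3 : 0 ≤ p * (r : ℝ) ^ 2 := by positivity
      linarith
    · rw [if_neg hee, zero_add, ← pow_add]
      refine (le_abs_self _).trans ((abs_pow_sub_pow_le_mul hq0 hq1 _ _).trans ?_)
      rw [sub_sub_cancel]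
      refine mul_le_mul_of_nonneg_left ?_ hp0
      have h1 := card_union_add_card_inter (blockers E u e) (blockers E u e')
      have h2 := hE.card_blockers_inter_le he.1 he'.1 he.2 he'.2 hee
      rw [← h1]
      push_cast
      rw [sub_add_cancel_left, abs_neg, Nat.abs_cast]
      exact_mod_cast h2
  calc _ ≤ ∑ e ∈ I, ∑ e' ∈ I, ((if e = e' then 1 else 0) + p * (r : ℝ) ^ 2) := by
        refine sum_le_sum fun e he => ?_
        rw [← sum_sub_distrib]
        exact sum_le_sum fun e' he' => hterm e he e' he'
    _ = edgeDeg E u + edgeDeg E u ^ 2 * (p * r ^ 2) := by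
        have : ∀ e ∈ I, ∑ e' ∈ I, ((if e = e' then 1 else 0) + p * (r : ℝ) ^ 2)
            = 1 + #I * (p * (r : ℝ) ^ 2) := by
          intro e he
          rw [sum_add_distrib, sum_ite_eq, if_pos he, sum_const, nsmul_eq_mul]
        rw [sum_congr rfl this, sum_const, nsmul_eq_mul]
        simp only [edgeDeg, I]
        ring

lemma abs_bernExp_survivors_sub_le (hE : IsLinearOn r U E) {p D : ℝ}
    (hp0 : 0 ≤ p) (hp1 : p ≤ 1) (hD : 0 < D) (u : V) :
    |bernExp p (fun X => (#{e ∈ {e ∈ E | u ∈ e} | Disjoint (blockers E u e) X} : ℝ))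
      - D * ((1 - p) ^ ⌊D⌋₊) ^ (r - 1)|
    ≤ ∑ e ∈ E with u ∈ e, p * ∑ x ∈ e, (|(edgeDeg E x : ℝ) - D| + 1)
      + |(edgeDeg E u : ℝ) - D| := by
  have hq0 : 0 ≤ 1 - p := by linarith
  have hq1 : 1 - p ≤ 1 := by linarith
  rw [bernExp_card_avoid, ← pow_mul]
  set N := ⌊D⌋₊ * (r - 1)
  have h1 : ∑ e ∈ E with u ∈ e, (1 - p) ^ #(blockers E u e) - D * (1 - p) ^ N
      = ∑ e ∈ E with u ∈ e, ((1 - p) ^ #(blockers E u e) - (1 - p) ^ N)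
        + ((edgeDeg E u : ℝ) - D) * (1 - p) ^ N := by
    rw [sum_sub_distrib, sum_const, nsmul_eq_mul, edgeDeg]
    ring
  rw [h1]
  refine (abs_add_le _ _).trans (add_le_add ?_ ?_)
  · refine (abs_sum_le_sum_abs _ _).trans (sum_le_sum fun e he => ?_)
    rw [mem_filter] at he
    refine (abs_pow_sub_pow_le_mul hq0 hq1 _ _).trans ?_
    rw [sub_sub_cancel]
    refine mul_le_mul_of_nonneg_left ?_ hp0
    have hN : (N : ℝ) = ∑ x ∈ e.erase u, (⌊D⌋₊ : ℝ) := by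
      rw [sum_const, card_erase_of_mem he.2, hE.card e he.1, nsmul_eq_mul, mul_comm]
      simp only [N, Nat.cast_mul]
    rw [hE.card_blockers he.1 he.2, hN, ← sum_sub_distrib]
    refine (abs_sum_le_sum_abs _ _).trans ((sum_le_sum fun x _ => ?_).trans
      (sum_le_sum_of_subset_of_nonneg (erase_subset u e) fun x _ _ => by positivity))
    have h2 := Nat.floor_le hD.le
    have h3 := Nat.lt_floor_add_one D
    have h4 : |D - 1 - (⌊D⌋₊ : ℝ)| ≤ 1 := abs_le.mpr ⟨by linarith, by linarith⟩
    calc |(edgeDeg E x : ℝ) - 1 - ⌊D⌋₊| = |((edgeDeg E x : ℝ) - D) + (D - 1 - ⌊D⌋₊)| := by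
          congr 1; ring
      _ ≤ _ := (abs_add_le _ _).trans (add_le_add le_rfl h4)
  · rw [abs_mul, abs_of_nonneg (pow_nonneg hq0 N)]
    exact mul_le_of_le_one_right (abs_nonneg _) (pow_le_one₀ hq0 hq1)

/-- After one random round, the degrees of surviving vertices are concentrated in mean. -/
lemma bernExp_sum_survivors_le (hE : IsLinearOn r U E) (hr : 1 ≤ r) {θ D : ℝ}
    (hθ0 : 0 ≤ θ) (hθ1 : θ ≤ 1) (hD : 1 ≤ D) (hdeg : ∀ u ∈ U, (edgeDeg E u : ℝ) ≤ 2 * D) :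
    bernExp (θ / D) (fun X => ∑ u ∈ U,
      |(#{e ∈ {e ∈ E | u ∈ e} | Disjoint (blockers E u e) X} : ℝ)
        - D * ((1 - θ / D) ^ ⌊D⌋₊) ^ (r - 1)|)
    ≤ 7 * r ^ 2 * (degDeviation U E D + √D * #U) := by
  have hD0 : 0 < D := by linarith
  have hp0 : 0 ≤ θ / D := by positivity
  have hp1 : θ / D ≤ 1 := by rw [div_le_one hD0]; linarith
  have hpD : θ / D * D = θ := div_mul_cancel₀ _ hD0.ne'
  set p := θ / D
  have hs : 0 < √D := Real.sqrt_pos.mpr hD0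
  have hss : √D * √D = D := Real.mul_self_sqrt hD0.le
  have hs1 : 1 ≤ √D := Real.one_le_sqrt.mpr hD
  have hr1 : (1 : ℝ) ≤ r := by exact_mod_cast hr
  have hr2 : (r : ℝ) ≤ r ^ 2 := by nlinarith
  rw [bernExp_sum]
  have hu : ∀ u ∈ U, bernExp p (fun X =>
      |(#{e ∈ {e ∈ E | u ∈ e} | Disjoint (blockers E u e) X} : ℝ)
        - D * ((1 - p) ^ ⌊D⌋₊) ^ (r - 1)|)
      ≤ 4 * r ^ 2 * √D + |(edgeDeg E u : ℝ) - D|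
        + ∑ e ∈ E with u ∈ e, p * ∑ x ∈ e, (|(edgeDeg E x : ℝ) - D| + 1) := by
    intro u hu
    have h1 := bernExp_abs_sub_le hp0 hp1
      (fun X => (#{e ∈ {e ∈ E | u ∈ e} | Disjoint (blockers E u e) X} : ℝ))
      (D * ((1 - p) ^ ⌊D⌋₊) ^ (r - 1)) hs
    have h2 := hE.abs_bernExp_survivors_sub_le hp0 hp1 hD0 u
    have h3 := hE.bernExp_survivors_var_le hp0 hp1 u
    have h4 : (edgeDeg E u : ℝ) + edgeDeg E u ^ 2 * (p * r ^ 2) ≤ 6 * r ^ 2 * D := by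
      have h5 := hdeg u hu
      have h6 : (edgeDeg E u : ℝ) ^ 2 ≤ (2 * D) ^ 2 := pow_le_pow_left₀ (by positivity) h5 2
      have h7 : (edgeDeg E u : ℝ) ^ 2 * (p * r ^ 2) ≤ (2 * D) ^ 2 * (p * r ^ 2) :=
        mul_le_mul_of_nonneg_right h6 (by positivity)
      have h8 : (2 * D) ^ 2 * (p * r ^ 2) = 4 * θ * (r ^ 2 * D) := by
        rw [← hpD]; ring
      have h9 : θ * (r ^ 2 * D) ≤ r ^ 2 * D := mul_le_of_le_one_left (by positivity) hθ1
      nlinarith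
    have h10 := div_le_div_of_nonneg_right (h3.trans h4) hs.le
    have h11 : 6 * r ^ 2 * D / √D = 6 * r ^ 2 * √D := by
      rw [mul_div_assoc, Real.div_sqrt]
    have h12 : √D ≤ r ^ 2 * √D := le_mul_of_one_le_left hs.le (by linarith)
    rw [h11] at h10
    linarith
  refine (sum_le_sum hu).trans ?_
  rw [sum_add_distrib, sum_add_distrib, sum_const, nsmul_eq_mul, sum_sum_edges hE.subset]
  have h1 : ∑ e ∈ E, ∑ u ∈ e, p * ∑ x ∈ e, (|(edgeDeg E x : ℝ) - D| + 1)
      ≤ 2 * r * (degDeviation U E D + #U) := by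
    have h2 : ∑ e ∈ E, ∑ u ∈ e, p * ∑ x ∈ e, (|(edgeDeg E x : ℝ) - D| + 1)
        = r * p * ∑ u ∈ U, (edgeDeg E u : ℝ) * (|(edgeDeg E u : ℝ) - D| + 1) := by
      rw [sum_edgeDeg_mul hE.subset, mul_sum]
      refine sum_congr rfl fun e he => ?_
      rw [sum_const, hE.card e he, nsmul_eq_mul, mul_assoc]
    have h3 : ∑ u ∈ U, (edgeDeg E u : ℝ) * (|(edgeDeg E u : ℝ) - D| + 1)
        ≤ 2 * D * (degDeviation U E D + #U) := by
      rw [degDeviation, card_eq_sum_ones, Nat.cast_sum, Nat.cast_one, ← sum_add_distrib, mul_sum]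
      exact sum_le_sum fun u hu => mul_le_mul_of_nonneg_right (hdeg u hu) (by positivity)
    rw [h2]
    have h4 : 0 ≤ degDeviation U E D + #U :=
      add_nonneg (degDeviation_nonneg _ _ _) (Nat.cast_nonneg _)
    calc _ ≤ r * p * (2 * D * (degDeviation U E D + #U)) :=
          mul_le_mul_of_nonneg_left h3 (by positivity)
      _ = θ * (2 * r * (degDeviation U E D + #U)) := by rw [← hpD]; ring
      _ ≤ _ := mul_le_of_le_one_left (by positivity) hθ1
  have h5 : ∑ u ∈ U, |(edgeDeg E u : ℝ) - D| = degDeviation U E D := rfl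
  rw [h5]
  have h6 := degDeviation_nonneg U E D
  have h7 : (0 : ℝ) ≤ #U := Nat.cast_nonneg _
  have h8 : (#U : ℝ) ≤ √D * #U := le_mul_of_one_le_left h7 hs1
  have h9 : 0 ≤ √D * #U := by positivity
  nlinarith [mul_le_mul_of_nonneg_right hr2 h6, mul_le_mul_of_nonneg_right hr2 h9,
    mul_le_mul_of_nonneg_left h8 (by linarith : (0 : ℝ) ≤ r),
    mul_le_mul_of_nonneg_right (hr1.trans hr2) h6, mul_le_mul_of_nonneg_right (hr1.trans hr2) h9]

end IsLinearOn

end LinearHypergraph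

section Nibble

/-- Every linear `r`-uniform hypergraph has a matching missing at most a proportion `a` of the
vertices, up to an error controlled by the deviation from `D`-regularity. -/
def MatchingBound (r : ℕ) (a K : ℝ) : Prop :=
  ∀ (V : Type) [Fintype V] [DecidableEq V] (U : Finset V) (E : Finset (Finset V)) (D : ℝ),
    0 < D → IsLinearOn r U E →
    ∃ M, IsMatchingIn E M ∧
      (#U : ℝ) - r * #M ≤ a * #U + K * ((degDeviation U E D + √D * #U) / D)

variable {V : Type} [DecidableEq V] {r : ℕ} {U : Finset V} {E : Finset (Finset V)}

namespace IsLinearOn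

/-- Ordered pairs of distinct intersecting edges. -/
def meetingPairs (E : Finset (Finset V)) : Finset (Finset V × Finset V) :=
  {x ∈ E ×ˢ E | x.1 ≠ x.2 ∧ ¬ Disjoint x.1 x.2}

lemma card_meetingPairs_le (hE : IsLinearOn r U E) {D : ℝ} (hD : 0 ≤ D)
    (hdeg : ∀ u ∈ U, (edgeDeg E u : ℝ) ≤ D) : (#(meetingPairs E) : ℝ) ≤ D ^ 2 * #U := by
  have h1 : #(meetingPairs E) ≤ ∑ e ∈ E, ∑ x ∈ e, edgeDeg E x := by
    have : meetingPairs E ⊆ E.biUnion fun e => e.biUnion fun x =>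
        ({f ∈ E | x ∈ f} : Finset _).image fun f => (e, f) := by
      rintro ⟨e, f⟩ h
      simp only [meetingPairs, mem_filter, mem_product] at h
      obtain ⟨x, hxe, hxf⟩ := Finset.not_disjoint_iff.mp h.2.2
      simp only [mem_biUnion, mem_image, mem_filter]
      exact ⟨e, h.1.1, x, hxe, f, ⟨h.1.2, hxf⟩, rfl⟩
    refine (card_le_card this).trans (card_biUnion_le.trans (sum_le_sum fun e _ => ?_))
    exact card_biUnion_le.trans (sum_le_sum fun x _ => card_image_le)
  have h2 : (#(meetingPairs E) : ℝ) ≤ ∑ e ∈ E, ∑ x ∈ e, (edgeDeg E x : ℝ) := by exact_mod_cast h1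
  rw [← sum_edgeDeg_mul hE.subset] at h2
  refine h2.trans ?_
  calc ∑ u ∈ U, (edgeDeg E u : ℝ) * edgeDeg E u ≤ ∑ _u ∈ U, D ^ 2 := by
        refine sum_le_sum fun u hu => ?_
        rw [sq]
        exact mul_le_mul (hdeg u hu) (hdeg u hu) (Nat.cast_nonneg _) hD
    _ = D ^ 2 * #U := by rw [sum_const, nsmul_eq_mul, mul_comm]

variable [Fintype V]

/-- The outcome of one random round: extend the isolated selected edges by a matching of what
is left. -/
lemma exists_matching_of_round (hE : IsLinearOn r U E) (hr : 1 ≤ r) {a K D' : ℝ}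
    (hP : MatchingBound r a K) (hK : 0 ≤ K) (hD' : 0 < D') (Y : V → Finset (Finset V) → ℝ)
    (hY : ∀ u X, Y u X = #{e ∈ {e ∈ E | u ∈ e} | Disjoint (blockers E u e) X})
    (X : Finset (Finset V)) :
    ∃ M, IsMatchingIn E M ∧ (#U : ℝ) - r * #M ≤
      r * #{x ∈ meetingPairs E | x.1 ∈ X ∧ x.2 ∈ X}
      + a * #{u ∈ U | Disjoint {e ∈ E | u ∈ e} X}
      + K * ((∑ u ∈ U, |Y u X - D'| + √D' * #U) / D') := by
  set U' : Finset V := {u ∈ U | Disjoint {e ∈ E | u ∈ e} X} with hU'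
  set E' : Finset (Finset V) := {e ∈ E | ∀ f ∈ E, f ∈ X → Disjoint e f} with hE'
  set M₁ : Finset (Finset V) := {e ∈ E | e ∈ X ∧ ∀ f ∈ E, f ∈ X → e ≠ f → Disjoint e f} with hM₁
  have memU' : ∀ u, u ∈ U' ↔ u ∈ U ∧ ∀ f ∈ E, f ∈ X → u ∉ f := by
    intro u
    simp only [hU', mem_filter, Finset.disjoint_left]
    exact and_congr_right fun _ => ⟨fun h f hf hfX hu => h ⟨hf, hu⟩ hfX,
      fun h f hf hfX => h f hf.1 hfX hf.2⟩
  have hEsub : ∀ e ∈ E', e ⊆ U' := by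
    intro e he u hu
    simp only [hE', mem_filter] at he
    exact (memU' u).mpr ⟨hE.subset e he.1 hu, fun f hf hfX huf =>
      Finset.disjoint_left.mp (he.2 f hf hfX) hu huf⟩
  have hlin : IsLinearOn r U' E' := hE.mono (filter_subset _ _) hEsub
  obtain ⟨M₂, hM₂, hb⟩ := hP V U' E' D' hD' hlin
  have hdis : ∀ e ∈ M₁, ∀ f ∈ M₂, Disjoint e f := by
    intro e he f hf
    have hf' := hM₂.1 hf
    simp only [hE', mem_filter] at hf'
    simp only [hM₁, mem_filter] at he
    exact (hf'.2 e he.1 he.2.1).symm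
  have hne : ∀ e ∈ E, e.Nonempty := fun e he => card_pos.mp (by rw [hE.card e he]; omega)
  have hM₁E : M₁ ⊆ E := filter_subset _ _
  have hM₂E : M₂ ⊆ E := hM₂.1.trans (filter_subset _ _)
  have hMM : Disjoint M₁ M₂ := by
    rw [Finset.disjoint_left]
    intro e he he'
    obtain ⟨x, hx⟩ := hne e (hM₁E he)
    exact Finset.disjoint_left.mp (hdis e he e he') hx hx
  refine ⟨M₁ ∪ M₂, ⟨union_subset hM₁E hM₂E, ?_⟩, ?_⟩
  · intro e he f hf hef
    rcases mem_union.mp he with he | he <;> rcases mem_union.mp hf with hf | hf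
    · simp only [hM₁, mem_filter] at he hf
      exact he.2.2 f hf.1 hf.2.1 hef
    · exact hdis e he f hf
    · exact (hdis f hf e he).symm
    · exact hM₂.2 e he f hf hef
  · have hdev : degDeviation U' E' D' + √D' * #U' ≤ ∑ u ∈ U, |Y u X - D'| + √D' * #U := by
      have hUU : U' ⊆ U := filter_subset _ _
      refine add_le_add ?_ (mul_le_mul_of_nonneg_left (by exact_mod_cast card_le_card hUU)
        (Real.sqrt_nonneg _))
      refine (le_of_eq (sum_congr rfl fun u hu => ?_)).trans
        (sum_le_sum_of_subset_of_nonneg hUU fun u _ _ => abs_nonneg _)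
      rw [hY, edgeDeg]
      congr 4
      ext e
      simp only [hE', blockers, mem_filter, Finset.disjoint_left (s := filter _ _)]
      have hu' := (memU' u).mp hu
      constructor
      · rintro ⟨⟨he, h⟩, hue⟩
        exact ⟨⟨he, hue⟩, fun f ⟨hf, _, hd⟩ hfX => hd (h f hf hfX).symm⟩
      · rintro ⟨⟨he, hue⟩, h⟩
        refine ⟨⟨he, fun f hf hfX => ?_⟩, hue⟩
        by_contra hd
        exact h ⟨hf, hu'.2 f hf hfX, fun h' => hd h'.symm⟩ hfX
    have h1 : K * ((degDeviation U' E' D' + √D' * #U') / D')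
        ≤ K * ((∑ u ∈ U, |Y u X - D'| + √D' * #U) / D') :=
      mul_le_mul_of_nonneg_left (div_le_div_of_nonneg_right hdev hD'.le) hK
    have h2 : #U ≤ #U' + r * #{e ∈ E | e ∈ X} := by
      have : U ⊆ U' ∪ ({e ∈ E | e ∈ X} : Finset _).biUnion id := by
        intro u hu
        rw [mem_union, memU']
        by_cases h : ∀ f ∈ E, f ∈ X → u ∉ f
        · exact Or.inl ⟨hu, h⟩
        · push Not at h
          obtain ⟨f, hf, hfX, huf⟩ := h
          exact Or.inr (mem_biUnion.mpr ⟨f, mem_filter.mpr ⟨hf, hfX⟩, huf⟩)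
      refine (card_le_card this).trans ((card_union_le _ _).trans (Nat.add_le_add_left ?_ _))
      rw [mul_comm]
      exact card_biUnion_le_card_mul _ _ _ fun e he => (hE.card e (mem_filter.mp he).1).le
    have h3 : #{e ∈ E | e ∈ X} ≤ #M₁ + #{x ∈ meetingPairs E | x.1 ∈ X ∧ x.2 ∈ X} := by
      have : ({e ∈ E | e ∈ X} : Finset _) ⊆
          M₁ ∪ ({x ∈ meetingPairs E | x.1 ∈ X ∧ x.2 ∈ X} : Finset _).image Prod.fst := by
        intro e he
        rw [mem_filter] at he
        rw [mem_union]
        by_cases h : ∀ f ∈ E, f ∈ X → e ≠ f → Disjoint e f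
        · exact Or.inl (mem_filter.mpr ⟨he.1, he.2, h⟩)
        · push Not at h
          obtain ⟨f, hf, hfX, hef, hd⟩ := h
          refine Or.inr (mem_image.mpr ⟨(e, f), ?_, rfl⟩)
          simp only [meetingPairs, mem_filter, mem_product]
          exact ⟨⟨⟨he.1, hf⟩, hef, hd⟩, he.2, hfX⟩
      exact (card_le_card this).trans ((card_union_le _ _).trans
        (Nat.add_le_add_left card_image_le _))
    rw [card_union_of_disjoint hMM]
    have h2' : (#U : ℝ) ≤ #U' + r * #{e ∈ E | e ∈ X} := by exact_mod_cast h2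
    have h3' : (#{e ∈ E | e ∈ X} : ℝ) ≤ #M₁ + #{x ∈ meetingPairs E | x.1 ∈ X ∧ x.2 ∈ X} := by
      exact_mod_cast h3
    have h4 := mul_le_mul_of_nonneg_left h3' (Nat.cast_nonneg r : (0 : ℝ) ≤ r)
    push_cast
    linarith

lemma survival_bounds {θ D : ℝ} (hθ0 : 0 ≤ θ) (hθ1 : θ ≤ 1 / 2) (hD : 1 ≤ D) :
    1 / 2 ≤ (1 - θ / D) ^ ⌊D⌋₊ ∧ (1 - θ / D) ^ ⌊D⌋₊ ≤ 1 - θ / 3 := by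
  have hD0 : 0 < D := by linarith
  have hp0 : 0 ≤ θ / D := by positivity
  have hp1 : θ / D ≤ 1 := by rw [div_le_one hD0]; linarith
  have hpD : θ / D * D = θ := div_mul_cancel₀ _ hD0.ne'
  have hfl1 := Nat.floor_le hD0.le
  have hfl2 := Nat.lt_floor_add_one D
  have hfl3 : (1 : ℝ) ≤ ⌊D⌋₊ := by exact_mod_cast Nat.floor_pos.mpr hD
  generalize θ / D = p at *
  have hq0 : 0 ≤ 1 - p := by linarith
  constructor
  · have h := one_add_mul_le_pow (a := -p) (by linarith) ⌊D⌋₊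
    rw [← sub_eq_add_neg] at h
    nlinarith [mul_le_mul_of_nonneg_left hfl1 hp0]
  · have h := one_add_mul_le_pow (a := p) (by linarith) ⌊D⌋₊
    have h1 : (1 - p) ^ ⌊D⌋₊ * (1 + p) ^ ⌊D⌋₊ ≤ 1 := by
      rw [← mul_pow]
      exact pow_le_one₀ (by nlinarith) (by nlinarith)
    have h2 : θ / 2 ≤ ⌊D⌋₊ * p := by
      have : D / 2 ≤ ⌊D⌋₊ := by linarith
      nlinarith [mul_le_mul_of_nonneg_right this hp0]
    have h3 : (1 - p) ^ ⌊D⌋₊ * (1 + θ / 2) ≤ 1 :=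
      (mul_le_mul_of_nonneg_left (by linarith) (pow_nonneg hq0 _)).trans h1
    nlinarith

lemma bernExp_card_meetingPairs_le (hE : IsLinearOn r U E) {p D : ℝ} (hD : 0 ≤ D)
    (hdeg : ∀ u ∈ U, (edgeDeg E u : ℝ) ≤ D) :
    bernExp p (fun X => (#{x ∈ meetingPairs E | x.1 ∈ X ∧ x.2 ∈ X} : ℝ))
      ≤ (p * D) ^ 2 * #U := by
  simp_rw [card_filter, Nat.cast_sum, Nat.cast_ite, Nat.cast_one, Nat.cast_zero]
  rw [bernExp_sum]
  have h1 : ∀ x ∈ meetingPairs E,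
      bernExp p (fun X => if x.1 ∈ X ∧ x.2 ∈ X then (1 : ℝ) else 0) = p ^ 2 := by
    intro x hx
    have h2 := bernExp_subset p {x.1, x.2}
    rw [card_pair (mem_filter.mp hx).2.1] at h2
    rw [← h2]
    simp [insert_subset_iff]
  rw [sum_congr rfl h1, sum_const, nsmul_eq_mul]
  calc _ ≤ D ^ 2 * #U * p ^ 2 := by
        gcongr
        exact hE.card_meetingPairs_le hD hdeg
    _ = (p * D) ^ 2 * #U := by ring

lemma bernExp_card_uncovered_le (U : Finset V) (E : Finset (Finset V)) {θ D : ℝ}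
    (hθ0 : 0 ≤ θ) (hθ1 : θ ≤ 1 / 2) (hD : 1 ≤ D) :
    bernExp (θ / D) (fun X => (#{u ∈ U | Disjoint {e ∈ E | u ∈ e} X} : ℝ))
      ≤ (1 - θ / 3) * #U + (degDeviation U E D + √D * #U) / D := by
  have hD0 : 0 < D := by linarith
  have hp0 : 0 ≤ θ / D := by positivity
  have hp1 : θ / D ≤ 1 := by rw [div_le_one hD0]; linarith
  have hfl1 := Nat.floor_le hD0.le
  have hfl2 := Nat.lt_floor_add_one D
  have hρup := (survival_bounds hθ0 hθ1 hD).2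
  have hUT : (#U : ℝ) ≤ √D * #U :=
    le_mul_of_one_le_left (Nat.cast_nonneg _) (Real.one_le_sqrt.mpr hD)
  have hp4 : θ / D ≤ 1 / D := div_le_div_of_nonneg_right (by linarith) hD0.le
  set p := θ / D
  have hq0 : 0 ≤ 1 - p := by linarith
  have hq1 : 1 - p ≤ 1 := by linarith
  rw [bernExp_card_avoid]
  have h1 : ∀ u ∈ U, (1 - p) ^ #{e ∈ E | u ∈ e}
      ≤ (1 - θ / 3) + 1 / D * (|(edgeDeg E u : ℝ) - D| + 1) := by
    intro u _
    have h2 := (le_abs_self _).trans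
      (abs_pow_sub_pow_le_mul hq0 hq1 #{e ∈ E | u ∈ e} ⌊D⌋₊)
    rw [sub_sub_cancel] at h2
    have h3 : |(edgeDeg E u : ℝ) - ⌊D⌋₊| ≤ |(edgeDeg E u : ℝ) - D| + 1 := by
      refine (abs_sub_le _ D _).trans (add_le_add le_rfl ?_)
      exact abs_le.mpr ⟨by linarith, by linarith⟩
    have h5 : p * |(edgeDeg E u : ℝ) - ⌊D⌋₊| ≤ 1 / D * (|(edgeDeg E u : ℝ) - D| + 1) :=
      mul_le_mul hp4 h3 (abs_nonneg _) (by positivity)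
    rw [edgeDeg] at h5 ⊢
    linarith
  refine (sum_le_sum h1).trans ?_
  rw [sum_add_distrib, ← mul_sum, sum_add_distrib, sum_const, sum_const, nsmul_eq_mul,
    nsmul_eq_mul, mul_one, mul_comm (#U : ℝ)]
  refine add_le_add le_rfl ?_
  rw [one_div, inv_mul_eq_div]
  exact div_le_div_of_nonneg_right (add_le_add le_rfl hUT) hD0.le

lemma exists_matching_capped (hE : IsLinearOn r U E) (hr : 1 ≤ r) {θ a K D : ℝ}
    (hθ0 : 0 < θ) (hθ1 : θ ≤ 1 / 2) (ha0 : 0 ≤ a) (ha1 : a ≤ 1) (hK : 0 ≤ K)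
    (hP : MatchingBound r a K) (hD : 1 ≤ D) (hdeg : ∀ u ∈ U, (edgeDeg E u : ℝ) ≤ 2 * D) :
    ∃ M, IsMatchingIn E M ∧ (#U : ℝ) - r * #M ≤ (4 * r * θ ^ 2 + (1 - θ / 3) * a) * #U
      + (1 + 8 * r ^ 2 * 2 ^ (r - 1) * K) * ((degDeviation U E D + √D * #U) / D) := by
  have hD0 : 0 < D := by linarith
  have hp0 : 0 < θ / D := by positivity
  have hp1 : θ / D ≤ 1 := by rw [div_le_one hD0]; linarith
  have hpD : θ / D * D = θ := div_mul_cancel₀ _ hD0.ne'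
  have hsurv := hE.bernExp_sum_survivors_le hr hθ0.le (by linarith) hD hdeg
  set p := θ / D with hp
  set ρ := (1 - p) ^ ⌊D⌋₊ with hρ
  set T := degDeviation U E D + √D * #U with hT
  have hfl1 := Nat.floor_le hD0.le
  have hfl2 := Nat.lt_floor_add_one D
  have hfl3 : (1 : ℝ) ≤ ⌊D⌋₊ := by exact_mod_cast Nat.floor_pos.mpr hD
  have hq0 : 0 ≤ 1 - p := by linarith
  have hq1 : 1 - p ≤ 1 := by linarith
  have hρ0 : 0 ≤ ρ := pow_nonneg hq0 _
  have hρ1 : ρ ≤ 1 := pow_le_one₀ hq0 hq1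
  obtain ⟨hρlow, hρup⟩ := survival_bounds hθ0.le hθ1 hD
  set D' := D * ρ ^ (r - 1) with hD'
  have hρpow : (1 / 2) ^ (r - 1) ≤ ρ ^ (r - 1) := pow_le_pow_left₀ (by norm_num) hρlow _
  have hD'low : D ≤ 2 ^ (r - 1) * D' := by
    have : (2 : ℝ) ^ (r - 1) * (1 / 2) ^ (r - 1) = 1 := by rw [← mul_pow]; norm_num
    calc D = D * (2 ^ (r - 1) * (1 / 2) ^ (r - 1)) := by rw [this, mul_one]
      _ ≤ D * (2 ^ (r - 1) * ρ ^ (r - 1)) := by gcongr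
      _ = 2 ^ (r - 1) * D' := by rw [hD']; ring
  have hD'0 : 0 < D' := by positivity
  have hD'D : D' ≤ D := mul_le_of_le_one_right hD0.le (pow_le_one₀ hρ0 hρ1)
  set Y : V → Finset (Finset V) → ℝ :=
    fun u X => #{e ∈ {e ∈ E | u ∈ e} | Disjoint (blockers E u e) X} with hY
  set G : Finset (Finset V) → ℝ := fun X =>
      r * #{x ∈ meetingPairs E | x.1 ∈ X ∧ x.2 ∈ X}
      + a * #{u ∈ U | Disjoint {e ∈ E | u ∈ e} X}
      + (K / D' * (∑ u ∈ U, |Y u X - D'|) + K / D' * (√D' * #U)) with hG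
  obtain ⟨X, hX⟩ := exists_le_bernExp hp0.le hp1 G
  obtain ⟨M, hM, hMb⟩ := hE.exists_matching_of_round hr hP hK hD'0 Y (fun _ _ => rfl) X
  refine ⟨M, hM, ?_⟩
  have hTS := degDeviation_nonneg U E D
  have hU0 : (0 : ℝ) ≤ #U := Nat.cast_nonneg _
  have hs1 : 1 ≤ √D := Real.one_le_sqrt.mpr hD
  have hUT : (#U : ℝ) ≤ √D * #U := le_mul_of_one_le_left hU0 hs1
  have hT0 : 0 ≤ T := by positivity
  have hr1 : (1 : ℝ) ≤ r := by exact_mod_cast hr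
  have e1 : bernExp p (fun X => (#{x ∈ meetingPairs E | x.1 ∈ X ∧ x.2 ∈ X} : ℝ))
      ≤ 4 * θ ^ 2 * #U := by
    refine (hE.bernExp_card_meetingPairs_le (by linarith) hdeg).trans (le_of_eq ?_)
    rw [← hpD]
    ring
  have e2 : bernExp p (fun X => (#{u ∈ U | Disjoint {e ∈ E | u ∈ e} X} : ℝ))
      ≤ (1 - θ / 3) * #U + T / D :=
    bernExp_card_uncovered_le U E hθ0.le hθ1 hD
  have e3 : bernExp p G ≤ r * (4 * θ ^ 2 * #U) + a * ((1 - θ / 3) * #U + T / D)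
      + (K / D' * (7 * r ^ 2 * T) + K / D' * (√D' * #U)) := by
    rw [hG, bernExp_add, bernExp_add, bernExp_add, bernExp_const_mul, bernExp_const_mul,
      bernExp_const_mul, bernExp_const]
    exact add_le_add (add_le_add (mul_le_mul_of_nonneg_left e1 (Nat.cast_nonneg _))
      (mul_le_mul_of_nonneg_left e2 ha0))
      (add_le_add (mul_le_mul_of_nonneg_left hsurv (div_nonneg hK hD'0.le)) le_rfl)
  have e4 : √D' * #U ≤ r ^ 2 * T := by
    have h1 : √D' * #U ≤ √D * #U := by gcongr
    have h2 : √D * #U ≤ T := by linarith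
    have h3 : T ≤ r ^ 2 * T := le_mul_of_one_le_left hT0 (by nlinarith)
    linarith
  have e5 : K / D' * (7 * r ^ 2 * T) + K / D' * (√D' * #U)
      ≤ 8 * r ^ 2 * 2 ^ (r - 1) * K * (T / D) := by
    have h1 : 1 / D' ≤ 2 ^ (r - 1) / D := by
      rw [div_le_div_iff₀ hD'0 hD0]
      linarith
    calc _ ≤ K / D' * (7 * r ^ 2 * T) + K / D' * (r ^ 2 * T) := by gcongr
      _ = 8 * r ^ 2 * K * T * (1 / D') := by ring
      _ ≤ 8 * r ^ 2 * K * T * (2 ^ (r - 1) / D) := by gcongr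
      _ = _ := by ring
  have e6 : a * (T / D) ≤ T / D := mul_le_of_le_one_left (by positivity) ha1
  have e7 : K * ((∑ u ∈ U, |Y u X - D'| + √D' * #U) / D')
      = K / D' * (∑ u ∈ U, |Y u X - D'|) + K / D' * (√D' * #U) := by ring
  rw [e7] at hMb
  have e8 := (hMb.trans hX).trans e3
  clear_value D' ρ p Y G T
  linarith

end IsLinearOn

end Nibble

section NibbleIteration

lemma IsLinearOn.exists_capped {V : Type} [DecidableEq V] {r : ℕ} {U : Finset V}
    {E : Finset (Finset V)} (hE : IsLinearOn r U E) {D : ℝ} (hD : 0 ≤ D) :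
    ∃ E₀ ⊆ E, (∀ u ∈ U, (edgeDeg E₀ u : ℝ) ≤ 2 * D) ∧
      degDeviation U E₀ D ≤ (1 + 2 * r) * degDeviation U E D := by
  classical
  set E₀ : Finset (Finset V) := {e ∈ E | ∀ u ∈ e, (edgeDeg E u : ℝ) ≤ 2 * D} with hE₀
  have hsub : E₀ ⊆ E := filter_subset _ _
  have hle : ∀ u, (edgeDeg E₀ u : ℝ) ≤ edgeDeg E u := fun u => by
    exact_mod_cast card_le_card (filter_subset_filter _ hsub)
  refine ⟨E₀, hsub, fun u _ => ?_, ?_⟩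
  · by_cases h : (edgeDeg E u : ℝ) ≤ 2 * D
    · exact (hle u).trans h
    · have : edgeDeg E₀ u = 0 := by
        rw [edgeDeg, card_eq_zero, filter_eq_empty_iff]
        intro e he hue
        exact h ((mem_filter.mp he).2 u hue)
      rw [this]
      simpa using hD
  · have hlin : IsLinearOn r U E₀ := hE.mono hsub fun e he => hE.subset e (hsub he)
    have h1 : degDeviation U E₀ D ≤ degDeviation U E D + (r * #E - r * #E₀) := by
      rw [← hE.sum_edgeDeg, ← hlin.sum_edgeDeg, ← sum_sub_distrib, degDeviation, degDeviation,
        ← sum_add_distrib]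
      refine sum_le_sum fun u _ => ?_
      have := abs_sub_le (edgeDeg E₀ u : ℝ) (edgeDeg E u) D
      rw [abs_sub_comm (edgeDeg E₀ u : ℝ) (edgeDeg E u),
        abs_of_nonneg (sub_nonneg.mpr (hle u))] at this
      linarith
    have h2 : (#E : ℝ) - #E₀ ≤ 2 * degDeviation U E D := by
      have h3 : #(E \ E₀) ≤ ∑ u ∈ U with 2 * D < edgeDeg E u, edgeDeg E u := by
        have : E \ E₀ ⊆ ({u ∈ U | 2 * D < edgeDeg E u} : Finset V).biUnion
            fun u => {e ∈ E | u ∈ e} := by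
          intro e he
          simp only [hE₀, mem_sdiff, mem_filter, not_and, not_forall, not_le] at he
          obtain ⟨u, hu, hd⟩ := he.2 he.1
          exact mem_biUnion.mpr ⟨u, mem_filter.mpr ⟨hE.subset e he.1 hu, hd⟩,
            mem_filter.mpr ⟨he.1, hu⟩⟩
        exact (card_le_card this).trans card_biUnion_le
      rw [← Nat.cast_sub (card_le_card hsub), ← card_sdiff_of_subset hsub]
      calc (#(E \ E₀) : ℝ) ≤ ∑ u ∈ U with 2 * D < edgeDeg E u, (edgeDeg E u : ℝ) := by
            exact_mod_cast h3
        _ ≤ ∑ u ∈ U with 2 * D < edgeDeg E u, 2 * |(edgeDeg E u : ℝ) - D| := by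
            refine sum_le_sum fun u hu => ?_
            have h4 := (mem_filter.mp hu).2
            have h5 := le_abs_self ((edgeDeg E u : ℝ) - D)
            linarith
        _ ≤ ∑ u ∈ U, 2 * |(edgeDeg E u : ℝ) - D| :=
            sum_le_sum_of_subset_of_nonneg (filter_subset _ _) fun u _ _ => by positivity
        _ = 2 * degDeviation U E D := by rw [degDeviation, mul_sum]
    have h3 := mul_le_mul_of_nonneg_left h2 (Nat.cast_nonneg r : (0 : ℝ) ≤ r)
    linarith

lemma MatchingBound.step {r : ℕ} (hr : 1 ≤ r) {θ a K : ℝ} (hθ0 : 0 < θ) (hθ1 : θ ≤ 1 / 2)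
    (ha0 : 0 ≤ a) (ha1 : a ≤ 1) (hK : 0 ≤ K) (hP : MatchingBound r a K) :
    MatchingBound r (4 * r * θ ^ 2 + (1 - θ / 3) * a)
      ((1 + 2 * r) * (1 + 8 * r ^ 2 * 2 ^ (r - 1) * K)) := by
  intro V _ _ U E D hD0 hE
  have hdev := degDeviation_nonneg U E D
  have hL : (1 : ℝ) ≤ 1 + 8 * r ^ 2 * 2 ^ (r - 1) * K := by
    have : 0 ≤ 8 * (r : ℝ) ^ 2 * 2 ^ (r - 1) * K := by positivity
    linarith
  have hU0 : (0 : ℝ) ≤ #U := Nat.cast_nonneg _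
  have hr0 : (0 : ℝ) ≤ r := Nat.cast_nonneg _
  set L := 1 + 8 * (r : ℝ) ^ 2 * 2 ^ (r - 1) * K
  rcases le_or_gt 1 D with hD | hD
  · obtain ⟨E₀, hsub, hdeg, hdev₀⟩ := hE.exists_capped hD0.le
    have hlin : IsLinearOn r U E₀ := hE.mono hsub fun e he => hE.subset e (hsub he)
    obtain ⟨M, hM, hb⟩ := hlin.exists_matching_capped hr hθ0 hθ1 ha0 ha1 hK hP hD hdeg
    refine ⟨M, ⟨hM.1.trans hsub, hM.2⟩, hb.trans (add_le_add le_rfl ?_)⟩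
    rw [mul_comm (1 + 2 * (r : ℝ)) L, mul_assoc L]
    refine mul_le_mul_of_nonneg_left ?_ (zero_le_one.trans hL)
    rw [← mul_div_assoc]
    refine div_le_div_of_nonneg_right ?_ hD0.le
    have : 0 ≤ √D * #U := by positivity
    nlinarith [mul_nonneg hr0 this]
  · refine ⟨∅, ⟨empty_subset _, by simp⟩, ?_⟩
    have hs : D ≤ √D := Real.le_sqrt_of_sq_le (by nlinarith)
    have h1 : (#U : ℝ) ≤ (degDeviation U E D + √D * #U) / D := by
      rw [le_div_iff₀ hD0]
      nlinarith
    have h2 : 1 ≤ (1 + 2 * r) * L := by nlinarith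
    have h3 : 0 ≤ (4 * r * θ ^ 2 + (1 - θ / 3) * a) * #U := by
      have : 0 ≤ 1 - θ / 3 := by linarith
      positivity
    simp only [card_empty, Nat.cast_zero, mul_zero, sub_zero]
    have h4 : 0 ≤ (degDeviation U E D + √D * #U) / D := hU0.trans h1
    nlinarith

/-- Nearly regular linear hypergraphs of large degree have almost perfect matchings. -/
theorem exists_matchingBound {r : ℕ} (hr : 1 ≤ r) {a : ℝ} (ha : 0 < a) :
    ∃ K, 0 ≤ K ∧ MatchingBound r a K := by
  set S : Set ℝ := {a | (0 ≤ a ∧ a ≤ 1) ∧ ∃ K, 0 ≤ K ∧ MatchingBound r a K} with hS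
  have h1S : (1 : ℝ) ∈ S := by
    refine ⟨⟨zero_le_one, le_rfl⟩, 0, le_rfl, fun V _ _ U E D _ _ => ⟨∅, ⟨by simp, by simp⟩, ?_⟩⟩
    simp
  have hbdd : BddBelow S := ⟨0, fun x hx => hx.1.1⟩
  set b := sInf S with hb
  have hb1 : b ≤ 1 := csInf_le hbdd h1S
  have hr1 : (1 : ℝ) ≤ r := by exact_mod_cast hr
  have hb0 : b ≤ 0 := by
    by_contra! hpos
    set θ := b / (48 * r) with hθ
    have hθr : θ * (48 * r) = b := div_mul_cancel₀ _ (by positivity)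
    have hθ0 : 0 < θ := by positivity
    have hθ1 : θ ≤ 1 / 48 := by nlinarith
    obtain ⟨c, hcS, hcb⟩ := exists_lt_of_csInf_lt ⟨1, h1S⟩
      (show sInf S < b * (1 + θ / 6) by rw [← hb]; nlinarith)
    obtain ⟨⟨hc0, hc1⟩, K, hK, hP⟩ := hcS
    have hstep := hP.step hr hθ0 (by linarith) hc0 hc1 hK
    have h2 : 4 * r * θ ^ 2 = θ * b / 12 := by rw [← hθr]; ring
    have h3 : 0 ≤ 1 - θ / 3 := by linarith
    have h4 : 4 * r * θ ^ 2 + (1 - θ / 3) * c < b := by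
      have h5 := mul_le_mul_of_nonneg_left hcb.le h3
      have h6 : (1 - θ / 3) * (b * (1 + θ / 6)) ≤ b - θ * b / 6 := by
        have : 0 ≤ b * θ ^ 2 := by positivity
        nlinarith
      have h7 : 0 < θ * b := by positivity
      linarith
    refine absurd (csInf_le hbdd ⟨⟨by positivity, by linarith⟩, _, by positivity, hstep⟩) ?_
    rw [← hb]
    exact not_le.mpr h4
  obtain ⟨c, hcS, hca⟩ := exists_lt_of_csInf_lt ⟨1, h1S⟩ (hb0.trans_lt ha)
  obtain ⟨-, K, hK, hP⟩ := hcS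
  refine ⟨K, hK, fun V _ _ U E D hD hE => ?_⟩
  obtain ⟨M, hM, hMb⟩ := hP V U E D hD hE
  exact ⟨M, hM, hMb.trans (add_le_add
    (mul_le_mul_of_nonneg_right hca.le (Nat.cast_nonneg _)) le_rfl)⟩

end NibbleIteration

section Copies

variable {m k n : ℕ}

/-- All copies of `J` in the complete hypergraph on `Fin n`. -/
noncomputable def copies (J : Finset (Finset (Fin m))) (n : ℕ) : Finset (Finset (Finset (Fin n))) :=
  univ.image fun f : Fin m ↪ Fin n => J.image fun A => A.image f

/-- The vertex set spanned by a family of hypergraphs. -/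
def familySpan (𝒜 : Finset (Finset (Finset (Fin n)))) : Finset (Fin n) := (𝒜.sup id).sup id

lemma sup_image_image {J : Finset (Finset (Fin m))} (hJv : J.sup id = univ)
    (f : Fin m → Fin n) : (J.image fun A => A.image f).sup id = univ.image f := by
  rw [← hJv]
  ext x
  simp only [mem_sup, mem_image, id]
  constructor
  · rintro ⟨_, ⟨A, hA, rfl⟩, hx⟩
    obtain ⟨y, hy, rfl⟩ := mem_image.mp hx
    exact ⟨y, ⟨A, hA, hy⟩, rfl⟩
  · rintro ⟨y, ⟨A, hA, hy⟩, rfl⟩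
    exact ⟨_, ⟨A, hA, rfl⟩, mem_image_of_mem f hy⟩

lemma subset_sup_id {J' : Finset (Finset (Fin n))} {A : Finset (Fin n)} (hA : A ∈ J') :
    A ⊆ J'.sup id := le_sup (f := id) hA

variable {J : Finset (Finset (Fin m))}

lemma isCopyOf_of_mem_copies {J' : Finset (Finset (Fin n))} (h : J' ∈ copies J n) :
    IsCopyOf J' J := by
  obtain ⟨f, -, rfl⟩ := mem_image.mp h
  exact ⟨f, f.injective.injOn, rfl⟩

lemma card_of_mem_copies {J' : Finset (Finset (Fin n))} (h : J' ∈ copies J n) : #J' = #J := by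
  obtain ⟨f, -, rfl⟩ := mem_image.mp h
  exact card_image_of_injective _ (image_injective f.injective)

lemma card_sup_of_mem_copies (hJv : J.sup id = univ) {J' : Finset (Finset (Fin n))}
    (h : J' ∈ copies J n) : #(J'.sup id) = m := by
  obtain ⟨f, -, rfl⟩ := mem_image.mp h
  rw [sup_image_image hJv, card_image_of_injective _ f.injective, card_univ, Fintype.card_fin]

lemma card_edge_of_mem_copies (hJ : ∀ A ∈ J, #A = k) {J' : Finset (Finset (Fin n))}
    (h : J' ∈ copies J n) {A : Finset (Fin n)} (hA : A ∈ J') : #A = k := by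
  obtain ⟨f, -, rfl⟩ := mem_image.mp h
  obtain ⟨B, hB, rfl⟩ := mem_image.mp hA
  rw [card_image_of_injective _ f.injective, hJ B hB]

lemma exists_perm_image_eq {S T : Finset (Fin n)} (h : #S = #T) :
    ∃ σ : Equiv.Perm (Fin n), S.image σ = T := by
  have e : {x // x ∈ S} ≃ {x // x ∈ T} := Finset.equivOfCardEq h
  refine ⟨e.extendSubtype, eq_of_subset_of_card_le ?_ ?_⟩
  · intro y hy
    obtain ⟨x, hx, rfl⟩ := mem_image.mp hy
    exact e.extendSubtype_mem x hx
  · rw [card_image_of_injective _ (Equiv.injective _), h]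

lemma card_copies_mem_eq {S T : Finset (Fin n)} (h : #S = #T) :
    #{J' ∈ copies J n | S ∈ J'} = #{J' ∈ copies J n | T ∈ J'} := by
  have key : ∀ S T : Finset (Fin n), #S = #T →
      #{J' ∈ copies J n | S ∈ J'} ≤ #{J' ∈ copies J n | T ∈ J'} := by
    intro S T h
    obtain ⟨σ, rfl⟩ := exists_perm_image_eq h
    refine card_le_card_of_injOn (fun J' => J'.image fun A => A.image σ) ?_
      (image_injective (image_injective σ.injective)).injOn
    intro J' hJ'
    simp only [coe_filter, Set.mem_ofPred_eq] at hJ' ⊢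
    obtain ⟨hc, hS⟩ := hJ'
    obtain ⟨f, -, rfl⟩ := mem_image.mp hc
    refine ⟨mem_image.mpr ⟨f.trans σ.toEmbedding, mem_univ _, ?_⟩, mem_image_of_mem _ hS⟩
    rw [image_image]
    refine image_congr fun A _ => ?_
    simp only [Function.comp_apply, image_image]
    rfl
  exact le_antisymm (key S T h) (key T S h.symm)

lemma choose_le_card_copies (hJv : J.sup id = univ) : n.choose m ≤ #(copies J n) := by
  have : powersetCard m (univ : Finset (Fin n)) ⊆ (copies J n).image fun J' => J'.sup id := by
    intro W hW
    have hW' := (mem_powersetCard.mp hW).2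
    refine mem_image.mpr ⟨_, mem_image_of_mem _ (mem_univ (W.orderEmbOfFin hW').toEmbedding), ?_⟩
    rw [sup_image_image hJv]
    exact image_orderEmbOfFin_univ W hW'
  have h := (card_le_card this).trans card_image_le
  rwa [card_powersetCard, card_univ, Fintype.card_fin] at h

lemma pow_le_mul_choose (h : 2 * m ≤ n) (hkm : k ≤ m) :
    n ^ (m - k) ≤ 2 ^ (m - k) * (m - k).factorial * (n - k).choose (m - k) := by
  have h1 := Nat.pow_sub_le_descFactorial (n - k) (m - k)
  rw [Nat.descFactorial_eq_factorial_mul_choose] at h1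
  rw [mul_assoc]
  refine le_trans ?_ (Nat.mul_le_mul_left _ h1)
  rw [← mul_pow]
  exact Nat.pow_le_pow_left (by omega) _

/-- Every `k`-set lies in the same number of copies of `J`, of order `n ^ (m - k)`. -/
lemma exists_card_copies_mem (hJ : ∀ A ∈ J, #A = k) (hJv : J.sup id = univ) (hJ0 : J.Nonempty)
    (hkm : k ≤ m) (hn : 2 * m ≤ n) :
    ∃ c : ℕ, (∀ S : Finset (Fin n), #S = k → #{J' ∈ copies J n | S ∈ J'} = c) ∧
      n ^ (m - k) ≤ 2 ^ (m - k) * (m - k).factorial * m.choose k * c := by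
  obtain ⟨S₀, -, hS₀⟩ := exists_subset_card_eq (s := (univ : Finset (Fin n))) (n := k)
    (by rw [card_univ, Fintype.card_fin]; omega)
  set c := #{J' ∈ copies J n | S₀ ∈ J'} with hc
  have hcS : ∀ S : Finset (Fin n), #S = k → #{J' ∈ copies J n | S ∈ J'} = c := fun S hS =>
    card_copies_mem_eq (hS.trans hS₀.symm)
  refine ⟨c, hcS, ?_⟩
  have h1 : n.choose k * c = #J * #(copies J n) := by
    have h2 := sum_card_bipartiteAbove_eq_sum_card_bipartiteBelow
      (s := powersetCard k (univ : Finset (Fin n))) (t := copies J n) (fun S J' => S ∈ J')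
    simp only [bipartiteAbove, bipartiteBelow] at h2
    rw [sum_congr rfl fun S hS => hcS S (mem_powersetCard.mp hS).2, sum_const, card_powersetCard,
      card_univ, Fintype.card_fin, smul_eq_mul] at h2
    rw [h2, sum_congr rfl (g := fun _ => #J), sum_const, smul_eq_mul, mul_comm]
    intro J' hJ'
    rw [← card_of_mem_copies hJ']
    congr 1
    ext S
    simp only [mem_filter, mem_powersetCard]
    exact ⟨fun h => h.2, fun h => ⟨⟨subset_univ _, card_edge_of_mem_copies hJ hJ' h⟩, h⟩⟩
  have h3 : n.choose m ≤ n.choose k * c := by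
    rw [h1]
    exact (choose_le_card_copies hJv).trans (Nat.le_mul_of_pos_left _ (card_pos.mpr hJ0))
  have h4 := Nat.choose_mul (n := n) (k := m) (s := k) hkm
  have h5 : (n - k).choose (m - k) ≤ m.choose k * c := by
    have h6 : 0 < n.choose k := Nat.choose_pos (by omega)
    refine Nat.le_of_mul_le_mul_left ?_ h6
    rw [← h4]
    calc _ ≤ n.choose k * c * m.choose k := Nat.mul_le_mul_right _ h3
      _ = _ := by ring
  refine (pow_le_mul_choose hn hkm).trans ?_
  rw [mul_assoc _ (m.choose k)]
  exact Nat.mul_le_mul_left _ h5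

/-- Objects whose support contains `S` and has at most `s` elements are few. -/
lemma card_filter_support_le {κ : Type*} (F : Finset κ) (supp : κ → Finset (Fin n)) {s B : ℕ}
    (hB : ∀ W : Finset (Fin n), #W = s → #{x ∈ F | supp x ⊆ W} ≤ B) (S : Finset (Fin n))
    (hsn : s ≤ n) : #{x ∈ F | S ⊆ supp x ∧ #(supp x) ≤ s} ≤ n ^ (s - #S) * B := by
  classical
  have hsub : ({x ∈ F | S ⊆ supp x ∧ #(supp x) ≤ s} : Finset κ) ⊆
      ({T ∈ powersetCard (s - #S) univ | #(S ∪ T) = s} : Finset (Finset (Fin n))).biUnion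
        fun T => {x ∈ F | supp x ⊆ S ∪ T} := by
    intro x hx
    simp only [mem_filter] at hx
    obtain ⟨W, hxW, hW⟩ := exists_superset_card_eq hx.2.2 (by rwa [Fintype.card_fin])
    have hSW : S ⊆ W := hx.2.1.trans hxW
    have hU : S ∪ W \ S = W := union_sdiff_of_subset hSW
    refine mem_biUnion.mpr ⟨W \ S, mem_filter.mpr ⟨mem_powersetCard.mpr ⟨subset_univ _, ?_⟩, ?_⟩,
      mem_filter.mpr ⟨hx.1, ?_⟩⟩
    · rw [card_sdiff_of_subset hSW, hW]
    · rw [hU, hW]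
    · rwa [hU]
  refine (card_le_card hsub).trans ((card_biUnion_le_card_mul _ _ B ?_).trans ?_)
  · intro T hT
    exact hB _ (mem_filter.mp hT).2
  · refine Nat.mul_le_mul_right _ ((card_filter_le _ _).trans ?_)
    rw [card_powersetCard, card_univ, Fintype.card_fin]
    exact Nat.choose_le_pow _ _

lemma mem_powerset_powerset_of_sup_subset {J' : Finset (Finset (Fin n))} {W : Finset (Fin n)}
    (h : J'.sup id ⊆ W) : J' ∈ W.powerset.powerset := by
  rw [mem_powerset]
  exact fun A hA => mem_powerset.mpr ((subset_sup_id hA).trans h)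

lemma card_families_le (F : Finset (Finset (Finset (Finset (Fin n))))) {s : ℕ} (hsn : s ≤ n) :
    #{𝒜 ∈ F | #(familySpan 𝒜) ≤ s} ≤ n ^ s * 2 ^ 2 ^ 2 ^ s := by
  have h := card_filter_support_le F familySpan (s := s) (B := 2 ^ 2 ^ 2 ^ s) ?_ ∅ hsn
  · simpa using h
  · intro W hW
    rw [← hW, ← card_powerset, ← card_powerset, ← card_powerset]
    refine card_le_card fun 𝒜 h𝒜 => mem_powerset.mpr fun J' hmem => ?_
    refine mem_powerset_powerset_of_sup_subset (Subset.trans ?_ (mem_filter.mp h𝒜).2)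
    exact sup_mono (le_sup (f := id) hmem)

/-- Ordered pairs of copies of `J` through `S` whose vertex sets share more than
`k` vertices. -/
noncomputable def overlappingPairs (J : Finset (Finset (Fin m))) (k : ℕ) (S : Finset (Fin n)) :
    Finset (Finset (Finset (Fin n)) × Finset (Finset (Fin n))) :=
  {x ∈ copies J n ×ˢ copies J n | (S ∈ x.1 ∧ S ∈ x.2) ∧ k < #(x.1.sup id ∩ x.2.sup id)}

lemma card_overlappingPairs_le (hJv : J.sup id = univ) {S : Finset (Fin n)} (hS : #S = k)
    (hn : 2 * m ≤ n) :
    #(overlappingPairs J k S) ≤ n ^ (2 * m - k - 1 - k) * (2 ^ 2 ^ (2 * m - k - 1)) ^ 2 := by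
  have h := card_filter_support_le (copies J n ×ˢ copies J n)
    (fun x => x.1.sup id ∪ x.2.sup id) (s := 2 * m - k - 1)
    (B := (2 ^ 2 ^ (2 * m - k - 1)) ^ 2) ?_ S (by omega)
  · rw [hS] at h
    refine (card_le_card ?_).trans h
    intro x hx
    simp only [overlappingPairs, mem_filter, mem_product] at hx ⊢
    refine ⟨hx.1, (subset_sup_id hx.2.1.1).trans subset_union_left, ?_⟩
    have h1 := card_union_add_card_inter (x.1.sup id) (x.2.sup id)
    rw [card_sup_of_mem_copies hJv hx.1.1, card_sup_of_mem_copies hJv hx.1.2] at h1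
    omega
  · intro W hW
    rw [← hW, ← card_powerset, ← card_powerset, sq, ← card_product]
    refine card_le_card fun x hx => mem_product.mpr ?_
    have h2 := (mem_filter.mp hx).2
    exact ⟨mem_powerset_powerset_of_sup_subset (subset_union_left.trans h2),
      mem_powerset_powerset_of_sup_subset (subset_union_right.trans h2)⟩

end Copies

section GoodPacking

variable {m k e n : ℕ}

/-- An induced packing of copies of `J` in which any `ℓ ≤ e` members span many vertices. -/
structure IsGoodPacking (J : Finset (Finset (Fin m))) (k e : ℕ)
    (M : Finset (Finset (Finset (Fin n)))) : Prop where
  subset : M ⊆ copies J n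
  disjoint : ∀ A ∈ M, ∀ B ∈ M, A ≠ B → Disjoint A B
  card_inter : ∀ A ∈ M, ∀ B ∈ M, A ≠ B → #(A.sup id ∩ B.sup id) ≤ k
  notMem : ∀ A ∈ M, ∀ B ∈ M, A ≠ B → #(A.sup id ∩ B.sup id) = k → A.sup id ∩ B.sup id ∉ A
  lt_span : ∀ 𝒜 ⊆ M, 2 ≤ #𝒜 → #𝒜 ≤ e → #𝒜 * m - (#𝒜 - 1) * k - 1 < #(familySpan 𝒜)

/-- The `k`-subsets of the vertex set of `A` which are not edges of `A`. -/
def nonEdges (k : ℕ) (A : Finset (Finset (Fin n))) : Finset (Finset (Fin n)) :=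
  powersetCard k (A.sup id) \ A

/-- Families of at most `e` copies of `J` spanning too few vertices. -/
noncomputable def conflicts (J : Finset (Finset (Fin m))) (k e n : ℕ) :
    Finset (Finset (Finset (Finset (Fin n)))) :=
  {𝒜 ∈ (copies J n).powerset | (2 ≤ #𝒜 ∧ #𝒜 ≤ e) ∧
    #(familySpan 𝒜) ≤ #𝒜 * m - (#𝒜 - 1) * k - 1}

/-- The copies of `J` in `X` with no edge in `R` and all non-edges in `R`. -/
noncomputable def survivors (J : Finset (Finset (Fin m))) (k : ℕ) (R : Finset (Finset (Fin n)))
    (X : Finset (Finset (Finset (Fin n)))) : Finset (Finset (Finset (Fin n))) :=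
  {J' ∈ copies J n | J' ∈ X ∧ Disjoint J' R ∧ nonEdges k J' ⊆ R}

/-- The survivors which lie in no conflict inside `X`. -/
noncomputable def cleaned (J : Finset (Finset (Fin m))) (k e : ℕ) (R : Finset (Finset (Fin n)))
    (X : Finset (Finset (Finset (Fin n)))) : Finset (Finset (Finset (Fin n))) :=
  {J' ∈ survivors J k R X | ∀ 𝒜 ∈ conflicts J k e n, 𝒜 ⊆ X → J' ∉ 𝒜}

/-- The number of copies of `J` through `S` in `X` which would survive if `S` were not in `R`. -/
noncomputable def potentialDeg (J : Finset (Finset (Fin m))) (k : ℕ) (S : Finset (Fin n))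
    (R : Finset (Finset (Fin n))) (X : Finset (Finset (Finset (Fin n)))) : ℕ :=
  #{J' ∈ copies J n | S ∈ J' ∧ J' ∈ X ∧ Disjoint (J'.erase S) R ∧ nonEdges k J' ⊆ R}

variable {J : Finset (Finset (Fin m))} {R : Finset (Finset (Fin n))}
  {X : Finset (Finset (Finset (Fin n)))}

lemma mem_survivors {J' : Finset (Finset (Fin n))} : J' ∈ survivors J k R X ↔
    J' ∈ copies J n ∧ J' ∈ X ∧ Disjoint J' R ∧ nonEdges k J' ⊆ R := mem_filter

lemma cleaned_subset_survivors : cleaned J k e R X ⊆ survivors J k R X := filter_subset _ _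

lemma lt_span_of_subset_cleaned {𝒜 : Finset (Finset (Finset (Fin n)))}
    (h : 𝒜 ⊆ cleaned J k e R X) (h2 : 2 ≤ #𝒜) (he : #𝒜 ≤ e) :
    #𝒜 * m - (#𝒜 - 1) * k - 1 < #(familySpan 𝒜) := by
  by_contra! hcon
  obtain ⟨A, hA⟩ : 𝒜.Nonempty := card_pos.mp (by omega)
  have hs : ∀ B ∈ 𝒜, B ∈ copies J n ∧ B ∈ X := fun B hB =>
    ⟨(mem_survivors.mp (cleaned_subset_survivors (h hB))).1,
      (mem_survivors.mp (cleaned_subset_survivors (h hB))).2.1⟩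
  exact (mem_filter.mp (h hA)).2 𝒜 (mem_filter.mpr ⟨mem_powerset.mpr fun B hB => (hs B hB).1,
    ⟨h2, he⟩, hcon⟩) (fun B hB => (hs B hB).2) hA

lemma card_inter_le_of_mem_cleaned (hJv : J.sup id = univ) (he : 2 ≤ e)
    {A B : Finset (Finset (Fin n))} (hA : A ∈ cleaned J k e R X)
    (hB : B ∈ cleaned J k e R X) (hAB : A ≠ B) : #(A.sup id ∩ B.sup id) ≤ k := by
  have h := lt_span_of_subset_cleaned (𝒜 := {A, B}) (J := J) (k := k) (e := e) (R := R) (X := X)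
    (by intro C hC; simp only [mem_insert, mem_singleton] at hC
        rcases hC with rfl | rfl <;> assumption)
    (by rw [card_pair hAB]) (by rw [card_pair hAB]; exact he)
  have hs : familySpan {A, B} = A.sup id ∪ B.sup id := by
    simp [familySpan, sup_union]
  rw [card_pair hAB, hs] at h
  have h1 := card_union_add_card_inter (A.sup id) (B.sup id)
  rw [card_sup_of_mem_copies hJv (mem_survivors.mp (cleaned_subset_survivors hA)).1,
    card_sup_of_mem_copies hJv (mem_survivors.mp (cleaned_subset_survivors hB)).1] at h1
  omega

lemma eq_inter_of_mem_of_mem {A B : Finset (Finset (Fin n))} {S : Finset (Fin n)}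
    (hS : #S = k) (hA : S ∈ A) (hB : S ∈ B) (h : #(A.sup id ∩ B.sup id) ≤ k) :
    S = A.sup id ∩ B.sup id :=
  eq_of_subset_of_card_le (subset_inter (subset_sup_id hA) (subset_sup_id hB)) (hS ▸ h)

lemma isLinearOn_cleaned (hJ : ∀ A ∈ J, #A = k) (hJv : J.sup id = univ)
    (he : 2 ≤ e) :
    IsLinearOn #J (powersetCard k univ \ R) (cleaned J k e R X) where
  subset A hA S hS := by
    have hA' := mem_survivors.mp (cleaned_subset_survivors hA)
    exact mem_sdiff.mpr ⟨mem_powersetCard.mpr ⟨subset_univ _, card_edge_of_mem_copies hJ hA'.1 hS⟩,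
      Finset.disjoint_left.mp hA'.2.2.1 hS⟩
  card A hA := card_of_mem_copies (mem_survivors.mp (cleaned_subset_survivors hA)).1
  inter A hA B hB hAB := by
    have hle := card_inter_le_of_mem_cleaned hJv he hA hB hAB
    have hc := (mem_survivors.mp (cleaned_subset_survivors hA)).1
    refine card_le_one.mpr fun S hS T hT => ?_
    rw [mem_inter] at hS hT
    rw [eq_inter_of_mem_of_mem (card_edge_of_mem_copies hJ hc hS.1) hS.1 hS.2 hle,
      eq_inter_of_mem_of_mem (card_edge_of_mem_copies hJ hc hT.1) hT.1 hT.2 hle]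

lemma isGoodPacking_of_isMatchingIn (hJv : J.sup id = univ) (he : 2 ≤ e)
    {M : Finset (Finset (Finset (Fin n)))}
    (hM : IsMatchingIn (cleaned J k e R X) M) : IsGoodPacking J k e M where
  subset A hA := (mem_survivors.mp (cleaned_subset_survivors (hM.1 hA))).1
  disjoint := hM.2
  card_inter A hA B hB hAB :=
    card_inter_le_of_mem_cleaned hJv he (hM.1 hA) (hM.1 hB) hAB
  notMem A hA B hB hAB hcard hmem := by
    have hA' := mem_survivors.mp (cleaned_subset_survivors (hM.1 hA))
    have hB' := mem_survivors.mp (cleaned_subset_survivors (hM.1 hB))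
    refine Finset.disjoint_left.mp hA'.2.2.1 hmem (hB'.2.2.2 (mem_sdiff.mpr
      ⟨mem_powersetCard.mpr ⟨inter_subset_right, hcard⟩, fun hmem' => ?_⟩))
    exact Finset.disjoint_left.mp (hM.2 A hA B hB hAB) hmem hmem'
  lt_span _ h𝒜 := lt_span_of_subset_cleaned (h𝒜.trans hM.1)

lemma edgeDeg_survivors {S : Finset (Fin n)} (hS : S ∉ R) :
    edgeDeg (survivors J k R X) S = potentialDeg J k S R X := by
  rw [edgeDeg, potentialDeg, survivors, filter_filter]
  congr 1
  ext J'
  simp only [mem_filter, and_congr_right_iff]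
  intro _
  have : S ∈ J' → (Disjoint J' R ↔ Disjoint (J'.erase S) R) := by
    intro h
    conv_lhs => rw [← insert_erase h, disjoint_insert_left]
    simp [hS]
  tauto

lemma card_survivors_sdiff_cleaned_le :
    #(survivors J k R X \ cleaned J k e R X) ≤ #{𝒜 ∈ conflicts J k e n | 𝒜 ⊆ X} * e := by
  refine (card_le_card (t := ({𝒜 ∈ conflicts J k e n | 𝒜 ⊆ X}).biUnion id) ?_).trans
    (card_biUnion_le_card_mul _ _ _ fun 𝒜 h𝒜 => ?_)
  · intro A hA
    rw [mem_sdiff] at hA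
    have h := hA.2
    simp only [cleaned, mem_filter, hA.1, true_and, not_forall, not_not] at h
    obtain ⟨𝒜, h1, h2, h3⟩ := h
    exact mem_biUnion.mpr ⟨𝒜, mem_filter.mpr ⟨h1, h2⟩, h3⟩
  · exact (mem_filter.mp (mem_filter.mp h𝒜).1).2.1.2

lemma degDeviation_cleaned_le (hJ : ∀ A ∈ J, #A = k) (D : ℝ) :
    degDeviation (powersetCard k univ \ R) (cleaned J k e R X) D ≤
      ∑ S ∈ powersetCard k (univ : Finset (Fin n)), |(potentialDeg J k S R X : ℝ) - D|
        + #J * e * #{𝒜 ∈ conflicts J k e n | 𝒜 ⊆ X} := by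
  set U := powersetCard k (univ : Finset (Fin n)) \ R with hU
  set E₀ := survivors J k R X with hE₀
  set E₁ := cleaned J k e R X with hE₁
  have hsub : E₁ ⊆ E₀ := cleaned_subset_survivors
  have hdeg : ∀ S, (edgeDeg E₀ S : ℝ) = edgeDeg E₁ S + edgeDeg (E₀ \ E₁) S := by
    intro S
    rw [edgeDeg, edgeDeg, edgeDeg, ← Nat.cast_add, ← card_union_of_disjoint, ← filter_union,
      union_sdiff_of_subset hsub]
    exact disjoint_filter_filter disjoint_sdiff
  have h1 : ∑ S ∈ U, (edgeDeg (E₀ \ E₁) S : ℝ) ≤ #J * e * #{𝒜 ∈ conflicts J k e n | 𝒜 ⊆ X} := by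
    have h2 : ∀ A ∈ E₀ \ E₁, A ⊆ U ∧ #A = #J := by
      intro A hA
      have hA' := mem_survivors.mp (mem_sdiff.mp hA).1
      refine ⟨fun S hS => mem_sdiff.mpr ⟨mem_powersetCard.mpr
        ⟨subset_univ _, card_edge_of_mem_copies hJ hA'.1 hS⟩,
        Finset.disjoint_left.mp hA'.2.2.1 hS⟩, card_of_mem_copies hA'.1⟩
    have h3 := sum_edgeDeg_mul (fun A hA => (h2 A hA).1) fun _ => 1
    simp only [mul_one, sum_const, nsmul_eq_mul] at h3
    rw [h3, sum_congr rfl fun A hA => by rw [(h2 A hA).2], sum_const, nsmul_eq_mul]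
    have h4 : (#(E₀ \ E₁) : ℝ) ≤ #{𝒜 ∈ conflicts J k e n | 𝒜 ⊆ X} * e := by
      exact_mod_cast card_survivors_sdiff_cleaned_le
    nlinarith [Nat.cast_nonneg (α := ℝ) #J]
  refine le_trans ?_ (add_le_add_right h1 _)
  calc degDeviation U E₁ D
      ≤ ∑ S ∈ U, (|(potentialDeg J k S R X : ℝ) - D| + edgeDeg (E₀ \ E₁) S) := by
        refine sum_le_sum fun S hS => ?_
        rw [← edgeDeg_survivors (mem_sdiff.mp hS).2, ← hE₀]
        have h5 : (edgeDeg E₁ S : ℝ) - D = (edgeDeg E₀ S - D) - edgeDeg (E₀ \ E₁) S := by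
          rw [hdeg S]; ring
        rw [h5]
        refine (abs_sub _ _).trans ?_
        rw [Nat.abs_cast]
    _ ≤ _ := by
        rw [sum_add_distrib]
        gcongr
        exact sdiff_subset

lemma exists_isGoodPacking_of_matchingBound (hJ : ∀ A ∈ J, #A = k) (hJv : J.sup id = univ) (he : 2 ≤ e)
    {a K D : ℝ} (ha : 0 ≤ a) (hK : 0 ≤ K)
    (hMB : MatchingBound #J a K) (hD : 0 < D) (R : Finset (Finset (Fin n)))
    (X : Finset (Finset (Finset (Fin n)))) :
    ∃ M : Finset (Finset (Finset (Fin n))), IsGoodPacking J k e M ∧ (n.choose k : ℝ) - #J * #M ≤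
      ∑ S ∈ powersetCard k (univ : Finset (Fin n)), (if S ∈ R then (1 : ℝ) else 0)
        + a * n.choose k + K / D * (
        ∑ S ∈ powersetCard k (univ : Finset (Fin n)), |(potentialDeg J k S R X : ℝ) - D|
        + #J * e * ∑ 𝒜 ∈ conflicts J k e n, (if 𝒜 ⊆ X then (1 : ℝ) else 0)
        + √D * n.choose k) := by
  obtain ⟨M, hM, hbound⟩ := hMB _ _ _ D hD (isLinearOn_cleaned (R := R) (X := X) hJ hJv he)
  refine ⟨M, isGoodPacking_of_isMatchingIn hJv he hM, ?_⟩
  have hcard : #(powersetCard k (univ : Finset (Fin n))) = n.choose k := by simp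
  have h1 : (n.choose k : ℝ) = #(powersetCard k (univ : Finset (Fin n)) \ R)
      + ∑ S ∈ powersetCard k (univ : Finset (Fin n)), (if S ∈ R then (1 : ℝ) else 0) := by
    rw [sum_boole, ← hcard, ← card_filter_add_card_filter_not (fun S => S ∈ R)
      (s := powersetCard k (univ : Finset (Fin n))), sdiff_eq_filter]
    push_cast
    ring
  have h2 : (#(powersetCard k (univ : Finset (Fin n)) \ R) : ℝ) ≤ n.choose k := by
    rw [← hcard]
    exact_mod_cast card_le_card sdiff_subset
  have h3 := degDeviation_cleaned_le (e := e) (R := R) (X := X) hJ D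
  have h4 : K * ((degDeviation (powersetCard k univ \ R) (cleaned J k e R X) D
      + √D * #(powersetCard k (univ : Finset (Fin n)) \ R)) / D) ≤ K / D * (
        ∑ S ∈ powersetCard k (univ : Finset (Fin n)), |(potentialDeg J k S R X : ℝ) - D|
        + #J * e * #{𝒜 ∈ conflicts J k e n | 𝒜 ⊆ X} + √D * n.choose k) := by
    rw [mul_div_assoc', mul_div_right_comm]
    gcongr
  have h5 := mul_le_mul_of_nonneg_left h2 ha
  simp only [sum_boole] at h1 ⊢
  linarith

end GoodPacking

section TwoRandomSets

variable {ι κ τ : Type*} [Fintype ι] [DecidableEq ι] [Fintype κ] [DecidableEq κ]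

/-- Expectation of `f R X` for independent random sets `R` and `X` containing their elements
independently with probability `γ` and `p` respectively. -/
noncomputable def bernExp₂ (γ p : ℝ) (f : Finset ι → Finset κ → ℝ) : ℝ :=
  bernExp γ fun R => bernExp p (f R)

variable {γ p : ℝ}

lemma bernExp₂_add (f g : Finset ι → Finset κ → ℝ) :
    bernExp₂ γ p (fun R X => f R X + g R X) = bernExp₂ γ p f + bernExp₂ γ p g := by
  simp only [bernExp₂, bernExp_add]

lemma bernExp₂_const_mul (c : ℝ) (f : Finset ι → Finset κ → ℝ) :
    bernExp₂ γ p (fun R X => c * f R X) = c * bernExp₂ γ p f := by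
  simp only [bernExp₂, bernExp_const_mul]

lemma bernExp₂_sum (s : Finset τ) (f : τ → Finset ι → Finset κ → ℝ) :
    bernExp₂ γ p (fun R X => ∑ i ∈ s, f i R X) = ∑ i ∈ s, bernExp₂ γ p (f i) := by
  simp only [bernExp₂]
  rw [← bernExp_sum]
  congr 1
  funext R
  exact bernExp_sum p s fun i => f i R

lemma bernExp₂_const (c : ℝ) : bernExp₂ (ι := ι) (κ := κ) γ p (fun _ _ => c) = c := by
  simp only [bernExp₂, bernExp_const]

lemma bernExp₂_fst (g : Finset ι → ℝ) :
    bernExp₂ (κ := κ) γ p (fun R _ => g R) = bernExp γ g := by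
  simp only [bernExp₂, bernExp_const]

lemma bernExp₂_snd (h : Finset κ → ℝ) :
    bernExp₂ (ι := ι) γ p (fun _ X => h X) = bernExp p h := by
  simp only [bernExp₂, bernExp_const]

lemma bernExp₂_mul (g : Finset ι → ℝ) (h : Finset κ → ℝ) :
    bernExp₂ γ p (fun R X => g R * h X) = bernExp γ g * bernExp p h := by
  simp only [bernExp₂, bernExp_const_mul]
  simp only [mul_comm _ (bernExp p h), bernExp_const_mul]

lemma bernExp₂_mono (hγ0 : 0 ≤ γ) (hγ1 : γ ≤ 1) (hp0 : 0 ≤ p) (hp1 : p ≤ 1)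
    {f g : Finset ι → Finset κ → ℝ} (h : ∀ R X, f R X ≤ g R X) :
    bernExp₂ γ p f ≤ bernExp₂ γ p g :=
  bernExp_mono hγ0 hγ1 fun R => bernExp_mono hp0 hp1 (h R)

lemma exists_le_bernExp₂ (hγ0 : 0 ≤ γ) (hγ1 : γ ≤ 1) (hp0 : 0 ≤ p) (hp1 : p ≤ 1)
    (f : Finset ι → Finset κ → ℝ) : ∃ R X, f R X ≤ bernExp₂ γ p f := by
  obtain ⟨R, hR⟩ := exists_le_bernExp hγ0 hγ1 fun R => bernExp p (f R)
  obtain ⟨X, hX⟩ := exists_le_bernExp hp0 hp1 (f R)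
  exact ⟨R, X, hX.trans hR⟩

end TwoRandomSets

section PotentialDegree

variable {m k n : ℕ} {J : Finset (Finset (Fin m))} {γ p : ℝ}

/-- The indicator of the event that `J'` has no edge except possibly `S` in `R` and all its
non-edges in `R`. -/
noncomputable def fitsAt (k : ℕ) (S : Finset (Fin n)) (J' R : Finset (Finset (Fin n))) : ℝ :=
  if nonEdges k J' ⊆ R ∧ Disjoint (J'.erase S) R then 1 else 0

lemma potentialDeg_eq_sum (S : Finset (Fin n)) (R : Finset (Finset (Fin n)))
    (X : Finset (Finset (Finset (Fin n)))) : (potentialDeg J k S R X : ℝ) =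
      ∑ J' ∈ copies J n with S ∈ J', fitsAt k S J' R * (if {J'} ⊆ X then 1 else 0) := by
  rw [potentialDeg, ← filter_filter, card_filter]
  push_cast
  refine sum_congr rfl fun J' _ => ?_
  rw [fitsAt, ite_zero_mul_ite_zero, mul_one]
  congr 1
  simp only [singleton_subset_iff, eq_iff_iff]
  tauto

lemma card_nonEdges (hJ : ∀ A ∈ J, #A = k) (hJv : J.sup id = univ)
    {J' : Finset (Finset (Fin n))} (h : J' ∈ copies J n) :
    #(nonEdges k J') = m.choose k - #J := by
  rw [nonEdges, card_sdiff_of_subset, card_powersetCard, card_sup_of_mem_copies hJv h,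
    card_of_mem_copies h]
  exact fun A hA => mem_powersetCard.mpr ⟨subset_sup_id hA, card_edge_of_mem_copies hJ h hA⟩

/-- The probability that all edges of a copy of `J` but one avoid the random set of `k`-sets,
while it contains all non-edges. -/
noncomputable def fitProb (J : Finset (Finset (Fin m))) (k : ℕ) (γ : ℝ) : ℝ :=
  γ ^ (m.choose k - #J) * (1 - γ) ^ (#J - 1)

lemma bernExp_fitsAt (hJ : ∀ A ∈ J, #A = k) (hJv : J.sup id = univ) {S : Finset (Fin n)}
    {J' : Finset (Finset (Fin n))} (h : J' ∈ copies J n) (hS : S ∈ J') :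
    bernExp γ (fitsAt k S J') = fitProb J k γ := by
  have hd : Disjoint (nonEdges k J') (J'.erase S) :=
    disjoint_sdiff_self_left.mono_right (erase_subset _ _)
  have := bernExp_indicator γ hd
  rw [card_nonEdges hJ hJv h, card_erase_of_mem hS, card_of_mem_copies h] at this
  exact this

lemma bernExp_fitsAt_mul_le (hγ0 : 0 ≤ γ) (hγ1 : γ ≤ 1) (hJ : ∀ A ∈ J, #A = k)
    (hJv : J.sup id = univ) {S : Finset (Fin n)} {A B : Finset (Finset (Fin n))}
    (hA : A ∈ copies J n) (hB : B ∈ copies J n) (hSA : S ∈ A) (hSB : S ∈ B)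
    (hAB : #(A.sup id ∩ B.sup id) ≤ k) :
    bernExp γ (fun R => fitsAt k S A R * fitsAt k S B R) ≤ fitProb J k γ ^ 2 := by
  have hS : #S = k := card_edge_of_mem_copies hJ hA hSA
  have hunique : ∀ T : Finset (Fin n), #T = k → T ⊆ A.sup id → T ⊆ B.sup id → T = S := by
    intro T hT h1 h2
    rw [eq_inter_of_mem_of_mem hS hSA hSB hAB]
    exact eq_of_subset_of_card_le (subset_inter h1 h2) (hT ▸ hAB)
  have hN : Disjoint (nonEdges k A) (nonEdges k B) := by
    refine Finset.disjoint_left.mpr fun T hTA hTB => ?_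
    simp only [nonEdges, mem_sdiff, mem_powersetCard] at hTA hTB
    exact hTA.2 (hunique T hTA.1.2 hTA.1.1 hTB.1.1 ▸ hSA)
  have hE : Disjoint (A.erase S) (B.erase S) := by
    refine Finset.disjoint_left.mpr fun T hTA hTB => ?_
    rw [mem_erase] at hTA hTB
    exact hTA.1 (hunique T (card_edge_of_mem_copies hJ hA hTA.2) (subset_sup_id hTA.2)
      (subset_sup_id hTB.2))
  have h := bernExp_indicator_le hγ0 hγ1 (nonEdges k A ∪ nonEdges k B) (A.erase S ∪ B.erase S)
  rw [card_union_of_disjoint hN, card_union_of_disjoint hE, card_nonEdges hJ hJv hA,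
    card_nonEdges hJ hJv hB, card_erase_of_mem hSA, card_erase_of_mem hSB, card_of_mem_copies hA,
    card_of_mem_copies hB] at h
  refine le_trans (le_of_eq ?_) (h.trans (le_of_eq ?_))
  · congr 1
    funext R
    simp only [fitsAt, ite_zero_mul_ite_zero, mul_one, union_subset_iff, disjoint_union_left]
    congr 1
    simp only [eq_iff_iff]
    tauto
  · rw [fitProb]
    ring

lemma fitsAt_nonneg (S : Finset (Fin n)) (J' R : Finset (Finset (Fin n))) :
    0 ≤ fitsAt k S J' R := by
  unfold fitsAt
  split_ifs <;> simp

lemma fitsAt_le_one (S : Finset (Fin n)) (J' R : Finset (Finset (Fin n))) :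
    fitsAt k S J' R ≤ 1 := by
  unfold fitsAt
  split_ifs <;> simp

lemma bernExp₂_potentialDeg (hJ : ∀ A ∈ J, #A = k) (hJv : J.sup id = univ)
    (S : Finset (Fin n)) :
    bernExp₂ γ p (fun R X => (potentialDeg J k S R X : ℝ))
      = #{J' ∈ copies J n | S ∈ J'} * (p * fitProb J k γ) := by
  simp only [potentialDeg_eq_sum]
  rw [bernExp₂_sum, ← nsmul_eq_mul, ← sum_const]
  refine sum_congr rfl fun J' hJ' => ?_
  rw [mem_filter] at hJ'
  rw [bernExp₂_mul, bernExp_subset]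
  rw [bernExp_fitsAt hJ hJv hJ'.1 hJ'.2, card_singleton, pow_one, mul_comm]

lemma bernExp₂_potentialDeg_sq_le (hγ0 : 0 ≤ γ) (hγ1 : γ ≤ 1) (hp0 : 0 ≤ p)
    (hJ : ∀ A ∈ J, #A = k) (hJv : J.sup id = univ) (S : Finset (Fin n)) :
    bernExp₂ γ p (fun R X => (potentialDeg J k S R X : ℝ) ^ 2)
      ≤ (#{J' ∈ copies J n | S ∈ J'} * (p * fitProb J k γ)) ^ 2
        + #{J' ∈ copies J n | S ∈ J'} * (p * fitProb J k γ)
        + p ^ 2 * #(overlappingPairs J k S) := by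
  set T := ({J' ∈ copies J n | S ∈ J'} : Finset (Finset (Finset (Fin n)))) with hT
  set q := p * fitProb J k γ with hq
  have hq0 : 0 ≤ q := mul_nonneg hp0 (mul_nonneg (pow_nonneg hγ0 _) (pow_nonneg (by linarith) _))
  have hsq : ∀ (R : Finset (Finset (Fin n))) X, (potentialDeg J k S R X : ℝ) ^ 2 =
      ∑ x ∈ T ×ˢ T, (fitsAt k S x.1 R * fitsAt k S x.2 R) *
        (if {x.1} ∪ {x.2} ⊆ X then 1 else 0) := by
    intro R X
    rw [potentialDeg_eq_sum, sq, sum_mul_sum, sum_product]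
    refine sum_congr rfl fun A _ => sum_congr rfl fun B _ => ?_
    rw [mul_mul_mul_comm, ite_zero_mul_ite_zero, mul_one]
    simp only [union_subset_iff]
  simp only [hsq]
  rw [bernExp₂_sum]
  have hterm : ∀ x ∈ T ×ˢ T, bernExp₂ γ p (fun R X => (fitsAt k S x.1 R * fitsAt k S x.2 R) *
      (if {x.1} ∪ {x.2} ⊆ X then 1 else 0)) ≤ q ^ 2 + (if x.1 = x.2 then q else 0)
        + p ^ 2 * (if k < #(x.1.sup id ∩ x.2.sup id) then 1 else 0) := by
    rintro ⟨A, B⟩ hx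
    simp only [hT, mem_product, mem_filter] at hx
    obtain ⟨⟨hA, hSA⟩, hB, hSB⟩ := hx
    rw [bernExp₂_mul, bernExp_subset]
    dsimp only
    by_cases hAB : A = B
    · subst hAB
      rw [if_pos rfl, union_idempotent, card_singleton, pow_one]
      have h1 : bernExp γ (fun R => fitsAt k S A R * fitsAt k S A R) ≤ fitProb J k γ := by
        rw [← bernExp_fitsAt hJ hJv hA hSA]
        exact bernExp_mono hγ0 hγ1 fun R =>
          mul_le_of_le_one_left (fitsAt_nonneg _ _ _) (fitsAt_le_one _ _ _)
      have h2 := mul_le_mul_of_nonneg_right h1 hp0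
      have h3 : 0 ≤ p ^ 2 * (if k < #(A.sup id ∩ A.sup id) then (1 : ℝ) else 0) := by positivity
      nlinarith
    · rw [if_neg hAB, add_zero, card_union_of_disjoint (by simpa using hAB), card_singleton,
        card_singleton, one_add_one_eq_two]
      by_cases hk : k < #(A.sup id ∩ B.sup id)
      · rw [if_pos hk]
        have h1 : bernExp γ (fun R => fitsAt k S A R * fitsAt k S B R) ≤ 1 := by
          refine (bernExp_mono hγ0 hγ1 fun R => ?_).trans_eq (bernExp_const γ 1)
          exact mul_le_one₀ (fitsAt_le_one _ _ _) (fitsAt_nonneg _ _ _) (fitsAt_le_one _ _ _)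
        have h2 := mul_le_mul_of_nonneg_right h1 (sq_nonneg p)
        nlinarith [sq_nonneg q]
      · rw [if_neg hk, mul_zero, add_zero]
        have h1 := bernExp_fitsAt_mul_le hγ0 hγ1 hJ hJv hA hB hSA hSB (not_lt.mp hk)
        have h2 := mul_le_mul_of_nonneg_right h1 (sq_nonneg p)
        rw [hq]
        nlinarith
  refine (sum_le_sum hterm).trans (le_of_eq ?_)
  rw [sum_add_distrib, sum_add_distrib, ← mul_sum, sum_boole, sum_const, card_product,
    sum_product]
  have h1 : overlappingPairs J k S = {x ∈ T ×ˢ T | k < #(x.1.sup id ∩ x.2.sup id)} := by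
    ext x
    simp only [overlappingPairs, hT, mem_filter, mem_product]
    tauto
  have h2 : ∑ A ∈ T, ∑ B ∈ T, (if A = B then q else 0) = #T * q := by
    rw [← nsmul_eq_mul, ← sum_const]
    refine sum_congr rfl fun A hA => ?_
    rw [sum_ite_eq, if_pos hA]
  rw [h1, h2, nsmul_eq_mul]
  push_cast
  ring

lemma bernExp₂_abs_potentialDeg_sub_le (hγ0 : 0 ≤ γ) (hγ1 : γ ≤ 1) (hp0 : 0 ≤ p) (hp1 : p ≤ 1)
    (hJ : ∀ A ∈ J, #A = k) (hJv : J.sup id = univ) (S : Finset (Fin n)) {D : ℝ} (hD : 1 ≤ D)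
    (hpD : #{J' ∈ copies J n | S ∈ J'} * (p * fitProb J k γ) = D) :
    bernExp₂ γ p (fun R X => |(potentialDeg J k S R X : ℝ) - D|)
      ≤ √D + p ^ 2 * #(overlappingPairs J k S) := by
  have h1 := bernExp₂_potentialDeg (γ := γ) (p := p) hJ hJv S
  have h2 := bernExp₂_potentialDeg_sq_le hγ0 hγ1 hp0 hJ hJv S
  rw [hpD] at h1 h2
  have hs : 1 ≤ √D := Real.one_le_sqrt.mpr hD
  have hss : √D ^ 2 = D := Real.sq_sqrt (by linarith)
  have h : ∀ (R : Finset (Finset (Fin n))) (X : Finset (Finset (Finset (Fin n)))),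
      |(potentialDeg J k S R X : ℝ) - D| ≤ 1 / (2 * √D) * (potentialDeg J k S R X : ℝ) ^ 2 +
      (-(D / √D) * potentialDeg J k S R X + (D ^ 2 / (2 * √D) + √D / 2)) := by
    intro R X
    refine (abs_le_sq_div_add (by linarith : 0 < √D) _).trans (le_of_eq ?_)
    field_simp
    ring
  refine (bernExp₂_mono hγ0 hγ1 hp0 hp1 h).trans ?_
  rw [bernExp₂_add, bernExp₂_add, bernExp₂_const_mul, bernExp₂_const_mul, bernExp₂_const, h1]
  set ξ := p ^ 2 * (#(overlappingPairs J k S) : ℝ) with hξ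
  have hξ0 : 0 ≤ ξ := by positivity
  have h3 : 1 / (2 * √D) * bernExp₂ γ p (fun R X => (potentialDeg J k S R X : ℝ) ^ 2) ≤
      1 / (2 * √D) * (D ^ 2 + D + ξ) := by gcongr
  have h4 : 1 / (2 * √D) * (D ^ 2 + D + ξ) + (-(D / √D) * D + (D ^ 2 / (2 * √D) + √D / 2))
      = √D + ξ / (2 * √D) := by
    field_simp
    rw [hss]
    ring
  have h5 : ξ / (2 * √D) ≤ ξ := div_le_self hξ0 (by linarith)
  linarith

end PotentialDegree

section Selection

variable {m k e n : ℕ} {J : Finset (Finset (Fin m))} {γ p Q : ℝ}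

/-- A bound for the expected number of conflicts, divided by `n ^ (k - 1)`. -/
noncomputable def conflictConst (m k e : ℕ) (Q : ℝ) : ℝ :=
  ∑ ℓ ∈ Icc 2 e, Q ^ ℓ * 2 ^ 2 ^ 2 ^ (ℓ * (m - k) + (k - 1))

lemma sum_conflicts_pow_le (hk : 1 ≤ k) (hkm : k ≤ m) (hn : e * m ≤ n) (hp0 : 0 ≤ p)
    (hpQ : p * n ^ (m - k) ≤ Q) :
    ∑ 𝒜 ∈ conflicts J k e n, p ^ #𝒜 ≤ conflictConst m k e Q * n ^ (k - 1) := by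
  have hmaps : ∀ 𝒜 ∈ conflicts J k e n, #𝒜 ∈ Icc 2 e := fun 𝒜 h𝒜 =>
    mem_Icc.mpr (mem_filter.mp h𝒜).2.1
  rw [← sum_fiberwise_of_maps_to hmaps, conflictConst, sum_mul]
  refine sum_le_sum fun ℓ hℓ => ?_
  rw [mem_Icc] at hℓ
  rw [sum_congr rfl fun 𝒜 h𝒜 => by rw [(mem_filter.mp h𝒜).2], sum_const, nsmul_eq_mul]
  obtain ⟨d, rfl⟩ := Nat.exists_eq_add_of_le hkm
  obtain ⟨l, rfl⟩ := Nat.exists_eq_add_of_le hℓ.1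
  obtain ⟨j, rfl⟩ := Nat.exists_eq_add_of_le hk
  have hs : (2 + l) * (1 + j + d) - (2 + l - 1) * (1 + j) - 1 = (2 + l) * d + j := by
    have h1 : 2 + l - 1 = 1 + l := by omega
    have h2 : (2 + l) * (1 + j + d) = (1 + l) * (1 + j) + 1 + ((2 + l) * d + j) := by ring
    rw [h1, h2]
    omega
  have hle : (2 + l) * d + j ≤ n := by
    refine le_trans ?_ ((Nat.mul_le_mul_right _ hℓ.2).trans hn)
    nlinarith
  have hcard : #{𝒜 ∈ conflicts J (1 + j) e n | #𝒜 = 2 + l} ≤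
      n ^ ((2 + l) * d + j) * 2 ^ 2 ^ 2 ^ ((2 + l) * d + j) := by
    refine (card_le_card ?_).trans (card_families_le (copies J n).powerset hle)
    intro 𝒜 h𝒜
    simp only [conflicts, mem_filter] at h𝒜 ⊢
    obtain ⟨⟨h1, -, h2⟩, h3⟩ := h𝒜
    rw [h3, hs] at h2
    exact ⟨h1, h2⟩
  have hd : 1 + j + d - (1 + j) = d := by omega
  have hj : 1 + j - 1 = j := by omega
  rw [hd] at hpQ ⊢
  rw [hj]
  calc (#{𝒜 ∈ conflicts J (1 + j) e n | #𝒜 = 2 + l} : ℝ) * p ^ (2 + l)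
      ≤ (n ^ ((2 + l) * d + j) * 2 ^ 2 ^ 2 ^ ((2 + l) * d + j)) * p ^ (2 + l) := by
        gcongr
        exact_mod_cast hcard
    _ = (p * n ^ d) ^ (2 + l) * 2 ^ 2 ^ 2 ^ ((2 + l) * d + j) * n ^ j := by
        rw [mul_pow, ← pow_mul, pow_add, mul_comm d]
        ring
    _ ≤ _ := by gcongr

lemma sq_mul_card_overlappingPairs_le (hJv : J.sup id = univ) (hkm : k < m) {S : Finset (Fin n)}
    (hS : #S = k) (hn : 2 * m ≤ n) (hp0 : 0 ≤ p) (hpQ : p * n ^ (m - k) ≤ Q) :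
    p ^ 2 * #(overlappingPairs J k S) ≤ Q ^ 2 * (2 ^ 2 ^ (2 * m - k - 1)) ^ 2 / n := by
  have hn0 : (0 : ℝ) < n := by
    exact_mod_cast (by omega : 0 < n)
  have h := card_overlappingPairs_le (J := J) hJv hS hn
  have h' : (#(overlappingPairs J k S) : ℝ) ≤
      n ^ (2 * m - k - 1 - k) * (2 ^ 2 ^ (2 * m - k - 1)) ^ 2 := by exact_mod_cast h
  rw [le_div_iff₀ hn0]
  have hexp : (n : ℝ) ^ (2 * m - k - 1 - k) * n = (n ^ (m - k)) ^ 2 := by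
    rw [← pow_succ, ← pow_mul]
    congr 1
    omega
  calc p ^ 2 * (#(overlappingPairs J k S) : ℝ) * n
      ≤ p ^ 2 * (n ^ (2 * m - k - 1 - k) * (2 ^ 2 ^ (2 * m - k - 1)) ^ 2) * n := by gcongr
    _ = p ^ 2 * (n ^ (2 * m - k - 1 - k) * n) * (2 ^ 2 ^ (2 * m - k - 1)) ^ 2 := by ring
    _ = (p * n ^ (m - k)) ^ 2 * (2 ^ 2 ^ (2 * m - k - 1)) ^ 2 := by rw [hexp]; ring
    _ ≤ _ := by gcongr

lemma exists_isGoodPacking_of_prob (hk : 1 ≤ k) (hkm : k < m) (he : 2 ≤ e)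
    (hJ : ∀ A ∈ J, #A = k) (hJv : J.sup id = univ) {a K D : ℝ} (ha : 0 ≤ a) (hK : 0 ≤ K)
    (hMB : MatchingBound #J a K) (hD : 1 ≤ D) (hγ0 : 0 ≤ γ) (hγ1 : γ ≤ 1) (hp0 : 0 ≤ p)
    (hp1 : p ≤ 1) (hn : 2 * m ≤ n) (hn' : e * m ≤ n) (hpQ : p * n ^ (m - k) ≤ Q)
    (hpD : ∀ S : Finset (Fin n), #S = k →
      #{J' ∈ copies J n | S ∈ J'} * (p * fitProb J k γ) = D) :
    ∃ M : Finset (Finset (Finset (Fin n))), IsGoodPacking J k e M ∧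
      (n.choose k : ℝ) - #J * #M ≤ (γ + a + 2 * (K / √D) + K / D *
        (Q ^ 2 * (2 ^ 2 ^ (2 * m - k - 1)) ^ 2
          + #J * e * conflictConst m k e Q * (2 ^ k * k.factorial)) / n) * n.choose k := by
  have hn0 : (0 : ℝ) < n := by
    exact_mod_cast (by omega : 0 < n)
  have hD0 : 0 < D := by linarith
  have hQ0 : 0 ≤ Q := le_trans (by positivity) hpQ
  set B : ℝ := Q ^ 2 * (2 ^ 2 ^ (2 * m - k - 1)) ^ 2 with hB
  set C := conflictConst m k e Q with hC
  have hC0 : 0 ≤ C := sum_nonneg fun ℓ _ => by positivity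
  set KS := powersetCard k (univ : Finset (Fin n)) with hKS
  have hcardKS : (#KS : ℝ) = n.choose k := by simp [hKS]
  set F : Finset (Finset (Fin n)) → Finset (Finset (Finset (Fin n))) → ℝ := fun R X =>
    ∑ S ∈ KS, (if S ∈ R then (1 : ℝ) else 0) + a * n.choose k + K / D * (
      ∑ S ∈ KS, |(potentialDeg J k S R X : ℝ) - D|
        + #J * e * ∑ 𝒜 ∈ conflicts J k e n, (if 𝒜 ⊆ X then (1 : ℝ) else 0)
        + √D * n.choose k) with hF
  obtain ⟨R, X, hRX⟩ := exists_le_bernExp₂ hγ0 hγ1 hp0 hp1 F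
  obtain ⟨M, hM, hMbound⟩ := exists_isGoodPacking_of_matchingBound hJ hJv he ha hK hMB hD0 R X
  refine ⟨M, hM, (hMbound.trans hRX).trans ?_⟩
  have h1 : bernExp₂ (κ := Finset (Finset (Fin n))) γ p
      (fun R _ => ∑ S ∈ KS, (if S ∈ R then (1 : ℝ) else 0)) = γ * n.choose k := by
    rw [bernExp₂_sum, ← hcardKS, mul_comm, ← nsmul_eq_mul, ← sum_const]
    refine sum_congr rfl fun S _ => ?_
    rw [bernExp₂_fst]
    simpa using bernExp_subset γ {S}
  have h2 : bernExp₂ γ p (fun R X => ∑ S ∈ KS, |(potentialDeg J k S R X : ℝ) - D|)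
      ≤ (√D + B / n) * n.choose k := by
    rw [bernExp₂_sum, ← hcardKS, mul_comm, ← nsmul_eq_mul, ← sum_const]
    refine sum_le_sum fun S hS => ?_
    have hS' := (mem_powersetCard.mp hS).2
    exact (bernExp₂_abs_potentialDeg_sub_le hγ0 hγ1 hp0 hp1 hJ hJv S hD (hpD S hS')).trans
      (add_le_add_right (sq_mul_card_overlappingPairs_le hJv hkm hS' hn hp0 hpQ) _)
  have h3 : bernExp₂ (ι := Finset (Fin n)) γ p
      (fun _ X => ∑ 𝒜 ∈ conflicts J k e n, (if 𝒜 ⊆ X then (1 : ℝ) else 0))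
      ≤ C * (2 ^ k * k.factorial) / n * n.choose k := by
    rw [bernExp₂_sum]
    refine le_trans (le_of_eq (sum_congr rfl fun 𝒜 _ => ?_))
      ((sum_conflicts_pow_le (J := J) hk hkm.le hn' hp0 hpQ).trans ?_)
    · rw [bernExp₂_snd, bernExp_subset]
    · have h4 := pow_le_mul_choose (m := k) (k := 0) (n := n) (by omega) (Nat.zero_le _)
      rw [Nat.sub_zero, Nat.sub_zero] at h4
      have h5 : (n : ℝ) ^ k ≤ 2 ^ k * k.factorial * n.choose k := by exact_mod_cast h4
      rw [div_mul_eq_mul_div, le_div_iff₀ hn0, mul_assoc, ← pow_succ, Nat.sub_add_cancel hk,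
        mul_assoc C]
      gcongr
  rw [hF, bernExp₂_add, bernExp₂_add, h1, bernExp₂_const, bernExp₂_const_mul, bernExp₂_add,
    bernExp₂_add, bernExp₂_const_mul, bernExp₂_const]
  have h6 : K / D * √D = K / √D := by
    rw [div_mul_eq_mul_div, mul_div_assoc, Real.sqrt_div_self', mul_one_div]
  calc _ ≤ γ * n.choose k + a * n.choose k + K / D * ((√D + B / n) * n.choose k
        + #J * e * (C * (2 ^ k * k.factorial) / n * n.choose k) + √D * n.choose k) := by gcongr
    _ = (γ + a + 2 * (K / D * √D) + K / D * (B + #J * e * C * (2 ^ k * k.factorial)) / n)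
        * n.choose k := by ring
    _ = _ := by rw [h6]

lemma exists_forall_isGoodPacking (hk : 1 ≤ k) (hkm : k < m) (he : 2 ≤ e)
    (hJ : ∀ A ∈ J, #A = k) (hJv : J.sup id = univ) (hJ0 : J.Nonempty) {ε : ℝ} (hε : 0 < ε) :
    ∃ n0 : ℕ, ∀ n : ℕ, n0 ≤ n → ∃ M : Finset (Finset (Finset (Fin n))),
      IsGoodPacking J k e M ∧ (n.choose k : ℝ) - #J * #M ≤ ε * n.choose k := by
  obtain ⟨K, hK, hMB⟩ := exists_matchingBound (r := #J) (card_pos.mpr hJ0) (a := ε / 4)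
    (by positivity)
  set γ : ℝ := min (ε / 4) (1 / 2) with hγ
  have hγ0 : 0 < γ := by positivity
  have hγ1 : γ < 1 := (min_le_right _ _).trans_lt (by norm_num)
  have hπ : 0 < fitProb J k γ := mul_pos (pow_pos hγ0 _) (pow_pos (by linarith) _)
  set s : ℝ := 8 * K / ε + 1 with hs
  have hs1 : 1 ≤ s := by
    have : 0 ≤ 8 * K / ε := by positivity
    linarith
  set D : ℝ := s ^ 2 with hD
  have hD1 : 1 ≤ D := one_le_pow₀ hs1
  have hsD : √D = s := Real.sqrt_sq (by linarith)
  set c₁ : ℕ := 2 ^ (m - k) * (m - k).factorial * m.choose k with hc₁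
  set Q : ℝ := D * c₁ / fitProb J k γ with hQ
  set W : ℝ := K / D * (Q ^ 2 * (2 ^ 2 ^ (2 * m - k - 1)) ^ 2
    + #J * e * conflictConst m k e Q * (2 ^ k * k.factorial)) with hW
  refine ⟨2 * m + e * m + ⌈Q⌉₊ + ⌈4 * W / ε⌉₊, fun n hn => ?_⟩
  have hn1 : 1 ≤ n := by omega
  have hn0 : (0 : ℝ) < n := by exact_mod_cast hn1
  have hnQ : Q ≤ n := (Nat.le_ceil _).trans (by exact_mod_cast (by omega))
  have hnW : 4 * W / ε ≤ n := (Nat.le_ceil _).trans (by exact_mod_cast (by omega))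
  obtain ⟨c, hc, hcn⟩ := exists_card_copies_mem (n := n) hJ hJv hJ0 hkm.le (by omega)
  rw [← hc₁] at hcn
  have hc0 : 0 < c := by
    rcases Nat.eq_zero_or_pos c with rfl | h
    · have := Nat.pow_pos (n := m - k) hn1
      omega
    · exact h
  have hc0' : (0 : ℝ) < c := by exact_mod_cast hc0
  have hcn' : (n : ℝ) ^ (m - k) ≤ c₁ * c := by exact_mod_cast hcn
  have hc₁0 : (0 : ℝ) < c₁ := by
    by_contra! h
    have := pow_pos hn0 (m - k)
    nlinarith
  set p : ℝ := D / (c * fitProb J k γ) with hp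
  have hD0 : 0 < D := by linarith
  have hp0 : 0 ≤ p := by positivity
  have hpQ : p * n ^ (m - k) ≤ Q := by
    calc p * n ^ (m - k) ≤ p * (c₁ * c) := by gcongr
      _ = Q := by rw [hp, hQ]; field_simp
  have hp1 : p ≤ 1 := by
    have h1 : (n : ℝ) ≤ n ^ (m - k) :=
      le_self_pow₀ (by exact_mod_cast hn1) (by omega)
    have h2 : D * c₁ / fitProb J k γ ≤ c₁ * c := hnQ.trans (h1.trans hcn')
    rw [div_le_iff₀ hπ] at h2
    rw [hp, div_le_one (by positivity)]
    refine le_of_mul_le_mul_right (a := (c₁ : ℝ)) ?_ hc₁0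
    linarith
  obtain ⟨M, hM, hbound⟩ := exists_isGoodPacking_of_prob (n := n) hk hkm he hJ hJv
    (by positivity : (0 : ℝ) ≤ ε / 4) hK hMB hD1 hγ0.le hγ1.le hp0 hp1 (by omega) (by omega) hpQ
    (fun S hS => by rw [hc S hS, hp]; field_simp)
  refine ⟨M, hM, hbound.trans ?_⟩
  rw [← hW, hsD]
  gcongr
  have h1 : γ ≤ ε / 4 := min_le_left _ _
  have h2 : 2 * (K / s) ≤ ε / 4 := by
    rw [← mul_div_assoc, div_le_iff₀ (by linarith), hs]
    have : ε / 4 * (8 * K / ε + 1) = 2 * K + ε / 4 := by field_simp; ring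
    linarith
  have h3 : W / n ≤ ε / 4 := by
    rw [div_le_iff₀ hn0]
    rw [div_le_iff₀ hε] at hnW
    linarith
  linarith

end Selection

section FullVertexSet

variable {k e n : ℕ} {J : Finset (Finset (Fin k))}

lemma eq_singleton_sup_of_mem_copies (hJ : ∀ A ∈ J, #A = k) (hJv : J.sup id = univ)
    (hJ0 : J.Nonempty) {A : Finset (Finset (Fin n))} (hA : A ∈ copies J n) :
    A = {A.sup id} := by
  refine eq_singleton_iff_nonempty_unique_mem.mpr ⟨?_, fun S hS => ?_⟩
  · rw [← card_pos, card_of_mem_copies hA]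
    exact card_pos.mpr hJ0
  · refine eq_of_subset_of_card_le (subset_sup_id hS) ?_
    rw [card_sup_of_mem_copies hJv hA, card_edge_of_mem_copies hJ hA hS]

lemma isGoodPacking_copies (hk : 1 ≤ k) (hJ : ∀ A ∈ J, #A = k) (hJv : J.sup id = univ)
    (hJ0 : J.Nonempty) : IsGoodPacking J k e (copies J n) := by
  have hsup : ∀ A ∈ copies J n, ∀ B ∈ copies J n, A.sup id = B.sup id → A = B := by
    intro A hA B hB h
    rw [eq_singleton_sup_of_mem_copies hJ hJv hJ0 hA, h,
      ← eq_singleton_sup_of_mem_copies hJ hJv hJ0 hB]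
  have hlt : ∀ A ∈ copies J n, ∀ B ∈ copies J n, A ≠ B → #(A.sup id ∩ B.sup id) < k := by
    intro A hA B hB hAB
    by_contra! h
    have h1 := card_sup_of_mem_copies hJv hA
    have h2 := card_sup_of_mem_copies hJv hB
    refine hAB (hsup A hA B hB ?_)
    exact (eq_of_subset_of_card_le inter_subset_left (h1.trans_le h)).symm.trans
      (eq_of_subset_of_card_le inter_subset_right (h2.trans_le h))
  refine ⟨Subset.rfl, fun A hA B hB hAB => ?_, fun A hA B hB hAB => (hlt A hA B hB hAB).le,
    fun A hA B hB hAB h => absurd h (hlt A hA B hB hAB).ne, fun 𝒜 h𝒜 h2 _ => ?_⟩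
  · rw [eq_singleton_sup_of_mem_copies hJ hJv hJ0 hA,
      eq_singleton_sup_of_mem_copies hJ hJv hJ0 hB, disjoint_singleton]
    exact fun h => hAB (hsup A hA B hB h)
  · obtain ⟨A, hA⟩ : 𝒜.Nonempty := card_pos.mp (by omega)
    have h1 : k ≤ #(familySpan 𝒜) := by
      rw [← card_sup_of_mem_copies hJv (h𝒜 hA)]
      exact card_le_card (sup_mono (le_sup (f := id) hA))
    have h3 : #𝒜 * k = (#𝒜 - 1) * k + k := by
      rw [← Nat.succ_mul, Nat.succ_eq_add_one, Nat.sub_add_cancel (by omega)]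
    omega

end FullVertexSet

lemma familySpan_eq_sup_image {n : ℕ} (𝒜 : Finset (Finset (Finset (Fin n)))) :
    familySpan 𝒜 = (𝒜.image fun A => A.sup id).sup id := by
  rw [familySpan, sup_image]
  ext x
  simp only [mem_sup, id, Function.comp_apply]
  exact ⟨fun ⟨S, ⟨A, hA, hS⟩, hx⟩ => ⟨A, hA, S, hS, hx⟩,
    fun ⟨A, hA, S, hS, hx⟩ => ⟨S, ⟨A, hA, hS⟩, hx⟩⟩

lemma exists_isGoodPacking {m k e : ℕ} (hk : 1 ≤ k) (hkm : k ≤ m) (he : 2 ≤ e)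
    {J : Finset (Finset (Fin m))} (hJ : ∀ A ∈ J, #A = k) (hJv : J.sup id = univ)
    (hJ0 : J.Nonempty) {ε : ℝ} (hε : 0 < ε) :
    ∃ n0 : ℕ, ∀ n : ℕ, n0 ≤ n → ∃ M : Finset (Finset (Finset (Fin n))),
      IsGoodPacking J k e M ∧ (n.choose k : ℝ) - #J * #M ≤ ε * n.choose k := by
  rcases hkm.lt_or_eq with hlt | rfl
  · exact exists_forall_isGoodPacking hk hlt he hJ hJv hJ0 hε
  · refine ⟨0, fun n _ => ⟨copies J n, isGoodPacking_copies hk hJ hJv hJ0, ?_⟩⟩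
    have h1 : n.choose k ≤ #J * #(copies J n) :=
      (choose_le_card_copies hJv).trans (Nat.le_mul_of_pos_left _ (card_pos.mpr hJ0))
    have h2 : (n.choose k : ℝ) ≤ #J * #(copies J n) := by exact_mod_cast h1
    have h3 : 0 ≤ ε * n.choose k := by positivity
    linarith

/-- For a fixed `k`-graph `J` on `m` vertices and every `ε > 0`, for all large enough `n`
there is an induced `J`-packing `P = {J_1, …, J_N}` in `C([n], k)` such that the family of
vertex sets `{V(J_i)}` is `(ℓm - (ℓ-1)k - 1, ℓ)`-free for all `2 ≤ ℓ ≤ e`, and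
`N ≥ (1-ε) · C(n, k) / |J|`. -/
theorem exists_good_packing (m k e : ℕ) (hk : 2 ≤ k) (hkm : k ≤ m) (he : 2 ≤ e)
    (J : Finset (Finset (Fin m))) (hJ : ∀ A ∈ J, A.card = k)
    (hJv : J.sup id = Finset.univ)
    (ε : ℝ) (hε : 0 < ε) :
    ∃ n0 : ℕ, ∀ n : ℕ, n0 ≤ n →
      ∃ (N : ℕ) (Js : Fin N → Finset (Finset (Fin n))),
        (∀ i, IsCopyOf (Js i) J) ∧
        (∀ i j, i ≠ j → Disjoint (Js i) (Js j)) ∧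
        (∀ i j, i ≠ j →
          ((Js i).sup id ∩ (Js j).sup id).card ≤ k ∧
          (((Js i).sup id ∩ (Js j).sup id).card = k →
            (Js i).sup id ∩ (Js j).sup id ∉ Js i ∧
            (Js i).sup id ∩ (Js j).sup id ∉ Js j)) ∧
        (∀ ℓ : ℕ, 2 ≤ ℓ → ℓ ≤ e →
          IsVEFree (ℓ * m - (ℓ - 1) * k - 1) ℓ
            (Finset.image (fun i => (Js i).sup id) Finset.univ)) ∧
        (1 - ε) * (n.choose k : ℝ) / (J.card : ℝ) ≤ (N : ℝ) := by
  have hJ0 : J.Nonempty := by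
    rw [nonempty_iff_ne_empty]
    rintro rfl
    have h := congrArg card hJv
    rw [sup_empty, bot_eq_empty, card_empty, card_univ, Fintype.card_fin] at h
    omega
  obtain ⟨n0, hn0⟩ := exists_isGoodPacking (by omega) hkm he hJ hJv hJ0 hε
  refine ⟨n0, fun n hn => ?_⟩
  obtain ⟨M, hM, hbound⟩ := hn0 n hn
  have hmem : ∀ i : Fin #M, (M.equivFin.symm i : Finset (Finset (Fin n))) ∈ M := fun i =>
    (M.equivFin.symm i).2
  have hne : ∀ i j : Fin #M, i ≠ j →
      (M.equivFin.symm i : Finset (Finset (Fin n))) ≠ M.equivFin.symm j := fun i j hij h =>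
    hij (M.equivFin.symm.injective (Subtype.ext h))
  refine ⟨#M, fun i => M.equivFin.symm i, fun i => isCopyOf_of_mem_copies (hM.subset (hmem i)),
    fun i j hij => hM.disjoint _ (hmem i) _ (hmem j) (hne i j hij), fun i j hij =>
      ⟨hM.card_inter _ (hmem i) _ (hmem j) (hne i j hij), fun h =>
        ⟨hM.notMem _ (hmem i) _ (hmem j) (hne i j hij) h, ?_⟩⟩, ?_, ?_⟩
  · rw [inter_comm] at h ⊢
    exact hM.notMem _ (hmem j) _ (hmem i) (hne j i hij.symm) h
  · intro ℓ hℓ2 hℓe 𝒱 h𝒱 hcard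
    have hsurj : Set.SurjOn (fun A : Finset (Finset (Fin n)) => A.sup id) (M : Set (Finset (Finset (Fin n)))) 𝒱 := by
      intro V hV
      obtain ⟨i, -, rfl⟩ := mem_image.mp (h𝒱 hV)
      exact ⟨_, hmem i, rfl⟩
    obtain ⟨𝒜, h𝒜, hinj, rfl⟩ := exists_subset_injOn_image_eq_of_surjOn _ 𝒱 hsurj
    rw [card_image_of_injOn hinj] at hcard
    subst hcard
    rw [← familySpan_eq_sup_image]
    exact hM.lt_span 𝒜 h𝒜 hℓ2 hℓe
  · rw [div_le_iff₀ (by exact_mod_cast card_pos.mpr hJ0)]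
    linarith
end

section
/- Let t ≥ 2 and k ≥ 2 be integers. Let F be a 2(t−1)-cancellative tk-graph with |V(F)| = m and k-shadow J(F), and let P = {(V(J_i), J_i) : i ∈ [|P|]} be an induced J(F)-packing in C([n], k). Suppose (i) F is (ℓ·tk − (ℓ−1)k − 1, ℓ)-free for all 2 ≤ ℓ ≤ 2t, and (ii) the m-graph V = {V(J_i) : i ∈ [|P|]} is (ℓm − (ℓ−1)k − 1, ℓ)-free for all 2 ≤ ℓ ≤ 2t. Then the tk-graph H(F) obtained by placing a copy F_i of F on top of each J_i and taking H(F) = ∪_i F_i is 2(t−1)-cancellative. -/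
open Finset

variable {α : Type*} {β : Type*}

lemma IsCancellative.image [DecidableEq α] [DecidableEq β] {t : ℕ} {H : Finset (Finset α)}
    (h : IsCancellative t H) {f : α → β} (hf : f.Injective) :
    IsCancellative t (H.image fun A => A.image f) := by
  have hinj : Function.Injective fun A : Finset α => A.image f := Finset.image_injective hf
  intro 𝒜 h𝒜 hcard B hB C hC hB𝒜 hC𝒜 hBC hsub
  obtain ⟨𝒜', h𝒜', rfl⟩ := Finset.subset_image_iff.1 h𝒜
  obtain ⟨B', hB', rfl⟩ := Finset.mem_image.1 hB
  obtain ⟨C', hC', rfl⟩ := Finset.mem_image.1 hC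
  rw [Finset.card_image_of_injective _ hinj] at hcard
  refine h 𝒜' (by exact_mod_cast h𝒜') hcard B' hB' C' hC'
    (fun hm => hB𝒜 (Finset.mem_image_of_mem _ hm))
    (fun hm => hC𝒜 (Finset.mem_image_of_mem _ hm)) (fun e => hBC (by rw [e])) ?_
  intro x hx
  have hfx : f x ∈ (𝒜'.image fun A => A.image f).sup id := by
    apply hsub
    simpa [hf.eq_iff] using hx
  simpa [Finset.mem_sup, hf.eq_iff] using hfx

lemma sup_id_image_image [DecidableEq α] [DecidableEq β] (H : Finset (Finset α)) (f : α → β) :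
    (H.image fun A => A.image f).sup id = (H.sup id).image f := by
  ext x
  simp only [Finset.mem_sup, Finset.mem_image, id]
  aesop

lemma IsVEFree.image [DecidableEq α] [DecidableEq β] {v e : ℕ} {H : Finset (Finset α)}
    (h : IsVEFree v e H) {f : α → β} (hf : f.Injective) :
    IsVEFree v e (H.image fun A => A.image f) := by
  have hinj : Function.Injective fun A : Finset α => A.image f := Finset.image_injective hf
  intro 𝒜 h𝒜 hcard
  obtain ⟨𝒜', h𝒜', rfl⟩ := Finset.subset_image_iff.1 h𝒜
  rw [Finset.card_image_of_injective _ hinj] at hcard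
  rw [sup_id_image_image, Finset.card_image_of_injective _ hf]
  exact h 𝒜' (by exact_mod_cast h𝒜') hcard

lemma sup_id_kShadow [DecidableEq α] {k r : ℕ} (hk : 1 ≤ k) (hkr : k ≤ r)
    {H : Finset (Finset α)} (hH : ∀ A ∈ H, A.card = r) :
    (kShadow k H).sup id = H.sup id := by
  ext x
  simp only [kShadow, Finset.mem_sup, Finset.mem_powersetCard, id]
  constructor
  · rintro ⟨S, ⟨A, hA, hSA, -⟩, hx⟩
    exact ⟨A, hA, hSA hx⟩
  · rintro ⟨A, hA, hx⟩
    obtain ⟨S, hxS, hSA, hS⟩ := Finset.exists_subsuperset_card_eq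
      (Finset.singleton_subset_iff.2 hx) (by simpa using hk) (hkr.trans_eq (hH A hA).symm)
    exact ⟨S, ⟨A, hA, hSA, hS⟩, hxS (Finset.mem_singleton_self x)⟩

/-- Subtraction-free form of `(ℓr - (ℓ-1)k - 1, ℓ)`-freeness. -/
lemma card_mul_add_le_of_isVEFree [DecidableEq α] {r k L : ℕ} (hk : 1 ≤ k) (hkr : k ≤ r)
    {G : Finset (Finset α)} (hG : ∀ A ∈ G, A.card = r)
    (hfree : ∀ ℓ : ℕ, 2 ≤ ℓ → ℓ ≤ L → IsVEFree (ℓ * r - (ℓ - 1) * k - 1) ℓ G)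
    {𝒜 : Finset (Finset α)} (h𝒜 : 𝒜 ⊆ G) (hne : 𝒜.Nonempty) (hcard : 𝒜.card ≤ L) :
    𝒜.card * r + k ≤ (𝒜.sup id).card + 𝒜.card * k := by
  rcases (Nat.succ_le_of_lt hne.card_pos).eq_or_lt with h1 | h2
  · obtain ⟨A, rfl⟩ := Finset.card_eq_one.1 h1.symm
    simp [hG A (h𝒜 (Finset.mem_singleton_self A))]
  · have h := hfree _ h2 hcard 𝒜 h𝒜 rfl
    obtain ⟨c, hc⟩ : ∃ c, 𝒜.card = c + 1 := ⟨𝒜.card - 1, by omega⟩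
    rw [hc] at h ⊢
    have h3 : c * k ≤ c * r := Nat.mul_le_mul_left c hkr
    simp only [Nat.add_sub_cancel, add_mul, one_mul] at h ⊢
    omega

lemma card_sup_inter_sup_le [DecidableEq α] {r k L : ℕ} (hk : 1 ≤ k) (hkr : k ≤ r)
    {G : Finset (Finset α)} (hG : ∀ A ∈ G, A.card = r)
    (hfree : ∀ ℓ : ℕ, 2 ≤ ℓ → ℓ ≤ L → IsVEFree (ℓ * r - (ℓ - 1) * k - 1) ℓ G)
    {𝒜 ℬ : Finset (Finset α)} (h𝒜 : 𝒜 ⊆ G) (hℬ : ℬ ⊆ G) (hne : ℬ.Nonempty)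
    (hdisj : Disjoint 𝒜 ℬ) (hcard : 𝒜.card + ℬ.card ≤ L) :
    ℬ.card * r + k + (𝒜.sup id ∩ ℬ.sup id).card ≤
      (ℬ.sup id).card + (𝒜.card + ℬ.card) * k := by
  have h := card_mul_add_le_of_isVEFree hk hkr hG hfree (Finset.union_subset h𝒜 hℬ)
    (hne.mono Finset.subset_union_right)
    (by rwa [Finset.card_union_of_disjoint hdisj])
  rw [Finset.card_union_of_disjoint hdisj, Finset.sup_union, Finset.sup_eq_union] at h
  have h1 := Finset.card_union_add_card_inter (𝒜.sup id) (ℬ.sup id)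
  have h2 : (𝒜.sup id).card ≤ 𝒜.card * r := by
    rw [Finset.sup_eq_biUnion]
    exact Finset.card_biUnion_le_card_mul _ _ _ fun A hA => (hG A (h𝒜 hA)).le
  rw [add_mul] at h
  omega

/-- The intersection bound an edge of one member of an induced packing satisfies against
the vertex set `V` of another member. -/
lemma card_inter_lt_of_notMem_kShadow [DecidableEq α] {k : ℕ} {G : Finset (Finset α)}
    {A V : Finset α} (hA : A ∈ G) (hcard : (V ∩ G.sup id).card ≤ k)
    (hnot : (V ∩ G.sup id).card = k → V ∩ G.sup id ∉ kShadow k G) :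
    (A ∩ V).card < k := by
  by_contra! hlt
  have hAG : A ⊆ G.sup id := Finset.le_sup (f := id) hA
  have hsub : A ∩ V ⊆ V ∩ G.sup id := fun x hx =>
    Finset.mem_inter.2 ⟨(Finset.mem_inter.1 hx).2, hAG (Finset.mem_inter.1 hx).1⟩
  have heq := Finset.eq_of_subset_of_card_le hsub (hcard.trans hlt)
  have hk : (V ∩ G.sup id).card = k :=
    le_antisymm hcard (hlt.trans (Finset.card_le_card hsub))
  refine hnot hk ?_
  rw [kShadow, Finset.mem_sup]
  exact ⟨A, hA, Finset.mem_powersetCard.2 ⟨heq ▸ Finset.inter_subset_left, hk⟩⟩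

/-- If `F` is a `2(t-1)`-cancellative `tk`-graph on `m` vertices which is
`(ℓ·tk - (ℓ-1)k - 1, ℓ)`-free for all `2 ≤ ℓ ≤ 2t`, and `P` is an induced `J(F)`-packing
whose family of vertex sets is `(ℓm - (ℓ-1)k - 1, ℓ)`-free for all `2 ≤ ℓ ≤ 2t`, then the
`tk`-graph `H(F) = ∪ᵢ Fᵢ` is `2(t-1)`-cancellative. -/
theorem HF_cancellative (t k m n : ℕ) (ht : 2 ≤ t) (hk : 2 ≤ k)
    (F : Finset (Finset (Fin m))) (hF : ∀ A ∈ F, A.card = t * k)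
    (hFv : F.sup id = Finset.univ)
    (hFc : IsCancellative (2 * (t - 1)) F)
    (N : ℕ) (Js : Fin N → Finset (Finset (Fin n)))
    (hcopy : ∀ i, IsCopyOf (Js i) (kShadow k F))
    (hdisj : ∀ i j, i ≠ j → Disjoint (Js i) (Js j))
    (hind : ∀ i j, i ≠ j →
      ((Js i).sup id ∩ (Js j).sup id).card ≤ k ∧
      (((Js i).sup id ∩ (Js j).sup id).card = k →
        (Js i).sup id ∩ (Js j).sup id ∉ Js i ∧
        (Js i).sup id ∩ (Js j).sup id ∉ Js j))
    (Fs : Fin N → Finset (Finset (Fin n)))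
    (hFs : ∀ i, IsCopyOf (Fs i) F ∧ kShadow k (Fs i) = Js i)
    (hFfree : ∀ ℓ : ℕ, 2 ≤ ℓ → ℓ ≤ 2 * t →
      IsVEFree (ℓ * (t * k) - (ℓ - 1) * k - 1) ℓ F)
    (hVfree : ∀ ℓ : ℕ, 2 ≤ ℓ → ℓ ≤ 2 * t →
      IsVEFree (ℓ * m - (ℓ - 1) * k - 1) ℓ
        (Finset.image (fun i => (Js i).sup id) Finset.univ)) :
    IsCancellative (2 * (t - 1)) (Finset.univ.sup Fs) := by
  set V : Fin N → Finset (Fin n) := fun i => (Js i).sup id with hV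
  have hkr : k ≤ t * k := Nat.le_mul_of_pos_left k (by omega)
  have hk1 : 1 ≤ k := by omega
  have hcopyF : ∀ i, ∃ f : Fin m → Fin n, f.Injective ∧ Fs i = F.image fun A => A.image f := by
    intro i
    obtain ⟨f, hf, he⟩ := (hFs i).1
    rw [hFv, Finset.coe_univ] at hf
    exact ⟨f, Set.injOn_univ.1 hf, he⟩
  have hFsc : ∀ i, IsCancellative (2 * (t - 1)) (Fs i) := by
    intro i
    obtain ⟨f, hf, he⟩ := hcopyF i
    exact he ▸ hFc.image hf
  have hFsfree : ∀ i, ∀ ℓ : ℕ, 2 ≤ ℓ → ℓ ≤ 2 * t →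
      IsVEFree (ℓ * (t * k) - (ℓ - 1) * k - 1) ℓ (Fs i) := by
    intro i ℓ h2 hℓ
    obtain ⟨f, hf, he⟩ := hcopyF i
    exact he ▸ (hFfree ℓ h2 hℓ).image hf
  have hFscard : ∀ i, ∀ A ∈ Fs i, A.card = t * k := by
    intro i A hA
    obtain ⟨f, hf, he⟩ := hcopyF i
    rw [he] at hA
    obtain ⟨A', hA', rfl⟩ := Finset.mem_image.1 hA
    rw [Finset.card_image_of_injective _ hf, hF A' hA']
  have hVF : ∀ i, V i = (Fs i).sup id := by
    intro i
    simp only [hV]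
    rw [← (hFs i).2, sup_id_kShadow hk1 hkr (hFscard i)]
  have hVcard : ∀ i, (V i).card = m := by
    intro i
    obtain ⟨f, hf, he⟩ := hcopyF i
    rw [hVF, he, sup_id_image_image, Finset.card_image_of_injective _ hf, hFv]
    simp
  have hsubV : ∀ i, ∀ A ∈ Fs i, A ⊆ V i := fun i A hA =>
    (hVF i).symm ▸ Finset.le_sup (f := id) hA
  have hinter : ∀ i j, i ≠ j → ∀ A ∈ Fs j, (A ∩ V i).card < k := by
    intro i j hij A hA
    have h := hind i j hij
    change (V i ∩ V j).card ≤ k ∧ ((V i ∩ V j).card = k → V i ∩ V j ∉ Js i ∧ V i ∩ V j ∉ Js j) at h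
    rw [hVF j] at h
    exact card_inter_lt_of_notMem_kShadow hA h.1 fun e => (hFs j).2.symm ▸ (h.2 e).2
  intro 𝒜 h𝒜 hcard B hB C hC hB𝒜 hC𝒜 hBC hsub
  have hex : ∀ A ∈ Finset.univ.sup Fs, ∃ i, A ∈ Fs i := by
    intro A hA
    simpa [Finset.mem_sup] using hA
  obtain ⟨i, hBi⟩ := hex B hB
  obtain ⟨j, hCj⟩ := hex C hC
  have : Nonempty (Fin N) := ⟨i⟩
  choose! g hg using hex
  have hg𝒜 : ∀ A ∈ 𝒜, A ∈ Fs (g A) := fun A hA => hg A (h𝒜 hA)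
  by_cases hij : i = j
  · subst hij
    set 𝒜₁ := 𝒜.filter fun A => g A = i with h𝒜₁
    set 𝒜₂ := 𝒜.filter fun A => ¬ g A = i with h𝒜₂
    have hs : 𝒜₁.card + 𝒜₂.card = 𝒜.card :=
      Finset.card_filter_add_card_filter_not (s := 𝒜) _
    have h𝒜₁F : 𝒜₁ ⊆ Fs i := fun A hA => by
      obtain ⟨hA, hAi⟩ := Finset.mem_filter.1 hA
      exact hAi ▸ hg𝒜 A hA
    have hpos : 1 ≤ 𝒜₂.card := by
      by_contra! h0
      have h0 : 𝒜₂ = ∅ := Finset.card_eq_zero.1 (by omega)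
      have h1 : 𝒜 ⊆ Fs i := fun A hA => by
        by_contra hAi
        have : A ∈ 𝒜₂ := Finset.mem_filter.2 ⟨hA, fun e => hAi (e ▸ hg𝒜 A hA)⟩
        simp [h0] at this
      exact hFsc i 𝒜 h1 hcard B hBi C hCj hB𝒜 hC𝒜 hBC hsub
    have hpair : ({B, C} : Finset (Finset (Fin n))) ⊆ Fs i := by
      simp [Finset.insert_subset_iff, hBi, hCj]
    have hpc : ({B, C} : Finset (Finset (Fin n))).card = 2 := Finset.card_pair hBC
    have hps : ({B, C} : Finset (Finset (Fin n))).sup id = B ∪ C := by simp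
    have hd : Disjoint 𝒜₁ {B, C} := by
      rw [Finset.disjoint_left]
      intro A hA hA2
      have hA' := (Finset.mem_filter.1 hA).1
      rcases Finset.mem_insert.1 hA2 with rfl | h
      · exact hB𝒜 hA'
      · exact hC𝒜 (Finset.mem_singleton.1 h ▸ hA')
    have hI := card_sup_inter_sup_le hk1 hkr (hFscard i) (hFsfree i) h𝒜₁F hpair (by simp) hd
      (by omega)
    have hb := card_mul_add_le_of_isVEFree hk1 hkr (hFscard i) (hFsfree i) hpair (by simp)
      (by omega)
    rw [hpc, hps] at hI hb
    have hcover : (B \ C) ∪ (C \ B) ⊆ (𝒜₁.sup id ∩ (B ∪ C)) ∪ 𝒜₂.biUnion fun A => A ∩ V i := by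
      intro x hx
      obtain ⟨A, hA, hxA⟩ := Finset.mem_sup.1 (hsub hx)
      have hxBC : x ∈ B ∪ C := by
        simp only [Finset.mem_union, Finset.mem_sdiff] at hx ⊢
        tauto
      by_cases hAi : g A = i
      · exact Finset.mem_union_left _ (Finset.mem_inter.2
          ⟨Finset.mem_sup.2 ⟨A, Finset.mem_filter.2 ⟨hA, hAi⟩, hxA⟩, hxBC⟩)
      · exact Finset.mem_union_right _ (Finset.mem_biUnion.2
          ⟨A, Finset.mem_filter.2 ⟨hA, hAi⟩, Finset.mem_inter.2
            ⟨hxA, Finset.union_subset (hsubV i B hBi) (hsubV i C hCj) hxBC⟩⟩)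
    have hout : (𝒜₂.biUnion fun A => A ∩ V i).card ≤ 𝒜₂.card * (k - 1) := by
      refine Finset.card_biUnion_le_card_mul _ _ _ fun A hA => ?_
      obtain ⟨hA, hAi⟩ := Finset.mem_filter.1 hA
      have := hinter i (g A) (Ne.symm hAi) A (hg𝒜 A hA)
      omega
    have hD := (Finset.card_le_card hcover).trans (Finset.card_union_le _ _)
    have hDU : ((B \ C) ∪ (C \ B)).card = (B \ C).card + (C \ B).card :=
      Finset.card_union_of_disjoint (Finset.disjoint_left.2 fun x hx hx' =>
        (Finset.mem_sdiff.1 hx).2 (Finset.mem_sdiff.1 hx').1)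
    have hB1 := Finset.card_sdiff_add_card_inter B C
    have hC1 := Finset.card_sdiff_add_card_inter C B
    rw [Finset.inter_comm] at hC1
    have hU := Finset.card_union_add_card_inter B C
    rw [hFscard i B hBi] at hB1 hU
    rw [hFscard i C hCj] at hC1 hU
    obtain ⟨k', rfl⟩ : ∃ k', k = k' + 1 := ⟨k - 1, by omega⟩
    obtain ⟨t', rfl⟩ : ∃ t', t = t' + 1 := ⟨t - 1, by omega⟩
    simp only [Nat.add_sub_cancel] at hout hcard
    have hmul : (𝒜₁.card + 𝒜₂.card) * (k' + 1) ≤ (2 * t') * (k' + 1) :=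
      Nat.mul_le_mul_right _ (by omega)
    nlinarith
  · set X := V i ∩ V j with hX
    have hm : k < m := by
      have h1 := Finset.card_le_card (hsubV i B hBi)
      rw [hVcard, hFscard i B hBi] at h1
      nlinarith
    have hVinj : Function.Injective V := by
      intro a b hab
      by_contra hne
      have h := (hind a b hne).1
      change (V a ∩ V b).card ≤ k at h
      rw [← hab, Finset.inter_self, hVcard] at h
      omega
    set 𝒜₁ := 𝒜.filter fun A => g A = i with h𝒜₁
    set 𝒜₂ := (𝒜.filter fun A => ¬ g A = i).filter fun A => g A = j with h𝒜₂
    set 𝒜₃ := (𝒜.filter fun A => ¬ g A = i).filter fun A => ¬ g A = j with h𝒜₃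
    have hs : 𝒜₁.card + (𝒜₂.card + 𝒜₃.card) = 𝒜.card := by
      rw [h𝒜₂, h𝒜₃, Finset.card_filter_add_card_filter_not,
        Finset.card_filter_add_card_filter_not]
    set W := 𝒜₃.image fun A => V (g A) with hW
    have hWcard : W.card ≤ 𝒜₃.card := Finset.card_image_le
    have inner : ∀ (l : Fin N) (D : Finset (Fin n)) (𝒞 : Finset (Finset (Fin n))), D ∈ Fs l →
        D ∉ 𝒜 → 𝒞 ⊆ 𝒜 → (∀ A ∈ 𝒞, g A = l) → (𝒞.sup id ∩ D).card ≤ 𝒞.card * k := by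
      intro l D 𝒞 hD hD𝒜 h𝒞 hl
      have h := card_sup_inter_sup_le (𝒜 := 𝒞) (ℬ := {D}) hk1 hkr (hFscard l) (hFsfree l)
        (fun A hA => hl A hA ▸ hg𝒜 A (h𝒞 hA)) (by simpa using hD) (by simp)
        (by simpa using fun h => hD𝒜 (h𝒞 h))
        (by have := Finset.card_le_card h𝒞; rw [Finset.card_singleton]; omega)
      simp only [Finset.card_singleton, Finset.sup_singleton, id, hFscard l D hD, add_mul,
        one_mul] at h
      omega
    have hI₁ := inner i B 𝒜₁ hBi hB𝒜 (Finset.filter_subset _ _)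
      fun A hA => (Finset.mem_filter.1 hA).2
    have hI₂ := inner j C 𝒜₂ hCj hC𝒜
      ((Finset.filter_subset _ _).trans (Finset.filter_subset _ _))
      fun A hA => (Finset.mem_filter.1 hA).2
    have hVG : ∀ l, V l ∈ Finset.univ.image V := fun l =>
      Finset.mem_image_of_mem _ (Finset.mem_univ l)
    have hpc : ({V i, V j} : Finset (Finset (Fin n))).card = 2 :=
      Finset.card_pair (hVinj.ne hij)
    have hps : ({V i, V j} : Finset (Finset (Fin n))).sup id = V i ∪ V j := by simp
    have hWd : Disjoint W {V i, V j} := by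
      rw [Finset.disjoint_left]
      intro S hS hS2
      obtain ⟨A, hA, rfl⟩ := Finset.mem_image.1 hS
      simp only [h𝒜₃, Finset.mem_filter] at hA
      simp only [Finset.mem_insert, Finset.mem_singleton, hVinj.eq_iff] at hS2
      tauto
    have hI₃ := card_sup_inter_sup_le (L := 2 * t) (G := Finset.univ.image V) hk1 hm.le
      (by
        intro S hS
        obtain ⟨l, -, rfl⟩ := Finset.mem_image.1 hS
        exact hVcard l) hVfree
      (𝒜 := W) (ℬ := {V i, V j})
      (Finset.image_subset_iff.2 fun A _ => hVG (g A))
      (by simp only [Finset.insert_subset_iff, Finset.singleton_subset_iff]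
          exact ⟨hVG i, hVG j⟩) (by simp) hWd (by omega)
    rw [hpc, hps] at hI₃
    have hdiffB : ∀ x ∈ B \ X, x ∈ B ∧ x ∉ V j := fun x hx =>
      ⟨(Finset.mem_sdiff.1 hx).1, fun h => (Finset.mem_sdiff.1 hx).2
        (Finset.mem_inter.2 ⟨hsubV i B hBi (Finset.mem_sdiff.1 hx).1, h⟩)⟩
    have hdiffC : ∀ x ∈ C \ X, x ∈ C ∧ x ∉ V i := fun x hx =>
      ⟨(Finset.mem_sdiff.1 hx).1, fun h => (Finset.mem_sdiff.1 hx).2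
        (Finset.mem_inter.2 ⟨h, hsubV j C hCj (Finset.mem_sdiff.1 hx).1⟩)⟩
    have hcover : (B \ X) ∪ (C \ X) ⊆
        (𝒜₁.sup id ∩ B) ∪ (𝒜₂.sup id ∩ C) ∪ (W.sup id ∩ (V i ∪ V j)) := by
      intro x hx
      have hx' : x ∈ B ∧ x ∉ V j ∨ x ∈ C ∧ x ∉ V i :=
        (Finset.mem_union.1 hx).imp (hdiffB x) (hdiffC x)
      have hxV : x ∈ V i ∪ V j := Finset.mem_union.2 <|
        hx'.imp (fun h => hsubV i B hBi h.1) (fun h => hsubV j C hCj h.1)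
      have hxBC : x ∈ (B \ C) ∪ (C \ B) := Finset.mem_union.2 <| hx'.imp
        (fun h => Finset.mem_sdiff.2 ⟨h.1, fun hC' => h.2 (hsubV j C hCj hC')⟩)
        (fun h => Finset.mem_sdiff.2 ⟨h.1, fun hB' => h.2 (hsubV i B hBi hB')⟩)
      obtain ⟨A, hA, hxA⟩ := Finset.mem_sup.1 (hsub hxBC)
      have hxg : x ∈ V (g A) := hsubV _ A (hg𝒜 A hA) hxA
      by_cases hAi : g A = i
      · have h1 : x ∈ 𝒜₁.sup id :=
          Finset.mem_sup.2 ⟨A, Finset.mem_filter.2 ⟨hA, hAi⟩, hxA⟩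
        rw [hAi] at hxg
        have hxB : x ∈ B := (hx'.resolve_right fun h => h.2 hxg).1
        exact Finset.mem_union_left _ (Finset.mem_union_left _ (Finset.mem_inter.2 ⟨h1, hxB⟩))
      · by_cases hAj : g A = j
        · have h1 : x ∈ 𝒜₂.sup id := Finset.mem_sup.2
            ⟨A, Finset.mem_filter.2 ⟨Finset.mem_filter.2 ⟨hA, hAi⟩, hAj⟩, hxA⟩
          rw [hAj] at hxg
          have hxC : x ∈ C := (hx'.resolve_left fun h => h.2 hxg).1
          exact Finset.mem_union_left _ (Finset.mem_union_right _ (Finset.mem_inter.2 ⟨h1, hxC⟩))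
        · have h1 : x ∈ W.sup id := Finset.mem_sup.2 ⟨V (g A), Finset.mem_image_of_mem _
            (Finset.mem_filter.2 ⟨Finset.mem_filter.2 ⟨hA, hAi⟩, hAj⟩), hxg⟩
          exact Finset.mem_union_right _ (Finset.mem_inter.2 ⟨h1, hxV⟩)
    have hD := Finset.card_le_card hcover
    have hDU : ((B \ X) ∪ (C \ X)).card = (B \ X).card + (C \ X).card :=
      Finset.card_union_of_disjoint (Finset.disjoint_left.2 fun x hx hx' =>
        (hdiffC x hx').2 (hsubV i B hBi (hdiffB x hx).1))
    have hU₁ := Finset.card_union_le ((𝒜₁.sup id ∩ B) ∪ (𝒜₂.sup id ∩ C))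
      (W.sup id ∩ (V i ∪ V j))
    have hU₂ := Finset.card_union_le (𝒜₁.sup id ∩ B) (𝒜₂.sup id ∩ C)
    have hB1 := Finset.card_sdiff_add_card_inter B X
    have hC1 := Finset.card_sdiff_add_card_inter C X
    rw [hFscard i B hBi] at hB1
    rw [hFscard j C hCj] at hC1
    have hBX : (B ∩ X).card < k :=
      (Finset.card_le_card (Finset.inter_subset_inter_left Finset.inter_subset_right)).trans_lt
        (hinter j i (Ne.symm hij) B hBi)
    have hCX : (C ∩ X).card ≤ X.card := Finset.card_le_card Finset.inter_subset_right
    have hVU := Finset.card_union_add_card_inter (V i) (V j)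
    rw [hVcard, hVcard, ← hX] at hVU
    obtain ⟨t', rfl⟩ : ∃ t', t = t' + 1 := ⟨t - 1, by omega⟩
    simp only [Nat.add_sub_cancel] at hcard
    have hmul : (𝒜₁.card + 𝒜₂.card + W.card) * k ≤ (2 * t') * k :=
      Nat.mul_le_mul_right _ (by omega)
    nlinarith
end

section
/- Let t ≥ 2 and k ≥ 2 be integers. Let G = {G_1, …, G_N} be a (tk−1)-graph on a vertex set W that is (ℓ(tk−1) − (ℓ−1)k − 1, ℓ)-free for all 2 ≤ ℓ ≤ 2t, and let u_1, …, u_N be N distinct vertices disjoint from W. Then the tk-graph F = {G_i ∪ {u_i} : i ∈ [N]} is 2(t−1)-cancellative and is (ℓ·tk − (ℓ−1)k − 1, ℓ)-free for all 2 ≤ ℓ ≤ 2t. -/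
open Finset

variable {α : Type*} {β : Type*}

/-- A subfamily of the edges `f i` is the image of an index set of the same size. -/
theorem exists_index_of_subset_image {ι β : Type*} [Fintype ι] [DecidableEq β] {f : ι → β}
    {A : Finset β} (hA : A ⊆ univ.image f) : ∃ s : Finset ι, s.image f = A ∧ s.card = A.card := by
  obtain ⟨s, -, hinj, hs⟩ := exists_subset_injOn_image_eq_of_surjOn (f := f) Set.univ A
    (fun x hx => by simpa using hA (mem_coe.1 hx))
  exact ⟨s, hs, by rw [← hs, card_image_of_injOn hinj]⟩

/-- The union of edges extended by pendant vertices consists of the union of the original edges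
together with the pendant vertices. -/
theorem sup_image_insert {ι α : Type*} [DecidableEq α] (u : ι → α) (G : ι → Finset α)
    (s : Finset ι) :
    (s.image fun i => insert (u i) (G i)).sup id = (s.image G).sup id ∪ s.image u := by
  ext x
  simp only [mem_sup, mem_image, mem_union, id_eq, exists_exists_and_eq_and, mem_insert]
  grind

/-- If `G = {G_1, …, G_N}` is a `(tk-1)`-graph on `W` that is
`(ℓ(tk-1) - (ℓ-1)k - 1, ℓ)`-free for all `2 ≤ ℓ ≤ 2t`, and `u_1, …, u_N` are distinct new
vertices, then the `tk`-graph `F = {G_i ∪ {u_i}}` is `2(t-1)`-cancellative and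
`(ℓ·tk - (ℓ-1)k - 1, ℓ)`-free for all `2 ≤ ℓ ≤ 2t`. -/
theorem pendant_construction_cancellative {α : Type*} [DecidableEq α]
    (t k : ℕ) (ht : 2 ≤ t) (hk : 2 ≤ k)
    (W : Finset α) (N : ℕ) (G : Fin N → Finset α)
    (hGW : ∀ i, G i ⊆ W) (hGcard : ∀ i, (G i).card = t * k - 1)
    (hGinj : Function.Injective G)
    (hGfree : ∀ ℓ : ℕ, 2 ≤ ℓ → ℓ ≤ 2 * t →
      IsVEFree (ℓ * (t * k - 1) - (ℓ - 1) * k - 1) ℓ (Finset.image G Finset.univ))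
    (u : Fin N → α) (huinj : Function.Injective u) (huW : ∀ i, u i ∉ W) :
    IsCancellative (2 * (t - 1))
      (Finset.image (fun i => insert (u i) (G i)) Finset.univ) ∧
    ∀ ℓ : ℕ, 2 ≤ ℓ → ℓ ≤ 2 * t →
      IsVEFree (ℓ * (t * k) - (ℓ - 1) * k - 1) ℓ
        (Finset.image (fun i => insert (u i) (G i)) Finset.univ) := by
  have huG (i j : Fin N) : u i ∉ G j := fun h => huW i (hGW j h)
  constructor
  · intro 𝒜 h𝒜 _ B hB C hC hB𝒜 _ hBC hsub
    obtain ⟨i, -, rfl⟩ := mem_image.1 hB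
    obtain ⟨j, -, rfl⟩ := mem_image.1 hC
    have hij : i ≠ j := fun h => hBC (by rw [h])
    have hu : u i ∈ 𝒜.sup id := hsub <| mem_union_left _ <| by
      simp [huG, huinj.eq_iff, hij]
    obtain ⟨A, hA, huA⟩ := mem_sup.1 hu
    obtain ⟨m, -, rfl⟩ := mem_image.1 (h𝒜 hA)
    have him : i = m := by simpa [huG, huinj.eq_iff] using huA
    subst him
    exact hB𝒜 hA
  · intro ℓ hℓ hℓt 𝒜 h𝒜 hcard
    obtain ⟨s, rfl, hs⟩ := exists_index_of_subset_image h𝒜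
    have hfree := hGfree ℓ hℓ hℓt (s.image G) (image_subset_image (subset_univ s))
      (by rw [card_image_of_injective s hGinj, hs, hcard])
    have hdisj : Disjoint ((s.image G).sup id) (s.image u) := by
      rw [disjoint_right]
      intro x hx hxG
      obtain ⟨i, -, rfl⟩ := mem_image.1 hx
      obtain ⟨A, hA, huA⟩ := mem_sup.1 hxG
      obtain ⟨j, -, rfl⟩ := mem_image.1 hA
      exact huG i j huA
    rw [sup_image_insert, card_union_of_disjoint hdisj, card_image_of_injective s huinj, hs,
      hcard]
    have hmul : ℓ * (t * k) = ℓ * (t * k - 1) + ℓ := by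
      rw [← Nat.mul_succ, Nat.succ_eq_add_one, Nat.sub_add_cancel (by nlinarith)]
    omega
end

section
/- Let t ≥ 2 and k ≥ 2 be integers, and let F be a 2(t−1)-cancellative tk-graph on vertex set [n]. Let T be a k-subset of [n] with deg_F(T) = s ≥ 2, and let F_1, …, F_s be the edges of F containing T. Then for at least s − 1 indices i ∈ [s], the k-graph D(F, F_i∖T, ≥2) = {R ∈ C(F_i∖T, k) : deg_F(R) ≥ 2} has matching number at most t − 2. -/
open Finset

variable {α : Type*} {β : Type*}

/-- A `k`-uniform matching of size exceeding `t - 2` in a set of size `(t - 1) * k`, all of whose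
members have degree at least two, yields a cover of the set by at most `t - 1` edges
other than `A`. -/
lemma exists_cover_of_not_matchingNumberLE [DecidableEq α] {t k : ℕ} (ht : 2 ≤ t) (hk : 0 < k)
    {F : Finset (Finset α)} {A X : Finset α} (hX : X.card = (t - 1) * k)
    (h : ¬ MatchingNumberLE
      ((Finset.powersetCard k X).filter fun R => 2 ≤ (F.filter fun B => R ⊆ B).card) (t - 2)) :
    ∃ C ⊆ F, C.card ≤ t - 1 ∧ A ∉ C ∧ X ⊆ C.sup id := by
  unfold MatchingNumberLE at h
  push Not at h
  obtain ⟨M, hM, hdisj, hcard⟩ := h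
  have hM' : ∀ R ∈ M, R ⊆ X ∧ R.card = k ∧ 2 ≤ (F.filter fun B => R ⊆ B).card := by
    intro R hR
    have := hM hR
    simpa [Finset.mem_powersetCard, and_assoc] using this
  have hunion : (M.biUnion id).card = M.card * k := by
    rw [Finset.card_biUnion (t := id) hdisj]
    exact Finset.sum_const_nat fun R hR => (hM' R hR).2.1
  have hsub : M.biUnion id ⊆ X := Finset.biUnion_subset.2 fun R hR => (hM' R hR).1
  have hle : M.card ≤ t - 1 := by
    have := Finset.card_le_card hsub
    rw [hunion, hX] at this
    exact Nat.le_of_mul_le_mul_right this hk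
  have heq : M.biUnion id = X := by
    refine Finset.eq_of_subset_of_card_le hsub ?_
    rw [hunion, hX]
    exact Nat.mul_le_mul_right k (by omega)
  have hother : ∀ R ∈ M, ∃ B ∈ F, R ⊆ B ∧ B ≠ A := by
    intro R hR
    obtain ⟨B, hB, hBA⟩ := Finset.exists_mem_ne (hM' R hR).2.2 A
    rw [Finset.mem_filter] at hB
    exact ⟨B, hB.1, hB.2, hBA⟩
  choose! f hfF hRf hfA using hother
  refine ⟨M.image f, Finset.image_subset_iff.2 hfF, Finset.card_image_le.trans hle, ?_, ?_⟩
  · rw [Finset.mem_image]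
    rintro ⟨R, hR, hRA⟩
    exact hfA R hR hRA
  · rw [← heq]
    refine Finset.biUnion_subset.2 fun R hR => (hRf R hR).trans ?_
    exact Finset.le_sup (f := id) (Finset.mem_image_of_mem f hR)

/-- If `A` and `B` are distinct edges of a cancellative family, both containing `T`, then
`A \ T` and `B \ T` cannot both be covered by few other edges. -/
lemma IsCancellative.eq_of_covers [DecidableEq α] {m : ℕ} {F : Finset (Finset α)}
    (hF : IsCancellative (2 * m) F) {A B T : Finset α} (hA : A ∈ F) (hB : B ∈ F)
    (hTA : T ⊆ A) (hTB : T ⊆ B) {C D : Finset (Finset α)} (hC : C ⊆ F) (hD : D ⊆ F)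
    (hCm : C.card ≤ m) (hDm : D.card ≤ m) (hAC : A ∉ C) (hBD : B ∉ D)
    (hcovA : A \ T ⊆ C.sup id) (hcovB : B \ T ⊆ D.sup id) : A = B := by
  by_contra hAB
  refine hF ((C ∪ D) \ {A, B}) (Finset.sdiff_subset.trans (Finset.union_subset hC hD)) ?_
    A hA B hB (by simp) (by simp) hAB ?_
  · have h₁ := Finset.card_le_card (Finset.sdiff_subset (s := C ∪ D) (t := {A, B}))
    have h₂ := Finset.card_union_le C D
    omega
  · intro x hx
    simp only [Finset.mem_union, Finset.mem_sdiff] at hx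
    rw [Finset.mem_sup]
    rcases hx with ⟨hxA, hxB⟩ | ⟨hxB, hxA⟩
    · obtain ⟨E, hE, hxE⟩ := Finset.mem_sup.1
        (hcovA (Finset.mem_sdiff.2 ⟨hxA, fun h => hxB (hTB h)⟩))
      refine ⟨E, ?_, hxE⟩
      have hEA : E ≠ A := fun h => hAC (h ▸ hE)
      have hEB : E ≠ B := fun h => hxB (h ▸ hxE)
      simp [hE, hEA, hEB]
    · obtain ⟨E, hE, hxE⟩ := Finset.mem_sup.1
        (hcovB (Finset.mem_sdiff.2 ⟨hxB, fun h => hxA (hTA h)⟩))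
      refine ⟨E, ?_, hxE⟩
      have hEA : E ≠ A := fun h => hxA (h ▸ hxE)
      have hEB : E ≠ B := fun h => hBD (h ▸ hE)
      simp [hE, hEA, hEB]

/-- Let `F` be a `2(t-1)`-cancellative `tk`-graph on `[n]` and let `T` be a `k`-set contained
in exactly `s ≥ 2` edges of `F`. Then for at least `s - 1` of the edges `A ⊇ T`, the family
`D(F, A \ T, ≥2)` of `k`-subsets of `A \ T` of degree at least `2` in `F` has matching
number at most `t - 2`. -/
theorem almost_all_small_matching (t k n : ℕ) (ht : 2 ≤ t) (hk : 2 ≤ k)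
    (F : Finset (Finset (Fin n))) (hF : ∀ A ∈ F, A.card = t * k)
    (hcanc : IsCancellative (2 * (t - 1)) F)
    (T : Finset (Fin n)) (hT : T.card = k)
    (hdeg : 2 ≤ (F.filter fun A => T ⊆ A).card) :
    ∃ S ⊆ F.filter (fun A => T ⊆ A),
      (F.filter fun A => T ⊆ A).card - 1 ≤ S.card ∧
      ∀ A ∈ S, MatchingNumberLE
        ((Finset.powersetCard k (A \ T)).filter
          fun R => 2 ≤ (F.filter fun B => R ⊆ B).card)
        (t - 2) := by
  classical
  let good : Finset (Fin n) → Prop := fun A => MatchingNumberLE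
    ((Finset.powersetCard k (A \ T)).filter fun R => 2 ≤ (F.filter fun B => R ⊆ B).card) (t - 2)
  refine ⟨(F.filter fun A => T ⊆ A).filter good, Finset.filter_subset _ _, ?_,
    fun A hA => (Finset.mem_filter.1 hA).2⟩
  have hbad : ((F.filter fun A => T ⊆ A).filter fun A => ¬ good A).card ≤ 1 := by
    have hcover : ∀ A ∈ F, T ⊆ A → ¬ good A →
        ∃ C ⊆ F, C.card ≤ t - 1 ∧ A ∉ C ∧ A \ T ⊆ C.sup id := by
      intro A hA hTA hg
      refine exists_cover_of_not_matchingNumberLE ht (by omega) ?_ hg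
      rw [Finset.card_sdiff_of_subset hTA, hF A hA, hT, Nat.sub_mul, one_mul]
    refine Finset.card_le_one.2 fun A hA B hB => ?_
    simp only [Finset.mem_filter] at hA hB
    obtain ⟨⟨hAF, hTA⟩, hgA⟩ := hA
    obtain ⟨⟨hBF, hTB⟩, hgB⟩ := hB
    obtain ⟨C, hC, hCm, hAC, hcovA⟩ := hcover A hAF hTA hgA
    obtain ⟨D, hD, hDm, hBD, hcovB⟩ := hcover B hBF hTB hgB
    exact hcanc.eq_of_covers hAF hBF hTA hTB hC hD hCm hDm hAC hBD hcovA hcovB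
  have hsum := Finset.card_filter_add_card_filter_not (s := F.filter fun A => T ⊆ A) good
  omega
end

section
/- Let t ≥ 2 and k ≥ 2 be integers, and let F be a 2(t−1)-cancellative tk-graph on vertex set [n]. Then Σ_{s≥2} (s−1) · |D(F, s)| ≤ (t−1) · C(n, k), where D(F, s) is the family of k-subsets of [n] contained in exactly s edges of F and C(n, k) is the binomial coefficient. -/
open Finset

variable {α : Type*} {β : Type*}

/-- The `i`-th block of the partition of `B` into `t` sets of size `k` given by an equivalence
`Fin t × Fin k ≃ B`. -/
def block {t k : ℕ} {B : Finset α} (f : Fin t × Fin k ≃ B) (i : Fin t) : Finset α :=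
  Finset.univ.map
    ⟨fun j => (f (i, j) : α), fun _ _ h => by simpa using f.injective (Subtype.ext h)⟩

theorem mem_block {t k : ℕ} {B : Finset α} (f : Fin t × Fin k ≃ B) (i : Fin t) (x : α) :
    x ∈ block f i ↔ ∃ j, (f (i, j) : α) = x := by
  simp only [block, Finset.mem_map, Finset.mem_univ, true_and]
  rfl

theorem card_block {t k : ℕ} {B : Finset α} (f : Fin t × Fin k ≃ B) (i : Fin t) :
    (block f i).card = k := by
  simp [block]

theorem block_subset {t k : ℕ} {B : Finset α} (f : Fin t × Fin k ≃ B) (i : Fin t) :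
    block f i ⊆ B := by
  intro x hx
  obtain ⟨j, rfl⟩ := (mem_block f i x).1 hx
  exact (f (i, j)).2

theorem exists_mem_block {t k : ℕ} {B : Finset α} (f : Fin t × Fin k ≃ B) {x : α}
    (hx : x ∈ B) : ∃ i, x ∈ block f i :=
  ⟨(f.symm ⟨x, hx⟩).1, (mem_block _ _ _).2 ⟨(f.symm ⟨x, hx⟩).2, by simp⟩⟩

theorem exists_perm_mem_iff [DecidableEq α] {B T U : Finset α} (hT : T ⊆ B) (hU : U ⊆ B)
    (h : T.card = U.card) : ∃ τ : Equiv.Perm B, ∀ x, (τ x : α) ∈ U ↔ (x : α) ∈ T := by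
  have hcard : ∀ S ⊆ B, Fintype.card {x : B // (x : α) ∈ S} = S.card := by
    intro S hS
    rw [Fintype.card_subtype, ← Finset.card_map (Function.Embedding.subtype (· ∈ B))]
    congr 1
    ext x
    simpa using fun hx => hS hx
  have e : {x : B // (x : α) ∈ T} ≃ {x : B // (x : α) ∈ U} :=
    Fintype.equivOfCardEq (by rw [hcard T hT, hcard U hU, h])
  refine ⟨e.extendSubtype, fun x => ⟨fun hx => ?_, fun hx => e.extendSubtype_mem x hx⟩⟩
  by_contra hn
  exact e.extendSubtype_not_mem x hn hx

/-- The number of ordered partitions and indices for which the block equals `T`. -/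
def blockCount [DecidableEq α] (t k : ℕ) (B T : Finset α) : ℕ :=
  ∑ f : Fin t × Fin k ≃ B, (Finset.univ.filter fun i => block f i = T).card

theorem blockCount_eq [DecidableEq α] {t k : ℕ} {B T U : Finset α} (hT : T ⊆ B) (hU : U ⊆ B)
    (h : T.card = U.card) : blockCount t k B T = blockCount t k B U := by
  obtain ⟨τ, hτ⟩ := exists_perm_mem_iff hT hU h
  unfold blockCount
  refine Fintype.sum_equiv (Equiv.equivCongr (Equiv.refl _) τ) _ _ fun f => ?_
  refine congrArg Finset.card (Finset.filter_congr fun i _ => ?_)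
  change _ ↔ block (f.trans τ) i = U
  have hsub : ∀ (g : Fin t × Fin k ≃ B) (S : Finset α), S.card = k →
      (block g i = S ↔ ∀ j, (g (i, j) : α) ∈ S) := by
    intro g S hS
    constructor
    · rintro rfl j
      exact (mem_block _ _ _).2 ⟨j, rfl⟩
    · intro hg
      refine Finset.eq_of_subset_of_card_le (fun x hx => ?_) (by rw [card_block, hS])
      obtain ⟨j, rfl⟩ := (mem_block _ _ _).1 hx
      exact hg j
  by_cases hk : T.card = k
  · simp [hsub _ _ hk, hsub _ _ (h ▸ hk), hτ]
  · have h1 : ∀ g : Fin t × Fin k ≃ B, block g i ≠ T := fun g hg => hk (hg ▸ card_block g i)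
    have h2 : ∀ g : Fin t × Fin k ≃ B, block g i ≠ U :=
      fun g hg => hk (h.trans (hg ▸ card_block g i))
    simp [h1, h2]

theorem sum_card_block_mem [DecidableEq α] {t k : ℕ} {B T : Finset α} (hT : T ⊆ B)
    (hTk : T.card = k) {M : Finset (Finset α)} (hM : M ⊆ Finset.powersetCard k B) :
    ∑ f : Fin t × Fin k ≃ B, (Finset.univ.filter fun i => block f i ∈ M).card
      = M.card * blockCount t k B T := by
  have h1 : ∀ f : Fin t × Fin k ≃ B, (Finset.univ.filter fun i => block f i ∈ M).card
      = ∑ U ∈ M, (Finset.univ.filter fun i => block f i = U).card := by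
    intro f
    rw [Finset.card_eq_sum_card_fiberwise (f := fun i => block f i) (t := M)
      (fun i hi => by simpa using hi)]
    refine Finset.sum_congr rfl fun U hU => ?_
    congr 1
    ext i
    simp only [Finset.mem_filter, Finset.mem_univ, true_and]
    exact ⟨fun h => h.2, fun h => ⟨h ▸ hU, h⟩⟩
  rw [Finset.sum_congr rfl fun f _ => h1 f, Finset.sum_comm, ← smul_eq_mul]
  refine Finset.sum_eq_card_nsmul fun U hU => ?_
  obtain ⟨hUB, hUk⟩ := Finset.mem_powersetCard.1 (hM hU)
  exact blockCount_eq hUB hT (hUk.trans hTk.symm)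

/-- If every partition of `B` into `t` blocks of size `k` which uses a member of `M` also uses a
member of the disjoint family `O`, then `|M| ≤ (t - 1) |O|`. -/
theorem card_le_mul_card_of_block [DecidableEq α] {t k : ℕ} (ht : 0 < t) {B : Finset α}
    (hB : B.card = t * k) {M O : Finset (Finset α)} (hM : M ⊆ Finset.powersetCard k B)
    (hO : O ⊆ Finset.powersetCard k B) (hMO : Disjoint M O)
    (h : ∀ (f : Fin t × Fin k ≃ B) (i : Fin t), block f i ∈ M → ∃ j, block f j ∈ O) :
    M.card ≤ (t - 1) * O.card := by
  have f₀ : Fin t × Fin k ≃ B := Fintype.equivOfCardEq (by simp [hB])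
  have hsub := block_subset f₀ ⟨0, ht⟩
  have hcard := card_block f₀ ⟨0, ht⟩
  have hpos : 0 < blockCount t k B (block f₀ ⟨0, ht⟩) := by
    refine lt_of_lt_of_le ?_ (Finset.single_le_sum (fun _ _ => Nat.zero_le _)
      (Finset.mem_univ f₀))
    exact Finset.card_pos.2 ⟨⟨0, ht⟩, by simp⟩
  refine Nat.le_of_mul_le_mul_right ?_ hpos
  rw [mul_assoc, ← sum_card_block_mem hsub hcard hM, ← sum_card_block_mem hsub hcard hO,
    Finset.mul_sum]
  refine Finset.sum_le_sum fun f _ => ?_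
  by_cases hne : ∃ i, block f i ∈ M
  · obtain ⟨i, hi⟩ := hne
    obtain ⟨j, hj⟩ := h f i hi
    have h1 : (Finset.univ.filter fun i => block f i ∈ M).card ≤ t - 1 := by
      calc _ ≤ (Finset.univ.erase j).card := Finset.card_le_card fun l hl => by
            refine Finset.mem_erase.2 ⟨?_, Finset.mem_univ _⟩
            rintro rfl
            exact Finset.disjoint_left.1 hMO (Finset.mem_filter.1 hl).2 hj
        _ = t - 1 := by simp
    have h2 : 0 < (Finset.univ.filter fun i => block f i ∈ O).card :=
      Finset.card_pos.2 ⟨j, by simpa using hj⟩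
    exact h1.trans (Nat.le_mul_of_pos_right _ h2)
  · push Not at hne
    simp [hne]

/-- The `k`-subsets of `A` which are contained in no edge of `F` other than `A`. -/
def ownSubsets [DecidableEq α] (F : Finset (Finset α)) (k : ℕ) (A : Finset α) :
    Finset (Finset α) :=
  (Finset.powersetCard k A).filter fun T => ∀ C ∈ F, T ⊆ C → C = A

theorem mem_ownSubsets [DecidableEq α] {F : Finset (Finset α)} {k : ℕ} {A T : Finset α} :
    T ∈ ownSubsets F k A ↔ T ∈ Finset.powersetCard k A ∧ ∀ C ∈ F, T ⊆ C → C = A := by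
  rw [ownSubsets, Finset.mem_filter]

theorem ownSubsets_subset [DecidableEq α] (F : Finset (Finset α)) (k : ℕ) (A : Finset α) :
    ownSubsets F k A ⊆ Finset.powersetCard k A :=
  Finset.filter_subset _ _

open scoped Classical in
/-- The non-own `k`-subsets `T` of `A` such that every partition of `A` into `t` blocks of size
`k`, one of which is `T`, has an own block. -/
noncomputable def forcingSubsets [DecidableEq α] (F : Finset (Finset α)) (t k : ℕ) (A : Finset α) :
    Finset (Finset α) :=
  (Finset.powersetCard k A).filter fun T => T ∉ ownSubsets F k A ∧
    ∀ (f : Fin t × Fin k ≃ A) (i : Fin t), block f i = T → ∃ j, block f j ∈ ownSubsets F k A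

theorem mem_forcingSubsets [DecidableEq α] {F : Finset (Finset α)} {t k : ℕ} {A T : Finset α} :
    T ∈ forcingSubsets F t k A ↔ T ∈ Finset.powersetCard k A ∧ T ∉ ownSubsets F k A ∧
      ∀ (f : Fin t × Fin k ≃ A) (i : Fin t), block f i = T →
        ∃ j, block f j ∈ ownSubsets F k A := by
  rw [forcingSubsets, Finset.mem_filter]

theorem forcingSubsets_subset [DecidableEq α] (F : Finset (Finset α)) (t k : ℕ) (A : Finset α) :
    forcingSubsets F t k A ⊆ Finset.powersetCard k A :=
  Finset.filter_subset _ _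

theorem card_forcingSubsets_le [DecidableEq α] {F : Finset (Finset α)} {t k : ℕ} (ht : 0 < t)
    {A : Finset α} (hA : A.card = t * k) :
    (forcingSubsets F t k A).card ≤ (t - 1) * (ownSubsets F k A).card := by
  exact card_le_mul_card_of_block ht hA (forcingSubsets_subset F t k A)
    (ownSubsets_subset F k A)
    (Finset.disjoint_left.2 fun T hT => (mem_forcingSubsets.1 hT).2.1)
    fun f i hi => (mem_forcingSubsets.1 hi).2.2 f i rfl

/-- If `T` is not forcing in `B`, there is a family of at most `t - 1` edges of `F` other than `B`
covering `B \ T`. -/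
theorem exists_cover_of_notMem_forcingSubsets [DecidableEq α] {F : Finset (Finset α)} {t k : ℕ}
    {T B : Finset α} (hTB : T ∈ Finset.powersetCard k B) (hown : T ∉ ownSubsets F k B)
    (hT : T ∉ forcingSubsets F t k B) :
    ∃ 𝒜 ⊆ F, 𝒜.card ≤ t - 1 ∧ B ∉ 𝒜 ∧ ∀ x ∈ B, x ∉ T → ∃ A ∈ 𝒜, x ∈ A := by
  have hex : ∃ (f : Fin t × Fin k ≃ B) (i : Fin t), block f i = T ∧
      ∀ j, block f j ∉ ownSubsets F k B := by
    by_contra! hcon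
    exact hT (mem_forcingSubsets.2 ⟨hTB, hown, hcon⟩)
  obtain ⟨f, i, rfl, hf⟩ := hex
  have hother : ∀ j, ∃ C ∈ F, block f j ⊆ C ∧ C ≠ B := by
    intro j
    by_contra! hcon
    exact hf j (mem_ownSubsets.2
      ⟨Finset.mem_powersetCard.2 ⟨block_subset f j, card_block f j⟩, hcon⟩)
  choose a haF ha haB using hother
  refine ⟨(Finset.univ.erase i).image a, ?_, ?_, ?_, ?_⟩
  · exact Finset.image_subset_iff.2 fun j _ => haF j
  · exact Finset.card_image_le.trans (by simp)
  · simp only [Finset.mem_image, not_exists, not_and]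
    exact fun j _ => haB j
  · intro x hx hxT
    obtain ⟨j, hj⟩ := exists_mem_block f hx
    refine ⟨a j, Finset.mem_image_of_mem _ (Finset.mem_erase.2 ⟨?_, Finset.mem_univ _⟩), ha j hj⟩
    rintro rfl
    exact hxT hj

theorem IsCancellative.mem_forcingSubsets_or [DecidableEq α] {F : Finset (Finset α)} {t k : ℕ}
    (hF : IsCancellative (2 * (t - 1)) F) {T B C : Finset α} (hB : B ∈ F) (hC : C ∈ F)
    (hTB : T ⊆ B) (hTC : T ⊆ C) (hT : T.card = k) (hBC : B ≠ C) :
    T ∈ forcingSubsets F t k B ∨ T ∈ forcingSubsets F t k C := by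
  by_contra! hcon
  obtain ⟨𝒜, h𝒜F, h𝒜t, hB𝒜, h𝒜⟩ := exists_cover_of_notMem_forcingSubsets
    (Finset.mem_powersetCard.2 ⟨hTB, hT⟩)
    (fun h => hBC ((mem_ownSubsets.1 h).2 C hC hTC).symm) hcon.1
  obtain ⟨ℬ, hℬF, hℬt, hCℬ, hℬ⟩ := exists_cover_of_notMem_forcingSubsets
    (Finset.mem_powersetCard.2 ⟨hTC, hT⟩)
    (fun h => hBC ((mem_ownSubsets.1 h).2 B hB hTB)) hcon.2
  refine hF (𝒜.erase C ∪ ℬ.erase B) (Finset.union_subset ((Finset.erase_subset _ _).trans h𝒜F)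
    ((Finset.erase_subset _ _).trans hℬF)) ?_ B hB C hC ?_ ?_ hBC fun x hx => ?_
  · have h1 := Finset.card_union_le (𝒜.erase C) (ℬ.erase B)
    have h2 := Finset.card_le_card (Finset.erase_subset C 𝒜)
    have h3 := Finset.card_le_card (Finset.erase_subset B ℬ)
    omega
  · simp [hB𝒜]
  · simp [hCℬ]
  · rw [Finset.mem_sup]
    rcases Finset.mem_union.1 hx with hx | hx <;> obtain ⟨hx, hx'⟩ := Finset.mem_sdiff.1 hx
    · obtain ⟨A, hA, hxA⟩ := h𝒜 x hx fun h => hx' (hTC h)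
      exact ⟨A, Finset.mem_union_left _ (Finset.mem_erase.2 ⟨by rintro rfl; exact hx' hxA, hA⟩),
        hxA⟩
    · obtain ⟨A, hA, hxA⟩ := hℬ x hx fun h => hx' (hTB h)
      exact ⟨A, Finset.mem_union_right _ (Finset.mem_erase.2 ⟨by rintro rfl; exact hx' hxA, hA⟩),
        hxA⟩

theorem IsCancellative.degree_sub_one_le [DecidableEq α] {F : Finset (Finset α)} {t k : ℕ}
    (hF : IsCancellative (2 * (t - 1)) F) {T : Finset α} (hT : T.card = k) :
    (F.filter fun A => T ⊆ A).card - 1 ≤ (F.filter fun A => T ∈ forcingSubsets F t k A).card := by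
  have hle : ((F.filter fun A => T ⊆ A).filter fun A => T ∉ forcingSubsets F t k A).card ≤ 1 := by
    refine Finset.card_le_one.2 fun B hB C hC => ?_
    simp only [Finset.mem_filter] at hB hC
    by_contra hBC
    rcases hF.mem_forcingSubsets_or hB.1.1 hC.1.1 hB.1.2 hC.1.2 hT hBC with h | h
    · exact hB.2 h
    · exact hC.2 h
  have hsplit := Finset.card_filter_add_card_filter_not (s := F.filter fun A => T ⊆ A)
    (fun A => T ∈ forcingSubsets F t k A)
  have hmono : ((F.filter fun A => T ⊆ A).filter fun A => T ∈ forcingSubsets F t k A).card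
      ≤ (F.filter fun A => T ∈ forcingSubsets F t k A).card :=
    Finset.card_le_card (Finset.filter_subset_filter _ (Finset.filter_subset _ _))
  omega

/-- For a `2(t-1)`-cancellative `tk`-graph `F` on `[n]`,
`Σ_{s ≥ 2} (s-1) · |D(F, s)| ≤ (t-1) · C(n, k)`, where `D(F, s)` is the family of `k`-subsets
of `[n]` contained in exactly `s` edges of `F`. -/
theorem cancellative_degree_sum (t k n : ℕ) (ht : 2 ≤ t) (hk : 2 ≤ k)
    (F : Finset (Finset (Fin n))) (hF : ∀ A ∈ F, A.card = t * k)
    (hcanc : IsCancellative (2 * (t - 1)) F) :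
    ∑ s ∈ Finset.Icc 2 F.card,
        (s - 1) *
          ((Finset.powersetCard k (Finset.univ : Finset (Fin n))).filter
            (fun T => (F.filter fun A => T ⊆ A).card = s)).card
      ≤ (t - 1) * n.choose k := by
  set P := Finset.powersetCard k (Finset.univ : Finset (Fin n)) with hP
  have hcount : ∀ (N : Finset (Fin n) → Finset (Finset (Fin n))),
      (∀ A ∈ F, N A ⊆ Finset.powersetCard k A) →
      ∑ T ∈ P, (F.filter fun A => T ∈ N A).card = ∑ A ∈ F, (N A).card := by
    intro N hN
    refine (Finset.sum_card_bipartiteAbove_eq_sum_card_bipartiteBelow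
      (fun T A => T ∈ N A)).trans ?_
    refine Finset.sum_congr rfl fun A hA => ?_
    congr 1
    ext T
    simp only [Finset.bipartiteBelow, Finset.mem_filter, hP, Finset.mem_powersetCard,
      Finset.subset_univ, true_and, and_iff_right_iff_imp]
    exact fun h => (Finset.mem_powersetCard.1 (hN A hA h)).2
  calc _ = ∑ s ∈ Finset.Icc 2 F.card, ∑ T ∈ P.filter
          (fun T => (F.filter fun A => T ⊆ A).card = s), ((F.filter fun A => T ⊆ A).card - 1) := by
        refine Finset.sum_congr rfl fun s _ => ?_
        rw [Finset.sum_congr rfl fun T hT => by rw [(Finset.mem_filter.1 hT).2],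
          Finset.sum_const, smul_eq_mul, mul_comm]
    _ ≤ ∑ T ∈ P, ((F.filter fun A => T ⊆ A).card - 1) := by
        rw [Finset.sum_fiberwise_eq_sum_filter]
        exact Finset.sum_le_sum_of_subset (Finset.filter_subset _ _)
    _ ≤ ∑ T ∈ P, (F.filter fun A => T ∈ forcingSubsets F t k A).card :=
        Finset.sum_le_sum fun T hT => hcanc.degree_sub_one_le (Finset.mem_powersetCard.1 hT).2
    _ = ∑ A ∈ F, (forcingSubsets F t k A).card :=
        hcount _ fun A _ => forcingSubsets_subset F t k A
    _ ≤ ∑ A ∈ F, (t - 1) * (ownSubsets F k A).card :=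
        Finset.sum_le_sum fun A hA => card_forcingSubsets_le (by omega) (hF A hA)
    _ = (t - 1) * ∑ T ∈ P, (F.filter fun A => T ∈ ownSubsets F k A).card := by
        rw [← Finset.mul_sum, hcount (ownSubsets F k) fun A _ => ownSubsets_subset F k A]
    _ ≤ (t - 1) * ∑ T ∈ P, 1 := by
        refine Nat.mul_le_mul_left _ (Finset.sum_le_sum fun T _ => ?_)
        refine Finset.card_le_one.2 fun A hA B hB => ?_
        obtain ⟨hA, hTA⟩ := Finset.mem_filter.1 hA
        obtain ⟨-, hTB⟩ := Finset.mem_filter.1 hB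
        have hTB := mem_ownSubsets.1 hTB
        have hTA := mem_ownSubsets.1 hTA
        exact hTB.2 A hA (Finset.mem_powersetCard.1 hTA.1).1
    _ = (t - 1) * n.choose k := by simp [hP]
end
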